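/- Let p be an odd prime number, P = 2p or p chosen so that P ≢ ±1 (mod 9), π = P^{1/3}, ε the fundamental unit of K = ℚ(π), and ι ∈ {1,2} defined as in the standing setup. Let l be a prime number not dividing P with l ≡ 2 (mod 3), and let m ≥ 1 be an integer. Assume there exist integers a, b, c such that: (1) l = a³ + b³P^ι + c³P^{2ι} − 3abcP^ι; (2) defining integers A_k, B_k, C_k for each k ∈ ℤ by A_k + B_k π^ι + C_k π^{2ι} = ε^k (a + bπ^ι + cπ^{2ι})^m, one has C_k ≢ 0 (mod p) for every k ∈ ℤ. Then for every integer n ≥ 5 divisible by p^ι, every primitive triple (x,y,z) ∈ ℤ³ with x³ + P^ι y³ = l^m z^n satisfies x ≡ y ≡ 0 (mod l). -/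

import Mathlib

/-- The real cube root of a natural number. -/
noncomputable def cbrt (P : ℕ) : ℝ := (P : ℝ) ^ ((1 : ℝ) / 3)

/-- `u` belongs to the order `ℤ[P^{1/3}]` of `ℚ(P^{1/3})`. -/
def InOrder (P : ℕ) (u : ℝ) : Prop :=
  ∃ x y z : ℤ, u = (x : ℝ) + (y : ℝ) * cbrt P + (z : ℝ) * (cbrt P) ^ 2

/-- `u` is a unit of the order `ℤ[P^{1/3}]`. -/
def IsUnitOfOrder (P : ℕ) (u : ℝ) : Prop :=
  InOrder P u ∧ ∃ v : ℝ, InOrder P v ∧ u * v = 1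

/-- `ε` is the fundamental unit of `ℚ(P^{1/3})` (whose ring of integers is `ℤ[P^{1/3}]`
since `P ≢ ±1 mod 9`): the smallest unit greater than `1`, equivalently the generator
greater than `1` of the unit group modulo `±1`. -/
def IsFundamentalUnit (P : ℕ) (ε : ℝ) : Prop :=
  IsUnitOfOrder P ε ∧ 1 < ε ∧ ∀ u : ℝ, IsUnitOfOrder P u → 1 < u → ε ≤ u

section PureCubicFields

open Polynomial NumberField

theorem squarefree_of_eq_two_mul_or_eq {P p : ℕ} (hp : p.Prime) (hpodd : Odd p)
    (hP : P = 2 * p ∨ P = p) : Squarefree P := by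
  rcases hP with rfl | rfl
  · exact (Nat.squarefree_mul (Nat.coprime_two_left.2 hpodd)).2
      ⟨Nat.prime_two.squarefree, hp.squarefree⟩
  · exact hp.squarefree

theorem Subalgebra.mem_of_nat_smul_mem {L : Type*} [CommRing L] (A : Subalgebra ℤ L) (N : ℕ)
    (hN : N ≠ 0)
    (H : ∀ q : ℕ, q.Prime → q ∣ N → ∀ z : L, IsIntegral ℤ z → (q : ℤ) • z ∈ A → z ∈ A) :
    ∀ z : L, IsIntegral ℤ z → (N : ℤ) • z ∈ A → z ∈ A := by
  induction N using Nat.recOnMul with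
  | zero => exact absurd rfl hN
  | one => intro z _ h; simpa using h
  | prime q hq => exact H q hq dvd_rfl
  | mul a b iha ihb =>
    intro z hz h
    have ha : a ≠ 0 := left_ne_zero_of_mul hN
    have hb : b ≠ 0 := right_ne_zero_of_mul hN
    refine ihb hb (fun q hq hd => H q hq (hd.mul_left a)) z hz ?_
    refine iha ha (fun q hq hd => H q hq (hd.mul_right b)) _ (hz.smul _) ?_
    rwa [smul_smul, ← Nat.cast_mul]

theorem isEisensteinAt_cubic {q : ℕ} (hq : q.Prime) {a b c : ℤ} (ha : (q : ℤ) ∣ a)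
    (hb : (q : ℤ) ∣ b) (hc : (q : ℤ) ∣ c) (hc2 : ¬ (q : ℤ) ^ 2 ∣ c) :
    (X ^ 3 + C a * X ^ 2 + C b * X + C c).IsEisensteinAt (Ideal.span {(q : ℤ)}) := by
  have hd : (X ^ 3 + C a * X ^ 2 + C b * X + C c : ℤ[X]).natDegree = 3 := by compute_degree!
  refine ⟨?_, ?_, ?_⟩
  · rw [leadingCoeff, hd, Ideal.mem_span_singleton]
    simp [-eq_intCast]
    intro h
    have := Int.le_of_dvd one_pos h
    have := hq.two_le
    omega
  · intro n hn
    rw [hd] at hn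
    rw [Ideal.mem_span_singleton]
    interval_cases n <;> simp [coeff_X, coeff_C, ha, hb, hc, -eq_intCast]
  · rw [Ideal.span_singleton_pow, Ideal.mem_span_singleton]
    simpa [coeff_X, coeff_C, -eq_intCast] using hc2

theorem Squarefree.exists_prime_isEisensteinAt {P q : ℕ} (hsq : Squarefree P) (hq : q.Prime)
    (hqP : q ∣ P) : (X ^ 3 - C (P : ℤ)).IsEisensteinAt (Ideal.span {(q : ℤ)}) := by
  have h := isEisensteinAt_cubic (a := 0) (b := 0) (c := -P) hq (dvd_zero _) (dvd_zero _)
    ((dvd_neg).2 (by exact_mod_cast hqP)) (by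
      rw [dvd_neg]; intro h
      have h' : q * q ∣ P := by rw [← sq]; exact_mod_cast h
      exact hq.one_lt.ne' (Nat.isUnit_iff.1 (hsq q h')))
  simpa [sub_eq_add_neg] using h

theorem Squarefree.irreducible_X_pow_three_sub {P : ℕ} (hP : 1 < P) (hsq : Squarefree P) :
    Irreducible (X ^ 3 - C (P : ℤ)) := by
  have hm : (X ^ 3 - C (P : ℤ)).Monic := monic_X_pow_sub_C _ (by norm_num)
  have hq : P.minFac.Prime := Nat.minFac_prime hP.ne'
  refine (hsq.exists_prime_isEisensteinAt hq P.minFac_dvd).irreducible ?_ hm.isPrimitive ?_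
  · exact (Ideal.span_singleton_prime (by exact_mod_cast hq.ne_zero)).2
      (Nat.prime_iff_prime_int.1 hq)
  · rw [natDegree_X_pow_sub_C]; norm_num

theorem minpoly_int_eq_of_irreducible {L : Type*} [Field L] [CharZero L] {x : L} {f : ℤ[X]}
    (hm : f.Monic) (hirr : Irreducible f) (hx : aeval x f = 0) : minpoly ℤ x = f := by
  have hint : IsIntegral ℤ x := ⟨f, hm, by simpa [aeval_def] using hx⟩
  have hd := minpoly.isIntegrallyClosed_dvd hint hx
  have h2 := (minpoly.irreducible hint).dvd_symm hirr hd
  exact eq_of_monic_of_associated (minpoly.monic hint) hm (associated_of_dvd_dvd hd h2)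

/-- In a field generated by a cube root of a squarefree `P ≢ ±1 (mod 9)` every algebraic integer
is an integral polynomial in that root. -/
theorem mem_adjoin_of_isIntegral_of_cubic {P : ℕ} (hP : 1 < P) (hsq : Squarefree P)
    (hP9 : P % 9 ≠ 1 ∧ P % 9 ≠ 8) {L : Type*} [Field L] [NumberField L] (B : PowerBasis ℚ L)
    (hB : B.gen ^ 3 = P) (hdim : B.dim = 3) {z : L} (hz : IsIntegral ℤ z) :
    z ∈ Algebra.adjoin ℤ {B.gen} := by
  have hirr := hsq.irreducible_X_pow_three_sub hP
  have hm : (X ^ 3 - C (P : ℤ)).Monic := monic_X_pow_sub_C _ (by norm_num)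
  have hroot : aeval B.gen (X ^ 3 - C (P : ℤ)) = 0 := by simp [hB]
  have hint : IsIntegral ℤ B.gen := ⟨_, hm, by simpa [aeval_def] using hroot⟩
  have hminZ := minpoly_int_eq_of_irreducible hm hirr hroot
  have hminQ : minpoly ℚ B.gen = X ^ 3 - C (P : ℚ) := by
    rw [minpoly.isIntegrallyClosed_eq_field_fractions' ℚ hint, hminZ]; simp
  have hdisc : Algebra.discr ℚ B.basis = -27 * P ^ 2 := by
    have hN : Algebra.norm ℚ B.gen = P := by
      rw [Algebra.PowerBasis.norm_gen_eq_coeff_zero_minpoly, hminQ, hdim]; norm_num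
    have hfr : Module.finrank ℚ L = 3 := by rw [B.finrank, hdim]
    have hder : aeval B.gen (derivative (X ^ 3 - C (P : ℚ))) = algebraMap ℚ L 3 * B.gen ^ 2 := by
      simp
      norm_num
    rw [Algebra.discr_powerBasis_eq_norm, hminQ, hfr, hder, map_mul, map_pow, hN,
      Algebra.norm_algebraMap, hfr]
    norm_num
  have h1 := Algebra.discr_mul_isIntegral_mem_adjoin ℚ hint hz
  have h2 : ((27 * P ^ 2 : ℕ) : ℤ) • z ∈ Algebra.adjoin ℤ {B.gen} := by
    rw [hdisc] at h1
    have := neg_mem h1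
    convert this using 1
    rw [zsmul_eq_mul, Algebra.smul_def]
    simp
  refine Subalgebra.mem_of_nat_smul_mem _ _ (by positivity) ?_ z hz h2
  intro q hq hqd w hw hwq
  by_cases hqP : q ∣ P
  · refine mem_adjoin_of_smul_prime_smul_of_minpoly_isEisensteinAt (Nat.prime_iff_prime_int.1 hq)
      hint hw hwq ?_
    rw [hminZ]
    exact hsq.exists_prime_isEisensteinAt hq hqP
  · have hq3 : q = 3 := by
      have : q ∣ 3 := by
        have : q ∣ 3 ^ 3 := by
          refine (hq.dvd_mul.1 hqd).resolve_right fun h => hqP (hq.dvd_of_dvd_pow h)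
        exact hq.dvd_of_dvd_pow this
      exact (Nat.prime_dvd_prime_iff_eq hq Nat.prime_three).1 this
    subst hq3
    have hadj : Algebra.adjoin ℤ {B.gen - (P : L)} = Algebra.adjoin ℤ {B.gen} := by
      have hPm : ∀ S : Subalgebra ℤ L, (P : L) ∈ S := fun S => natCast_mem S P
      apply le_antisymm <;> rw [Algebra.adjoin_le_iff, Set.singleton_subset_iff]
      · exact sub_mem (Algebra.subset_adjoin rfl) (hPm _)
      · have := add_mem (Algebra.subset_adjoin (R := ℤ) (Set.mem_singleton (B.gen - (P : L)))) (hPm _)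
        simpa using this
    have hEis : (X ^ 3 + C (3 * P : ℤ) * X ^ 2 + C (3 * P ^ 2 : ℤ) * X +
        C (P ^ 3 - P : ℤ)).IsEisensteinAt (Ideal.span {((3 : ℕ) : ℤ)}) := by
      have h9 : ∀ r : ℤ, P = r → (3 : ℤ) ∣ r ^ 3 - r ∧ ¬ (3 : ℤ) ^ 2 ∣ r ^ 3 - r := by
        rintro r rfl
        have : P % 9 = 2 ∨ P % 9 = 4 ∨ P % 9 = 5 ∨ P % 9 = 7 := by omega
        obtain ⟨k, hk⟩ : ∃ k : ℤ, (P : ℤ) = 9 * k + (P % 9 : ℕ) := ⟨P / 9, by omega⟩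
        constructor
        · rcases this with h | h | h | h <;> rw [h] at hk <;> rw [hk] <;> push_cast <;> ring_nf <;>
            omega
        · rcases this with h | h | h | h <;> rw [h] at hk <;> rw [hk] <;> push_cast <;> ring_nf <;>
            omega
      exact isEisensteinAt_cubic Nat.prime_three ⟨P, by simp⟩ ⟨P ^ 2, by simp⟩ (h9 _ rfl).1
        (h9 _ rfl).2
    have htop : Algebra.adjoin ℚ {B.gen - (P : L)} = ⊤ := by
      rw [eq_top_iff, ← B.adjoin_gen_eq_top, Algebra.adjoin_le_iff, Set.singleton_subset_iff]
      have := add_mem (Algebra.subset_adjoin (R := ℚ) (Set.mem_singleton (B.gen - (P : L))))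
        (natCast_mem _ P)
      simpa using this
    have hint' : IsIntegral ℤ (B.gen - (P : L)) := 
      hint.sub (by simpa using isIntegral_algebraMap (R := ℤ) (A := L) (x := (P : ℤ)))
    let B' := PowerBasis.ofAdjoinEqTop (hint'.tower_top (A := ℚ)) htop
    have hB' : B'.gen = B.gen - (P : L) := PowerBasis.ofAdjoinEqTop_gen _ _
    rw [← hadj, ← hB'] at hwq ⊢
    refine mem_adjoin_of_smul_prime_smul_of_minpoly_isEisensteinAt (Nat.prime_iff_prime_int.1 hq)
      (hB' ▸ hint') hw hwq ?_
    have hmm : (X ^ 3 + C (3 * P : ℤ) * X ^ 2 + C (3 * P ^ 2 : ℤ) * X + C (P ^ 3 - P : ℤ)).Monic := by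
      monicity!
    have : minpoly ℤ B'.gen = X ^ 3 + C (3 * P : ℤ) * X ^ 2 + C (3 * P ^ 2 : ℤ) * X +
        C (P ^ 3 - P : ℤ) := by
      refine minpoly_int_eq_of_irreducible hmm (hEis.irreducible ?_ hmm.isPrimitive ?_) ?_
      · exact (Ideal.span_singleton_prime (by norm_num)).2 (Nat.prime_iff_prime_int.1 hq)
      · rw [show (X ^ 3 + C (3 * P : ℤ) * X ^ 2 + C (3 * P ^ 2 : ℤ) * X +
          C (P ^ 3 - P : ℤ) : ℤ[X]).natDegree = 3 by compute_degree!]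
        norm_num
      · rw [hB']
        simp only [map_add, map_mul, map_pow, aeval_X, map_sub, map_natCast, map_ofNat]
        linear_combination hB
    rw [this]
    exact hEis

theorem cbrt_pow_three (P : ℕ) : cbrt P ^ 3 = P := by
  rw [cbrt, ← Real.rpow_natCast, ← Real.rpow_mul (by positivity)]
  norm_num

/-- A number field whose ring of integers is `ℤ[π]` with `π` a cube root of `P`, together with
its real embedding. -/
structure PureCubic (P : ℕ) (K : Type*) [Field K] [NumberField K] where
  /-- the cube root of `P` -/
  rt : 𝓞 K
  rt_pow : rt ^ 3 = P
  /-- the power basis of the ring of integers -/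
  basis : Module.Basis (Fin 3) ℤ (𝓞 K)
  basis_apply : ∀ i, basis i = rt ^ (i : ℕ)
  /-- the real embedding -/
  re : K →+* ℝ
  re_rt : re rt = cbrt P

theorem exists_pureCubic {P : ℕ} (hP : 1 < P) (hsq : Squarefree P)
    (hP9 : P % 9 ≠ 1 ∧ P % 9 ≠ 8) :
    ∃ (K : Type) (_ : Field K) (_ : NumberField K), Nonempty (PureCubic P K) := by
  have hirr := hsq.irreducible_X_pow_three_sub hP
  have hm : (X ^ 3 - C (P : ℤ)).Monic := monic_X_pow_sub_C _ (by norm_num)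
  have hroot : aeval (cbrt P) (X ^ 3 - C (P : ℤ)) = 0 := by simp [cbrt_pow_three]
  have hintZ : IsIntegral ℤ (cbrt P) := ⟨_, hm, by simpa [aeval_def] using hroot⟩
  have hint : IsIntegral ℚ (cbrt P) := hintZ.tower_top
  have hminZ := minpoly_int_eq_of_irreducible hm hirr hroot
  have hminQ : minpoly ℚ (cbrt P) = X ^ 3 - C (P : ℚ) := by
    rw [minpoly.isIntegrallyClosed_eq_field_fractions' ℚ hintZ, hminZ]; simp
  let L := IntermediateField.adjoin ℚ {cbrt P}
  have : FiniteDimensional ℚ L := IntermediateField.adjoin.finiteDimensional hint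
  have : NumberField L := ⟨⟩
  let B : PowerBasis ℚ L := IntermediateField.adjoin.powerBasis hint
  have hBr : (B.gen : ℝ) = cbrt P := IntermediateField.AdjoinSimple.coe_gen ℚ (cbrt P)
  have hB3 : B.gen ^ 3 = P := by
    apply Subtype.ext
    push_cast
    rw [hBr, cbrt_pow_three]
  have hdim : B.dim = 3 := by
    rw [IntermediateField.adjoin.powerBasis_dim, hminQ, natDegree_X_pow_sub_C]
  have hintB : IsIntegral ℤ B.gen := ⟨_, hm, by simp [hB3]⟩
  let rt : 𝓞 L := ⟨B.gen, hintB⟩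
  have hrt3 : rt ^ 3 = P := by
    apply RingOfIntegers.ext
    push_cast
    exact hB3
  have hspan : ∀ w : 𝓞 L, ∃ x y z : ℤ, w = x + y * rt + z * rt ^ 2 := by
    intro w
    have hw := mem_adjoin_of_isIntegral_of_cubic hP hsq hP9 B hB3 hdim w.isIntegral_coe
    suffices ∀ v ∈ Algebra.adjoin ℤ {B.gen}, ∃ x y z : ℤ, v = x + y * B.gen + z * B.gen ^ 2 by
      obtain ⟨x, y, z, h⟩ := this _ hw
      refine ⟨x, y, z, RingOfIntegers.ext ?_⟩
      push_cast
      exact h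
    intro v hv
    induction hv using Algebra.adjoin_induction with
    | mem x hx => exact ⟨0, 1, 0, by simpa using hx⟩
    | algebraMap r => exact ⟨r, 0, 0, by simp⟩
    | add u v _ _ hu hv =>
      obtain ⟨a, b, c, rfl⟩ := hu
      obtain ⟨a', b', c', rfl⟩ := hv
      exact ⟨a + a', b + b', c + c', by push_cast; ring⟩
    | mul u v _ _ hu hv =>
      obtain ⟨a, b, c, rfl⟩ := hu
      obtain ⟨a', b', c', rfl⟩ := hv
      refine ⟨a * a' + P * (b * c' + c * b'), a * b' + b * a' + P * c * c',
        a * c' + b * b' + c * a', ?_⟩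
      push_cast
      linear_combination (b * c' + c * b' + c * c' * B.gen) * hB3
  have hli : LinearIndependent ℤ fun i : Fin 3 => rt ^ (i : ℕ) := by
    have h1 : LinearIndependent ℤ fun i : Fin B.dim => B.gen ^ (i : ℕ) := by
      have := B.basis.linearIndependent.restrict_scalars' ℤ
      simpa [B.coe_basis] using this
    rw [hdim] at h1
    have h2 : (fun i : Fin 3 => B.gen ^ (i : ℕ)) =
        (Algebra.linearMap (𝓞 L) L).restrictScalars ℤ ∘ fun i : Fin 3 => rt ^ (i : ℕ) := by
      funext i
      exact (map_pow (algebraMap (𝓞 L) L) rt i).symm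
    rw [h2] at h1
    exact LinearIndependent.of_comp _ h1
  refine ⟨L, inferInstance, inferInstance, ⟨⟨rt, hrt3, Module.Basis.mk hli ?_, ?_,
    algebraMap L ℝ, hBr⟩⟩⟩
  · rintro w -
    obtain ⟨x, y, z, rfl⟩ := hspan w
    have hmem : ∀ i : Fin 3, rt ^ (i : ℕ) ∈
        Submodule.span ℤ (Set.range fun i : Fin 3 => rt ^ (i : ℕ)) :=
      fun i => Submodule.subset_span ⟨i, rfl⟩
    have h0 := Submodule.smul_mem _ x (hmem 0)
    have h1 := Submodule.smul_mem _ y (hmem 1)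
    have h2 := Submodule.smul_mem _ z (hmem 2)
    have := Submodule.add_mem _ (Submodule.add_mem _ h0 h1) h2
    simpa [zsmul_eq_mul] using this
  · intro i; simp

namespace PureCubic

variable {P : ℕ} {K : Type*} [Field K] [NumberField K] (h : PureCubic P K)

/-- The algebraic integer `x + y π + z π²`. -/
def elt (x y z : ℤ) : 𝓞 K := x + y * h.rt + z * h.rt ^ 2

theorem elt_eq_sum (x y z : ℤ) : h.elt x y z = ∑ i, ![x, y, z] i • h.basis i := by
  simp [Fin.sum_univ_three, h.basis_apply, elt, zsmul_eq_mul]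

theorem repr_elt (x y z : ℤ) : ⇑(h.basis.repr (h.elt x y z)) = ![x, y, z] := by
  rw [elt_eq_sum, h.basis.repr_sum_self]

theorem exists_elt (w : 𝓞 K) : ∃ x y z, w = h.elt x y z := by
  refine ⟨h.basis.repr w 0, h.basis.repr w 1, h.basis.repr w 2, ?_⟩
  conv_lhs => rw [← h.basis.sum_repr w]
  rw [elt_eq_sum]
  refine Finset.sum_congr rfl fun i _ => ?_
  fin_cases i <;> rfl

theorem elt_inj {x y z x' y' z' : ℤ} :
    h.elt x y z = h.elt x' y' z' ↔ x = x' ∧ y = y' ∧ z = z' := by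
  constructor
  · intro e
    have := congrArg (fun w => ⇑(h.basis.repr w)) e
    simp only [repr_elt] at this
    exact ⟨congrFun this 0, congrFun this 1, congrFun this 2⟩
  · rintro ⟨rfl, rfl, rfl⟩; rfl

theorem elt_mul (a b c x y z : ℤ) : h.elt a b c * h.elt x y z =
    h.elt (a * x + P * (b * z + c * y)) (a * y + b * x + P * c * z) (a * z + b * y + c * x) := by
  have := h.rt_pow
  simp only [elt]
  push_cast
  linear_combination (b * z + c * y + c * z * h.rt) * this

theorem intCast_eq_elt (x : ℤ) : (x : 𝓞 K) = h.elt x 0 0 := by simp [elt]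

theorem leftMulMatrix_elt (x y z : ℤ) : Algebra.leftMulMatrix h.basis (h.elt x y z) =
    !![x, P * z, P * y; y, x, P * z; z, y, x] := by
  have hb0 : h.basis 0 = h.elt 1 0 0 := by simp [h.basis_apply, elt]
  have hb1 : h.basis 1 = h.elt 0 1 0 := by simp [h.basis_apply, elt]
  have hb2 : h.basis 2 = h.elt 0 0 1 := by simp [h.basis_apply, elt]
  ext i j
  rw [Algebra.leftMulMatrix_eq_repr_mul]
  fin_cases j
  · simp only [Fin.zero_eta, hb0, elt_mul, repr_elt]; fin_cases i <;> simp
  · simp only [Fin.mk_one, hb1, elt_mul, repr_elt]; fin_cases i <;> simp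
  · simp only [Fin.reduceFinMk, hb2, elt_mul, repr_elt]; fin_cases i <;> simp

theorem norm_elt (x y z : ℤ) :
    Algebra.norm ℤ (h.elt x y z) = x ^ 3 + P * y ^ 3 + P ^ 2 * z ^ 3 - 3 * P * x * y * z := by
  rw [Algebra.norm_eq_matrix_det h.basis, leftMulMatrix_elt, Matrix.det_fin_three]
  simp
  ring

theorem trace_elt (x y z : ℤ) : Algebra.trace ℤ (𝓞 K) (h.elt x y z) = 3 * x := by
  rw [Algebra.trace_eq_matrix_trace h.basis, leftMulMatrix_elt, Matrix.trace_fin_three]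
  simp
  ring

include h in
theorem finrank_eq : Module.finrank ℚ K = 3 := by
  rw [← RingOfIntegers.rank, Module.finrank_eq_card_basis h.basis, Fintype.card_fin]

include h in
theorem discr_eq : NumberField.discr K = -27 * P ^ 2 := by
  rw [← NumberField.discr_eq_discr K h.basis, Algebra.discr_def]
  have hb0 : h.basis 0 = h.elt 1 0 0 := by simp [h.basis_apply, elt]
  have hb1 : h.basis 1 = h.elt 0 1 0 := by simp [h.basis_apply, elt]
  have hb2 : h.basis 2 = h.elt 0 0 1 := by simp [h.basis_apply, elt]
  rw [Matrix.det_fin_three]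
  simp only [Algebra.traceMatrix_apply, Algebra.traceForm_apply, hb0, hb1, hb2, elt_mul, trace_elt]
  ring

theorem re_elt (x y z : ℤ) : h.re (h.elt x y z : 𝓞 K) = x + y * cbrt P + z * cbrt P ^ 2 := by
  simp [elt, h.re_rt]

include h in
theorem ringHom_ext {R : Type*} [CommRing R] {f g : K →+* R} (hfg : f h.rt = g h.rt) : f = g := by
  refine IsLocalization.ringHom_ext (nonZeroDivisors (𝓞 K)) (RingHom.ext fun w => ?_)
  obtain ⟨x, y, z, rfl⟩ := h.exists_elt w
  simp [elt, hfg]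

theorem isReal_re : (InfinitePlace.mk (Complex.ofRealHom.comp h.re)).IsReal := by
  refine ⟨_, ?_, rfl⟩
  rw [ComplexEmbedding.isReal_iff]
  ext x
  simp [ComplexEmbedding.conjugate]

include h in
theorem nrRealPlaces_eq : InfinitePlace.nrRealPlaces K = 1 := by
  classical
  rw [InfinitePlace.nrRealPlaces, Fintype.card_eq_one_iff]
  refine ⟨⟨_, h.isReal_re⟩, fun ⟨w, hw⟩ => ?_⟩
  obtain ⟨φ, hφ, rfl⟩ := hw
  have h3 : φ h.rt ^ 3 = P := by
    have := congrArg (fun w : 𝓞 K => φ w) h.rt_pow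
    simpa using this
  refine Subtype.ext (congrArg InfinitePlace.mk (h.ringHom_ext ?_))
  have hr : starRingEnd ℂ (φ h.rt) = φ h.rt := by
    have := congrArg (fun f => f (h.rt : K)) (ComplexEmbedding.isReal_iff.1 hφ)
    simpa [ComplexEmbedding.conjugate] using this
  obtain ⟨r, hr⟩ := Complex.conj_eq_iff_real.1 hr
  rw [hr] at h3 ⊢
  have h3' : r ^ 3 = P := by exact_mod_cast h3
  simp only [RingHom.coe_comp, Function.comp_apply, h.re_rt, Complex.ofRealHom_eq_coe]
  congr 1
  rw [← cbrt_pow_three] at h3'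
  exact (Odd.strictMono_pow (by decide : Odd 3)).injective h3'

include h in
theorem nrComplexPlaces_eq : InfinitePlace.nrComplexPlaces K = 1 := by
  have := InfinitePlace.card_add_two_mul_card_eq_rank K
  rw [h.nrRealPlaces_eq, h.finrank_eq] at this
  omega

theorem exists_complex_embedding : ∃ (φ : K →+* ℂ) (s : ℝ), s ^ 2 = 3 / 4 ∧
    φ h.rt = cbrt P * (-1 / 2 + s * Complex.I) ∧ (InfinitePlace.mk φ).IsComplex := by
  classical
  have h1 := h.nrComplexPlaces_eq
  rw [InfinitePlace.nrComplexPlaces, Fintype.card_eq_one_iff] at h1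
  obtain ⟨⟨w, hw⟩, -⟩ := h1
  have hφ := InfinitePlace.isComplex_iff.1 hw
  set φ := w.embedding
  have h3 : φ h.rt ^ 3 = (cbrt P : ℂ) ^ 3 := by
    have := congrArg (fun w : 𝓞 K => φ w) h.rt_pow
    rw [← Complex.ofReal_pow, cbrt_pow_three]
    simpa using this
  have hne : φ h.rt ≠ (cbrt P : ℂ) := by
    intro e
    apply hφ
    have : φ = Complex.ofRealHom.comp h.re := h.ringHom_ext (by simp [e, h.re_rt])
    rw [this, ComplexEmbedding.isReal_iff]
    ext x
    simp [ComplexEmbedding.conjugate]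
  have hquad : φ h.rt ^ 2 + φ h.rt * cbrt P + (cbrt P : ℂ) ^ 2 = 0 := by
    have : (φ h.rt - cbrt P) * (φ h.rt ^ 2 + φ h.rt * cbrt P + (cbrt P : ℂ) ^ 2) = 0 := by
      linear_combination h3
    exact (mul_eq_zero.1 this).resolve_left (sub_ne_zero.2 hne)
  have hs : (√3 / 2 : ℝ) ^ 2 = 3 / 4 := by
    rw [div_pow, Real.sq_sqrt (by norm_num)]; norm_num
  have hsC : ((√3 / 2 : ℝ) : ℂ) ^ 2 = 3 / 4 := by rw [← Complex.ofReal_pow, hs]; simp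
  have hI := Complex.I_sq
  have hfac : (φ h.rt - cbrt P * (-1 / 2 + (√3 / 2 : ℝ) * Complex.I)) *
      (φ h.rt - cbrt P * (-1 / 2 + (-(√3 / 2) : ℝ) * Complex.I)) = 0 := by
    rw [Complex.ofReal_neg]
    linear_combination hquad + (-(cbrt P : ℂ) ^ 2) * Complex.I ^ 2 * hsC -
      3 / 4 * (cbrt P : ℂ) ^ 2 * hI
  have hwm : InfinitePlace.mk φ = w := InfinitePlace.mk_embedding w
  rcases mul_eq_zero.1 hfac with e | e
  · exact ⟨φ, _, hs, sub_eq_zero.1 e, hwm ▸ hw⟩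
  · exact ⟨φ, -(√3 / 2), by rw [neg_sq, hs], sub_eq_zero.1 e, hwm ▸ hw⟩

end PureCubic

/-- Coprimality facts for a primitive solution of `x³ + Q y³ = l^m z^n` with `l ∤ gcd (x, y)`. -/
theorem isCoprime_of_solution {P ι l m n : ℕ} {x y z : ℤ} (hsq : Squarefree P)
    (hP9 : P % 9 ≠ 1 ∧ P % 9 ≠ 8) (hι : ι = 1 ∨ ι = 2) (hl : l.Prime) (hlP : ¬ l ∣ P)
    (hl3 : l % 3 = 2) (hn : 5 ≤ n)
    (hprim : Int.gcd x (Int.gcd y z) = 1)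
    (heq : x ^ 3 + (P : ℤ) ^ ι * y ^ 3 = (l : ℤ) ^ m * z ^ n)
    (hxy : ¬ ((l : ℤ) ∣ x ∧ (l : ℤ) ∣ y)) :
    IsCoprime (x ^ 3 + (P : ℤ) ^ ι * y ^ 3) (3 * x ^ 2) ∧
      IsCoprime (x ^ 3 + (P : ℤ) ^ ι * y ^ 3) (P : ℤ) := by
  have hz : ∀ q : ℤ, Prime q → ¬ q ∣ l → q ∣ x ^ 3 + (P : ℤ) ^ ι * y ^ 3 →
      q ∣ z ∧ q ^ 5 ∣ x ^ 3 + (P : ℤ) ^ ι * y ^ 3 := by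
    intro q hq hql hqN
    rw [heq] at hqN ⊢
    have hqz : q ∣ z :=
      hq.dvd_of_dvd_pow ((hq.dvd_or_dvd hqN).resolve_left fun h => hql (hq.dvd_of_dvd_pow h))
    exact ⟨hqz, ((pow_dvd_pow q hn).trans (pow_dvd_pow_of_dvd hqz n)).mul_left _⟩
  have hnot : ∀ q : ℤ, Prime q → q ∣ x → ¬ q ∣ y := by
    intro q hq hx hy
    have hqN : q ∣ x ^ 3 + (P : ℤ) ^ ι * y ^ 3 :=
      dvd_add (dvd_pow hx (by norm_num)) ((dvd_pow hy (by norm_num)).mul_left _)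
    by_cases hql : q ∣ l
    · have hass : Associated q l :=
        (hq.dvd_prime_iff_associated (Nat.prime_iff_prime_int.1 hl)).1 hql
      exact hxy ⟨hass.dvd_iff_dvd_left.1 hx, hass.dvd_iff_dvd_left.1 hy⟩
    · have hzq := (hz q hq hql hqN).1
      have : q ∣ Int.gcd x (Int.gcd y z) :=
        Int.dvd_coe_gcd hx (Int.dvd_coe_gcd hy hzq)
      rw [hprim] at this
      exact hq.not_dvd_one (by simpa using this)
  have hP : ∀ q : ℤ, Prime q → q ∣ (P : ℤ) → ¬ q ∣ x ^ 3 + (P : ℤ) ^ ι * y ^ 3 := by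
    intro q hq hqP hqN
    have hqx : q ∣ x := by
      have : q ∣ x ^ 3 := by
        refine (dvd_add_left (Dvd.dvd.mul_right (dvd_pow hqP ?_) _)).1 hqN
        omega
      exact hq.dvd_of_dvd_pow this
    have hql : ¬ q ∣ l := fun hql => hlP <| by
      have hass : Associated q l :=
        (hq.dvd_prime_iff_associated (Nat.prime_iff_prime_int.1 hl)).1 hql
      exact_mod_cast hass.dvd_iff_dvd_left.1 hqP
    have h3 : q ^ 3 ∣ (P : ℤ) ^ ι * y ^ 3 :=
      (dvd_add_right (pow_dvd_pow_of_dvd hqx 3)).1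
        ((pow_dvd_pow q (by norm_num)).trans (hz q hq hql hqN).2)
    have h4 : q ^ 3 ∣ (P : ℤ) ^ ι :=
      (((hq.coprime_iff_not_dvd).2 (hnot q hq hqx)).pow).dvd_of_dvd_mul_right h3
    obtain ⟨k, hk⟩ := hqP
    have hqk : q ∣ k := by
      have h5 : q ^ 3 ∣ (P : ℤ) ^ 2 := h4.trans (pow_dvd_pow _ (by omega))
      rw [hk, mul_pow, pow_succ] at h5
      exact hq.dvd_of_dvd_pow ((mul_dvd_mul_iff_left (pow_ne_zero 2 hq.ne_zero)).1 h5)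
    have hsqZ : Squarefree (P : ℤ) := Int.squarefree_natCast.2 hsq
    obtain ⟨k', rfl⟩ := hqk
    exact hq.not_isUnit (hsqZ q ⟨k', by rw [hk]; ring⟩)
  have h3 : ¬ (3 : ℤ) ∣ x ^ 3 + (P : ℤ) ^ ι * y ^ 3 := by
    intro h
    by_cases h3P : (3 : ℤ) ∣ P
    · exact hP 3 Int.prime_three h3P h
    have h9 : (3 : ℤ) ^ 2 ∣ x ^ 3 + (P : ℤ) ^ ι * y ^ 3 := by
      refine (pow_dvd_pow 3 (by norm_num)).trans (hz 3 Int.prime_three ?_ h).2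
      omega
    have hx3 := hnot 3 Int.prime_three
    have hcube : ∀ t : ℤ, t ^ 3 % 9 = 0 ∨ t ^ 3 % 9 = 1 ∨ t ^ 3 % 9 = 8 := by
      intro t
      have : t % 9 = 0 ∨ t % 9 = 1 ∨ t % 9 = 2 ∨ t % 9 = 3 ∨ t % 9 = 4 ∨ t % 9 = 5 ∨ t % 9 = 6 ∨
        t % 9 = 7 ∨ t % 9 = 8 := by omega
      rcases this with h | h | h | h | h | h | h | h | h <;> simp [pow_succ, Int.mul_emod, h]
    have hcube0 : ∀ t : ℤ, t ^ 3 % 9 = 0 → 3 ∣ t := fun t ht =>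
      Int.prime_three.dvd_of_dvd_pow (by omega : (3 : ℤ) ∣ t ^ 3)
    have hPm : (P : ℤ) ^ ι % 9 ≠ 1 ∧ (P : ℤ) ^ ι % 9 ≠ 8 ∧ (P : ℤ) ^ ι % 3 ≠ 0 := by
      have : (P : ℤ) % 9 = 2 ∨ (P : ℤ) % 9 = 4 ∨ (P : ℤ) % 9 = 5 ∨ (P : ℤ) % 9 = 7 := by omega
      rcases hι with rfl | rfl
      · simp only [pow_one]; omega
      · have h93 : ∀ t : ℤ, t % 3 = t % 9 % 3 := by intro t; omega
        rw [h93]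
        rcases this with h | h | h | h <;> simp [pow_succ, Int.mul_emod, h]
    generalize (P : ℤ) ^ ι = Q at *
    have hmod : (x ^ 3 % 9 + (Q % 9) * (y ^ 3 % 9)) % 9 = 0 := by
      have h0 : (x ^ 3 + Q * y ^ 3) % 9 = 0 := Int.emod_eq_zero_of_dvd h9
      rwa [Int.add_emod, Int.mul_emod, Int.add_emod_emod] at h0
    by_cases hx0 : x ^ 3 % 9 = 0
    · have h3x := hcube0 x hx0
      have hy0 : y ^ 3 % 9 ≠ 0 := fun hy0 => hx3 h3x (hcube0 y hy0)
      rcases hcube y with hy | hy | hy <;> rw [hy, hx0] at hmod <;> omega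
    · rcases hcube x with hx | hx | hx <;> rcases hcube y with hy | hy | hy <;>
        rw [hx, hy] at hmod <;> omega
  have hN0 : x ^ 3 + (P : ℤ) ^ ι * y ^ 3 ≠ 0 := fun h => h3 (h ▸ dvd_zero _)
  refine ⟨isCoprime_of_prime_dvd (fun h => hN0 h.1) fun q hq hqN hq3 => ?_,
    isCoprime_of_prime_dvd (fun h => hN0 h.1) fun q hq hqN hqP => hP q hq hqP hqN⟩
  rcases hq.dvd_or_dvd hq3 with h | h
  · have hass := (hq.dvd_prime_iff_associated Int.prime_three).1 h
    exact h3 (hass.dvd_iff_dvd_left.1 hqN)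
  · have hqx := hq.dvd_of_dvd_pow h
    have : q ∣ (P : ℤ) ^ ι * y ^ 3 := (dvd_add_right (dvd_pow hqx (by norm_num))).1 hqN
    rcases hq.dvd_or_dvd this with h' | h'
    · exact hP q hq (hq.dvd_of_dvd_pow h') hqN
    · exact hnot q hq hqx (hq.dvd_of_dvd_pow h')

theorem cube_injective_of_pow_eq {F : Type*} [CommRing F] {l : ℕ} (hl3 : l % 3 = 2)
    (hF : ∀ u : F, u ^ l = u) {u v : F} (huv : u ^ 3 = v ^ 3) : u = v := by
  obtain ⟨j, hj⟩ : ∃ j, 2 * l = 3 * j + 1 := ⟨(2 * l) / 3, by omega⟩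
  have key : ∀ t : F, (t ^ 3) ^ j = t := by
    intro t
    have h1 : l = 1 + (l - 1) := by omega
    have h2 : 3 * j = l + (l - 1) := by omega
    calc (t ^ 3) ^ j = t ^ l * t ^ (l - 1) := by rw [← pow_mul, h2, pow_add]
      _ = t ^ (1 + (l - 1)) := by rw [hF t, pow_add, pow_one]
      _ = t := by rw [← h1, hF t]
  rw [← key u, huv, key v]

theorem eq_zero_of_common_root {l : ℕ} [Fact l.Prime] (hl3 : l % 3 = 2) {a b c x y Q : ZMod l}
    (hQ : Q ≠ 0) (hxy : ¬ (x = 0 ∧ y = 0)) (hN : x ^ 3 + Q * y ^ 3 = 0)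
    (h1 : a * y ^ 2 - b * x * y + c * x ^ 2 = 0)
    (h2 : (a ^ 2 - b * c * Q) * y ^ 2 - (c ^ 2 * Q - a * b) * x * y + (b ^ 2 - a * c) * x ^ 2 = 0) :
    a = 0 ∧ b = 0 ∧ c = 0 := by
  have hy : y ≠ 0 := by
    rintro rfl
    exact hxy ⟨by simpa using hN, rfl⟩
  obtain ⟨r, rfl⟩ : ∃ r, x = -r * y := ⟨-x / y, by field_simp⟩
  have hQr : Q = r ^ 3 := by
    have : (Q - r ^ 3) * y ^ 3 = 0 := by linear_combination hN
    exact sub_eq_zero.1 ((mul_eq_zero.1 this).resolve_right (pow_ne_zero 3 hy))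
  have hr : r ≠ 0 := by rintro rfl; exact hQ (by simpa using hQr)
  subst hQr
  have h1' : a + b * r + c * r ^ 2 = 0 := by
    have : (a + b * r + c * r ^ 2) * y ^ 2 = 0 := by linear_combination h1
    exact (mul_eq_zero.1 this).resolve_right (pow_ne_zero 2 hy)
  have h3 : (3 : ZMod l) ≠ 0 := by
    intro h
    have : l ∣ 3 := (ZMod.natCast_eq_zero_iff 3 l).1 (by exact_mod_cast h)
    have := (Nat.prime_dvd_prime_iff_eq Fact.out Nat.prime_three).1 this
    omega
  have ha : a = -b * r - c * r ^ 2 := by linear_combination h1'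
  subst ha
  have h4 : b ^ 2 + b * (c * r) + (c * r) ^ 2 = 0 := by
    have : (3 * r ^ 2 * y ^ 2) * (b ^ 2 + b * (c * r) + (c * r) ^ 2) = 0 := by
      linear_combination h2
    refine (mul_eq_zero.1 this).resolve_left ?_
    exact mul_ne_zero (mul_ne_zero h3 (pow_ne_zero 2 hr)) (pow_ne_zero 2 hy)
  have hbc : b = c * r := by
    refine cube_injective_of_pow_eq hl3 (fun u => ZMod.pow_card u) ?_
    linear_combination (b - c * r) * h4
  have hb : b = 0 := by
    have : 3 * b ^ 2 = 0 := by rw [← hbc] at h4; linear_combination h4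
    exact pow_eq_zero_iff (two_ne_zero) |>.1 ((mul_eq_zero.1 this).resolve_left h3)
  have hc : c = 0 := (mul_eq_zero.1 (hbc.symm.trans hb)).resolve_right hr
  subst hb hc
  simp

section

variable {K : Type*} [Field K] [NumberField K]

theorem dvd_of_norm_eq_prime {l : ℕ} (hl : l.Prime) (hl3 : l % 3 = 2) {ϖ : 𝓞 K} {Q a b c x y : ℤ}
    (hϖ : ϖ ^ 3 = Q)
    (hnorm : Algebra.norm ℤ ((a : 𝓞 K) + b * ϖ + c * ϖ ^ 2) = l)
    (hlam : (l : 𝓞 K) ∈ Ideal.span {(a : 𝓞 K) + b * ϖ + c * ϖ ^ 2})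
    (hN : (l : ℤ) ∣ x ^ 3 + Q * y ^ 3) :
    (a : 𝓞 K) + b * ϖ + c * ϖ ^ 2 ∣ x + y * ϖ := by
  set lam := (a : 𝓞 K) + b * ϖ + c * ϖ ^ 2
  set I := Ideal.span {lam}
  have habs : Ideal.absNorm I = l := by rw [Ideal.absNorm_span_singleton, hnorm]; simp
  have hprime : I.IsPrime := Ideal.isPrime_of_irreducible_absNorm (habs ▸ hl)
  have hne : I ≠ ⊥ := fun e => hl.ne_zero (by rw [← habs, e, Ideal.absNorm_bot])
  have hmax : I.IsMaximal := hprime.isMaximal hne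
  let := Ideal.Quotient.field I
  have hcard : Nat.card (𝓞 K ⧸ I) = l := by rw [← habs]; rfl
  have : Finite (𝓞 K ⧸ I) := Nat.finite_of_card_ne_zero (hcard ▸ hl.ne_zero)
  let := Fintype.ofFinite (𝓞 K ⧸ I)
  have hpow : ∀ u : 𝓞 K ⧸ I, u ^ l = u := fun u => by
    have := FiniteField.pow_card u
    rwa [← Nat.card_eq_fintype_card, hcard] at this
  rw [← Ideal.mem_span_singleton, ← Ideal.Quotient.eq_zero_iff_mem]
  rw [← Ideal.Quotient.eq_zero_iff_mem] at hlam
  have h3 : (Ideal.Quotient.mk I (x : 𝓞 K)) ^ 3 = (Ideal.Quotient.mk I (-(y * ϖ))) ^ 3 := by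
    rw [← map_pow, ← map_pow, ← sub_eq_zero, ← map_sub]
    obtain ⟨k, hk⟩ := hN
    have : (x : 𝓞 K) ^ 3 - (-(y * ϖ)) ^ 3 = l * k := by
      have hk' : (x : 𝓞 K) ^ 3 + Q * y ^ 3 = l * k := by
        exact_mod_cast congrArg (Int.cast (R := 𝓞 K)) hk
      linear_combination hk' + y ^ 3 * hϖ
    rw [this, map_mul, hlam, zero_mul]
  have := cube_injective_of_pow_eq hl3 hpow h3
  rw [map_neg] at this
  rw [map_add, this, neg_add_cancel]

theorem isCoprime_conj_of_norm_eq_prime {l : ℕ} (hl : l.Prime) (hl3 : l % 3 = 2) {ϖ : 𝓞 K}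
    {Q a b c x y : ℤ} (hϖ : ϖ ^ 3 = Q)
    (hnorm : Algebra.norm ℤ ((a : 𝓞 K) + b * ϖ + c * ϖ ^ 2) = l)
    (hlam : (l : ℤ) = a ^ 3 + b ^ 3 * Q + c ^ 3 * Q ^ 2 - 3 * a * b * c * Q)
    (hQ : ¬ (l : ℤ) ∣ Q) (hxy : ¬ ((l : ℤ) ∣ x ∧ (l : ℤ) ∣ y))
    (hN : (l : ℤ) ∣ x ^ 3 + Q * y ^ 3)
    (hdvd : (a : 𝓞 K) + b * ϖ + c * ϖ ^ 2 ∣ x + y * ϖ) :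
    IsCoprime ((x : 𝓞 K) + y * ϖ)
      ((a ^ 2 - b * c * Q : ℤ) + (c ^ 2 * Q - a * b : ℤ) * ϖ + (b ^ 2 - a * c : ℤ) * ϖ ^ 2) := by
  have : Fact l.Prime := ⟨hl⟩
  set lam := (a : 𝓞 K) + b * ϖ + c * ϖ ^ 2 with hlamdef
  set lam' : 𝓞 K := ((a ^ 2 - b * c * Q : ℤ) + (c ^ 2 * Q - a * b : ℤ) * ϖ +
    (b ^ 2 - a * c : ℤ) * ϖ ^ 2) with hlam'def
  have hmul : lam * lam' = l := by
    have : ((l : ℤ) : 𝓞 K) = _ := congrArg _ hlam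
    rw [← Int.cast_natCast (R := 𝓞 K) l, this, hlamdef, hlam'def]
    push_cast
    linear_combination (b * (b ^ 2 - a * c) + c * (c ^ 2 * Q - a * b) + c * (b ^ 2 - a * c) * ϖ) * hϖ
  have hn1 : (l : ℤ) ∣ a * y ^ 2 - b * x * y + c * x ^ 2 := by
    have h1 : lam ∣ ((a * y ^ 2 - b * x * y + c * x ^ 2 : ℤ) : 𝓞 K) := by
      have e : ((a * y ^ 2 - b * x * y + c * x ^ 2 : ℤ) : 𝓞 K) =
          y ^ 2 * lam - (x + y * ϖ) * (b * y - c * x + c * y * ϖ) := by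
        rw [hlamdef]; push_cast; ring
      rw [e]
      exact dvd_sub (dvd_mul_left _ _) (hdvd.mul_right _)
    have h2 := map_dvd (Algebra.norm ℤ) h1
    rw [hnorm, ← eq_intCast (algebraMap ℤ (𝓞 K)), Algebra.norm_algebraMap] at h2
    exact (Nat.prime_iff_prime_int.1 hl).dvd_of_dvd_pow h2
  by_contra hcop
  rw [← Ideal.isCoprime_span_singleton_iff, Ideal.isCoprime_iff_sup_eq] at hcop
  obtain ⟨M, hM, hle⟩ := Ideal.exists_le_maximal _ hcop
  have hθ : (x : 𝓞 K) + y * ϖ ∈ M := hle (Ideal.mem_sup_left (Ideal.mem_span_singleton_self _))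
  have hl' : lam' ∈ M := hle (Ideal.mem_sup_right (Ideal.mem_span_singleton_self _))
  have hlM : ((l : ℤ) : 𝓞 K) ∈ M := by
    rw [Int.cast_natCast, ← hmul]; exact M.mul_mem_left _ hl'
  have hn2 : (l : ℤ) ∣ (a ^ 2 - b * c * Q) * y ^ 2 - (c ^ 2 * Q - a * b) * x * y +
      (b ^ 2 - a * c) * x ^ 2 := by
    by_contra hnd
    have hc := ((Nat.prime_iff_prime_int.1 hl).coprime_iff_not_dvd).2 hnd
    obtain ⟨u, v, huv⟩ := hc
    apply hM.ne_top
    rw [Ideal.eq_top_iff_one]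
    have e : (1 : 𝓞 K) = u * (l : ℤ) + v * (y ^ 2 * lam' - (x + y * ϖ) *
        ((c ^ 2 * Q - a * b : ℤ) * y - (b ^ 2 - a * c : ℤ) * x + (b ^ 2 - a * c : ℤ) * y * ϖ)) := by
      rw [← Int.cast_one, ← huv, hlam'def]; push_cast; ring
    rw [e]
    exact M.add_mem (M.mul_mem_left _ hlM)
      (M.mul_mem_left _ (M.sub_mem (M.mul_mem_left _ hl') (M.mul_mem_right _ hθ)))
  have hz : ∀ t : ℤ, (t : ZMod l) = 0 ↔ (l : ℤ) ∣ t := fun t =>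
    ZMod.intCast_zmod_eq_zero_iff_dvd t l
  have hall := eq_zero_of_common_root (l := l) hl3 (a := a) (b := b) (c := c) (x := x) (y := y)
    (Q := Q) (by rwa [Ne, hz]) (by rwa [hz, hz]) (by exact_mod_cast (hz _).2 hN)
    (by exact_mod_cast (hz _).2 hn1) (by exact_mod_cast (hz _).2 hn2)
  simp only [hz] at hall
  obtain ⟨⟨a', rfl⟩, ⟨b', rfl⟩, ⟨c', rfl⟩⟩ := hall
  have h8 :
      (l : ℤ) * 1 = l * (l * (l * (a' ^ 3 + b' ^ 3 * Q + c' ^ 3 * Q ^ 2 - 3 * a' * b' * c' * Q))) := by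
    linear_combination hlam
  have h9 := mul_left_cancel₀ (by exact_mod_cast hl.ne_zero) h8
  have : (l : ℤ) ∣ 1 := ⟨_, h9⟩
  exact (Nat.prime_iff_prime_int.1 hl).not_dvd_one this

end

theorem exists_ideal_pow_of_coprime {R : Type*} [CommRing R] [IsDedekindDomain R]
    {θ θ' lam lam' z : R} {m n : ℕ} (hz : z ≠ 0) (hlam : lam ≠ 0) (hlam' : lam' ≠ 0)
    (heq : θ * θ' = lam ^ m * lam' ^ m * z ^ n) (hdvd : lam ∣ θ) (hcop : IsCoprime θ θ')
    (hcop' : IsCoprime θ lam') :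
    ∃ (μ : R) (J : Ideal R), θ = lam ^ m * μ ∧ μ ≠ 0 ∧ Ideal.span {μ} = J ^ n := by
  have h1 : IsCoprime (lam ^ m) θ' := (hcop.of_isCoprime_of_dvd_left hdvd).pow_left
  obtain ⟨μ, rfl⟩ : lam ^ m ∣ θ := by
    refine h1.dvd_of_dvd_mul_right (heq ▸ ?_)
    rw [mul_assoc]; exact dvd_mul_right _ _
  have h2 : μ * θ' = lam' ^ m * z ^ n :=
    mul_left_cancel₀ (pow_ne_zero m hlam) (by linear_combination heq)
  have h3 : IsCoprime (lam' ^ m) μ :=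
    ((hcop'.of_isCoprime_of_dvd_left (dvd_mul_left μ _)).pow_right).symm
  obtain ⟨ν, rfl⟩ : lam' ^ m ∣ θ' := h3.dvd_of_dvd_mul_left (h2 ▸ dvd_mul_right _ _)
  have h4 : μ * ν = z ^ n :=
    mul_left_cancel₀ (pow_ne_zero m hlam') (by linear_combination h2)
  have h5 : IsCoprime μ ν :=
    (hcop.of_isCoprime_of_dvd_left (dvd_mul_left μ _)).of_isCoprime_of_dvd_right (dvd_mul_left ν _)
  have h6 : Ideal.span {μ} * Ideal.span {ν} = (Ideal.span {z}) ^ n := by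
    rw [Ideal.span_singleton_mul_span_singleton, h4, Ideal.span_singleton_pow]
  obtain ⟨J, hJ⟩ := exists_eq_pow_of_mul_eq_pow_of_coprime
    ((Ideal.isCoprime_span_singleton_iff _ _).2 h5) h6
  exact ⟨μ, J, rfl, left_ne_zero_of_mul (h4 ▸ pow_ne_zero n hz), hJ⟩

theorem isPrincipal_of_pow_prime_pow {R : Type*} [CommRing R] [IsDomain R] {p : ℕ}
    (hcl : ∀ J : Ideal R, J ≠ ⊥ → (J ^ p).IsPrincipal → J.IsPrincipal) (i : ℕ) (J : Ideal R)
    (hJ0 : J ≠ ⊥) (hJ : (J ^ p ^ i).IsPrincipal) : J.IsPrincipal := by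
  induction i with
  | zero => simpa using hJ
  | succ i ih =>
    rw [pow_succ, pow_mul] at hJ
    exact ih (hcl _ (pow_ne_zero _ hJ0) hJ)

theorem exists_unit_mul_pow {R : Type*} [CommRing R] [IsDedekindDomain R] {p i n : ℕ}
    (hcl : ∀ J : Ideal R, J ≠ ⊥ → (J ^ p).IsPrincipal → J.IsPrincipal) (hn : p ^ i ∣ n)
    (hn0 : n ≠ 0) {μ : R} {J : Ideal R} (hμ : μ ≠ 0) (hJ : Ideal.span {μ} = J ^ n) :
    ∃ (η : Rˣ) (w : R), μ = η * w ^ p ^ i := by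
  obtain ⟨n', rfl⟩ := hn
  have hJ0 : J ≠ ⊥ := by
    rintro rfl
    rw [Ideal.bot_pow hn0, Ideal.span_singleton_eq_bot] at hJ
    exact hμ hJ
  rw [mul_comm, pow_mul] at hJ
  obtain ⟨w, hw⟩ := isPrincipal_of_pow_prime_pow hcl i (J ^ n') (pow_ne_zero _ hJ0)
    (hJ ▸ ⟨μ, rfl⟩)
  rw [hw] at hJ
  change _ = Ideal.span {w} ^ _ at hJ
  rw [Ideal.span_singleton_pow, Ideal.span_singleton_eq_span_singleton] at hJ
  obtain ⟨η, hη⟩ := hJ.symm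
  exact ⟨η, w, by rw [← hη, mul_comm]⟩

namespace PureCubic

variable {P : ℕ} {K : Type*} [Field K] [NumberField K] (h : PureCubic P K)

theorem inOrder_re (w : 𝓞 K) : InOrder P (h.re w) := by
  obtain ⟨x, y, z, rfl⟩ := h.exists_elt w
  exact ⟨x, y, z, h.re_elt x y z⟩

theorem isUnitOfOrder_re (u : (𝓞 K)ˣ) : IsUnitOfOrder P (h.re (u : 𝓞 K)) := by
  refine ⟨h.inOrder_re _, h.re ((u⁻¹ : (𝓞 K)ˣ) : 𝓞 K), h.inOrder_re _, ?_⟩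
  rw [← map_mul, ← map_mul, Units.mul_inv, map_one, map_one]

theorem re_injective : Function.Injective fun w : 𝓞 K => h.re w :=
  h.re.injective.comp RingOfIntegers.coe_injective

theorem exists_unit_of_isUnitOfOrder {ε : ℝ} (hε : IsUnitOfOrder P ε) :
    ∃ e : (𝓞 K)ˣ, h.re (e : 𝓞 K) = ε := by
  obtain ⟨⟨x, y, z, rfl⟩, v, ⟨x', y', z', rfl⟩, hv⟩ := hε
  have h1 : h.elt x y z * h.elt x' y' z' = 1 := by
    apply h.re_injective
    simp only [map_mul, h.re_elt, hv, map_one]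
  exact ⟨Units.mkOfMulEqOne _ _ h1, h.re_elt x y z⟩

theorem re_zpow {ε : ℝ} {e : (𝓞 K)ˣ} (he : h.re (e : 𝓞 K) = ε) (k : ℤ) :
    h.re ((e ^ k : (𝓞 K)ˣ) : 𝓞 K) = ε ^ k := by
  have := congrArg Units.val
    (map_zpow (Units.map (h.re.comp (algebraMap (𝓞 K) K) : 𝓞 K →* ℝ)) e k)
  rw [Units.val_zpow_eq_zpow_val] at this
  rw [← he]
  exact this

/-- A unit is, up to sign, a power of the fundamental unit. -/
theorem exists_eq_zpow {ε : ℝ} (hfund : IsFundamentalUnit P ε) {e : (𝓞 K)ˣ}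
    (he : h.re (e : 𝓞 K) = ε) (η : (𝓞 K)ˣ) (hη : 0 < h.re (η : 𝓞 K)) : ∃ k : ℤ, η = e ^ k := by
  obtain ⟨k, hk1, hk2⟩ := exists_mem_Ico_zpow hη hfund.2.1
  refine ⟨k, ?_⟩
  have hzpow := h.re_zpow he
  have hpos : 0 < ε ^ k := zpow_pos (one_pos.trans hfund.2.1) k
  set u := η * e ^ (-k)
  have hu : h.re (u : 𝓞 K) = h.re (η : 𝓞 K) / ε ^ k := by
    simp only [u, Units.val_mul, map_mul]
    rw [hzpow, zpow_neg, div_eq_mul_inv]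
  have h1 : ¬ 1 < h.re (u : 𝓞 K) := by
    intro h1
    have := hfund.2.2 _ (h.isUnitOfOrder_re u) h1
    rw [hu, le_div_iff₀ hpos] at this
    rw [zpow_add_one₀ (one_pos.trans hfund.2.1).ne'] at hk2
    linarith
  have h2 : h.re (u : 𝓞 K) = 1 := by
    refine le_antisymm (not_lt.1 h1) ?_
    rw [hu, le_div_iff₀ hpos, one_mul]; exact hk1
  have h3 : u = 1 := Units.ext (h.re_injective (by simpa using h2))
  rw [mul_eq_one_iff_eq_inv] at h3
  rw [h3, zpow_neg, inv_inv]

end PureCubic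

namespace PureCubic

variable {P : ℕ} {K : Type*} [Field K] [NumberField K] (h : PureCubic P K)

include h in
theorem exists_pow_prime_pow_eq {p : ℕ} (hp : p.Prime) (hp3 : 3 ≤ p) (hpP : p ∣ P) (w : 𝓞 K)
    (k : ℕ) : ∃ (r : ℤ) (v : 𝓞 K), w ^ p ^ (k + 1) = (r ^ p ^ (k + 1) : ℤ) + (p : 𝓞 K) ^ (k + 1) * v := by
  obtain ⟨r, s, t, rfl⟩ := h.exists_elt w
  have h1 : (p : 𝓞 K) ∣ (h.elt r s t) ^ p - (r : 𝓞 K) ^ p := by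
    obtain ⟨v, hv⟩ := exists_add_pow_prime_eq hp (r : 𝓞 K) (h.rt * (s + t * h.rt))
    have e : h.elt r s t = r + h.rt * (s + t * h.rt) := by simp only [elt]; ring
    rw [e, hv]
    have h3 : (p : 𝓞 K) ∣ h.rt ^ p := by
      have : (p : 𝓞 K) ∣ h.rt ^ 3 := by rw [h.rt_pow]; exact_mod_cast Nat.cast_dvd_cast hpP
      exact this.trans (pow_dvd_pow _ hp3)
    have e2 : (r : 𝓞 K) ^ p + (h.rt * (s + t * h.rt)) ^ p + p * r * (h.rt * (s + t * h.rt)) * v -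
        r ^ p = h.rt ^ p * (s + t * h.rt) ^ p + p * (r * (h.rt * (s + t * h.rt)) * v) := by
      rw [mul_pow]; ring
    rw [e2]
    exact dvd_add (h3.mul_right _) (dvd_mul_right _ _)
  obtain ⟨v, hv⟩ := dvd_sub_pow_of_dvd_sub h1 k
  refine ⟨r, v, ?_⟩
  rw [← hv, pow_succ' p, pow_mul, pow_mul, Int.cast_pow, Int.cast_pow]
  ring

theorem coeff_of_eq_mul {x y z a b c r N : ℤ} {v : 𝓞 K}
    (e : h.elt x y z = h.elt a b c * ((r : 𝓞 K) + N * v)) :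
    N ∣ x - a * r ∧ N ∣ y - b * r ∧ N ∣ z - c * r := by
  obtain ⟨u, v, w, rfl⟩ := h.exists_elt v
  have e1 : (r : 𝓞 K) + N * h.elt u v w = h.elt (r + N * u) (N * v) (N * w) := by
    simp only [elt]; push_cast; ring
  rw [e1, elt_mul, elt_inj] at e
  obtain ⟨rfl, rfl, rfl⟩ := e
  exact ⟨⟨a * u + P * (b * w + c * v), by ring⟩, ⟨a * v + b * u + P * c * w, by ring⟩,
    ⟨a * w + b * v + c * u, by ring⟩⟩

/-- The elements of the ring of integers whose `π`-coefficient is divisible by `N`. -/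
def MidDvd (N : ℕ) (w : 𝓞 K) : Prop := ∃ x y z : ℤ, w = h.elt x y z ∧ (N : ℤ) ∣ y

variable {h}

theorem MidDvd.mul {N : ℕ} (hN : N ∣ P) {u v : 𝓞 K} (hu : h.MidDvd N u) (hv : h.MidDvd N v) :
    h.MidDvd N (u * v) := by
  obtain ⟨x, y, z, rfl, hy⟩ := hu
  obtain ⟨x', y', z', rfl, hy'⟩ := hv
  refine ⟨_, _, _, h.elt_mul _ _ _ _ _ _, ?_⟩
  exact dvd_add (dvd_add (hy'.mul_left _) (hy.mul_right _))
    (((Int.natCast_dvd_natCast.2 hN).mul_right _).mul_right _)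

theorem MidDvd.pow {N : ℕ} (hN : N ∣ P) {u : 𝓞 K} (hu : h.MidDvd N u) (k : ℕ) :
    h.MidDvd N (u ^ k) := by
  induction k with
  | zero => exact ⟨1, 0, 0, by simp [elt], dvd_zero _⟩
  | succ k ih => rw [pow_succ]; exact ih.mul hN hu

theorem MidDvd.sq {p : ℕ} (hP : P = 2 * p ∨ P = p) {u : 𝓞 K} (hu : h.MidDvd p u) :
    h.MidDvd P (u ^ 2) := by
  obtain ⟨x, y, z, rfl, k, rfl⟩ := hu
  refine ⟨_, _, _, by rw [_root_.sq, h.elt_mul], ?_⟩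
  refine dvd_add ?_ ((dvd_mul_right _ _).mul_right _)
  rcases hP with rfl | rfl
  · exact ⟨x * k, by push_cast; ring⟩
  · exact ⟨2 * x * k, by ring⟩

theorem MidDvd.inv {N : ℕ} (hN : N ∣ P) {u : (𝓞 K)ˣ} (hu : h.MidDvd N (u : 𝓞 K)) :
    h.MidDvd N ((u⁻¹ : (𝓞 K)ˣ) : 𝓞 K) := by
  obtain ⟨x, y, z, hxyz, hy⟩ := hu
  have hn : IsUnit (Algebra.norm ℤ (u : 𝓞 K)) := u.isUnit.map _
  have hmul : (u : 𝓞 K) * h.elt (x ^ 2 - P * y * z) (P * z ^ 2 - x * y) (y ^ 2 - x * z) =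
      (Algebra.norm ℤ (u : 𝓞 K) : ℤ) := by
    rw [hxyz, h.elt_mul, h.norm_elt, h.intCast_eq_elt, h.elt_inj]
    refine ⟨by ring, by ring, by ring⟩
  have hinv : ((u⁻¹ : (𝓞 K)ˣ) : 𝓞 K) = (Algebra.norm ℤ (u : 𝓞 K) : ℤ) *
      h.elt (x ^ 2 - P * y * z) (P * z ^ 2 - x * y) (y ^ 2 - x * z) := by
    rw [Units.inv_eq_of_mul_eq_one_right]
    rw [mul_left_comm, hmul]
    rcases Int.isUnit_iff.1 hn with e | e <;> rw [e] <;> simp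
  rw [hinv, h.intCast_eq_elt]
  refine MidDvd.mul hN ⟨_, _, _, rfl, dvd_zero _⟩ ⟨_, _, _, rfl, ?_⟩
  exact dvd_sub ((Int.natCast_dvd_natCast.2 hN).mul_right _) (hy.mul_left _)

theorem MidDvd.zpow_two_mul {p : ℕ} (hP : P = 2 * p ∨ P = p) {u : (𝓞 K)ˣ}
    (hu : h.MidDvd p (u : 𝓞 K)) (j : ℤ) : h.MidDvd P ((u ^ (2 * j) : (𝓞 K)ˣ) : 𝓞 K) := by
  have hpP : p ∣ P := by rcases hP with rfl | rfl <;> simp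
  obtain ⟨n, rfl | rfl⟩ := j.eq_nat_or_neg
  · rw [zpow_mul, zpow_natCast, Units.val_pow_eq_pow_val]
    refine MidDvd.pow dvd_rfl ?_ n
    simpa using hu.sq hP
  · rw [mul_neg, zpow_neg, ← inv_zpow, zpow_mul, zpow_natCast, Units.val_pow_eq_pow_val]
    refine MidDvd.pow dvd_rfl ?_ n
    simpa using (hu.inv hpP).sq hP

end PureCubic

namespace PureCubic

variable {P : ℕ} {K : Type*} [Field K] [NumberField K] (h : PureCubic P K)

include h in
theorem exists_zpow_mul_pow_of_solution {p ι l m n : ℕ} {ε : ℝ} {x y z a b c : ℤ}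
    (hpodd : Odd p) (hsq : Squarefree P) (hP9 : P % 9 ≠ 1 ∧ P % 9 ≠ 8) (hι : ι = 1 ∨ ι = 2)
    (hcl : ∀ J : Ideal (𝓞 K), J ≠ ⊥ → (J ^ p).IsPrincipal → J.IsPrincipal)
    (hfund : IsFundamentalUnit P ε) {e : (𝓞 K)ˣ} (he : h.re (e : 𝓞 K) = ε)
    (hl : l.Prime) (hlP : ¬ l ∣ P) (hl3 : l % 3 = 2) (hm : 1 ≤ m)
    (h1 : (l : ℤ) = a ^ 3 + b ^ 3 * (P : ℤ) ^ ι + c ^ 3 * (P : ℤ) ^ (2 * ι)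
      - 3 * a * b * c * (P : ℤ) ^ ι)
    (hn : 5 ≤ n) (hpn : p ^ ι ∣ n)
    (hprim : Int.gcd x (Int.gcd y z) = 1)
    (heq : x ^ 3 + (P : ℤ) ^ ι * y ^ 3 = (l : ℤ) ^ m * z ^ n)
    (hxy : ¬ ((l : ℤ) ∣ x ∧ (l : ℤ) ∣ y)) :
    ∃ (k : ℤ) (w : 𝓞 K), (x : 𝓞 K) + y * h.rt ^ ι =
      ((a : 𝓞 K) + b * h.rt ^ ι + c * (h.rt ^ ι) ^ 2) ^ m *
        (((e ^ k : (𝓞 K)ˣ) : 𝓞 K) * w ^ p ^ ι) := by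
  obtain ⟨hc1, hc2⟩ := isCoprime_of_solution hsq hP9 hι hl hlP hl3 hn hprim heq hxy
  set ϖ := h.rt ^ ι with hϖdef
  set Q : ℤ := (P : ℤ) ^ ι with hQdef
  have hϖ : ϖ ^ 3 = (Q : 𝓞 K) := by
    rw [hϖdef, ← pow_mul, mul_comm, pow_mul, h.rt_pow, hQdef]; push_cast; rfl
  have hl' : (l : ℤ) = a ^ 3 + b ^ 3 * Q + c ^ 3 * Q ^ 2 - 3 * a * b * c * Q := by
    rw [h1, hQdef]; ring
  have hQl : ¬ (l : ℤ) ∣ Q := by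
    intro hd
    exact hlP (Int.natCast_dvd_natCast.1 ((Nat.prime_iff_prime_int.1 hl).dvd_of_dvd_pow hd))
  have hnorm : Algebra.norm ℤ ((a : 𝓞 K) + b * ϖ + c * ϖ ^ 2) = l := by
    rw [hl']
    rcases hι with rfl | rfl
    · have : (a : 𝓞 K) + b * ϖ + c * ϖ ^ 2 = h.elt a b c := by simp [elt, hϖdef]
      rw [this, h.norm_elt, hQdef]; ring
    · have : (a : 𝓞 K) + b * ϖ + c * ϖ ^ 2 = h.elt a (c * P) b := by
        simp only [elt, hϖdef]
        push_cast
        linear_combination (c : 𝓞 K) * h.rt * h.rt_pow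
      rw [this, h.norm_elt, hQdef]; ring
  have hNl : (l : ℤ) ∣ x ^ 3 + Q * y ^ 3 := by
    rw [heq]; exact (dvd_pow_self _ (by omega)).mul_right _
  set lam := (a : 𝓞 K) + b * ϖ + c * ϖ ^ 2 with hlam
  set lam' : 𝓞 K := ((a ^ 2 - b * c * Q : ℤ) + (c ^ 2 * Q - a * b : ℤ) * ϖ +
    (b ^ 2 - a * c : ℤ) * ϖ ^ 2) with hlam'def
  have hll' : lam * lam' = (l : 𝓞 K) := by
    have : (l : 𝓞 K) = ((l : ℤ) : 𝓞 K) := by simp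
    rw [this, hl', hlam, hlam'def]
    push_cast
    linear_combination
      ((b : 𝓞 K) * (b ^ 2 - a * c) + c * (c ^ 2 * Q - a * b) + c * (b ^ 2 - a * c) * ϖ) * hϖ
  have hl0 : (l : 𝓞 K) ≠ 0 := Nat.cast_ne_zero.2 hl.ne_zero
  have hdvd := dvd_of_norm_eq_prime hl hl3 hϖ hnorm
    (Ideal.mem_span_singleton.2 ⟨_, hll'.symm⟩) hNl
  have hcop' := isCoprime_conj_of_norm_eq_prime hl hl3 hϖ hnorm hl' hQl hxy hNl hdvd
  set θ := (x : 𝓞 K) + y * ϖ with hθ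
  set θ' : 𝓞 K := θ * (y * ϖ - 2 * x) + 3 * x ^ 2 with hθ'
  have hθθ' : θ * θ' = ((x ^ 3 + Q * y ^ 3 : ℤ) : 𝓞 K) := by
    push_cast
    rw [hθ', hθ]
    linear_combination (y : 𝓞 K) ^ 3 * hϖ
  have hcop : IsCoprime θ θ' := by
    have hc : IsCoprime ((x ^ 3 + Q * y ^ 3 : ℤ) : 𝓞 K) ((3 * x ^ 2 : ℤ) : 𝓞 K) :=
      hc1.map (Int.castRingHom (𝓞 K))
    rw [← hθθ'] at hc
    have hc' := hc.of_mul_left_left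
    push_cast at hc'
    rw [hθ', add_comm]
    exact hc'.add_mul_left_right _
  have hz0 : z ≠ 0 := by
    rintro rfl
    rw [zero_pow (by omega), mul_zero] at heq
    rw [heq] at hc2
    have h2 : IsUnit (P : ℤ) := isCoprime_zero_left.1 hc2
    have h3 : P = 1 := by simpa [Int.isUnit_iff_natAbs_eq] using h2
    omega
  obtain ⟨μ, J, hμ, hμ0, hJ⟩ := exists_ideal_pow_of_coprime (θ := θ) (θ' := θ') (lam := lam)
    (lam' := lam') (z := (z : 𝓞 K)) (m := m) (n := n) (Int.cast_ne_zero.2 hz0)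
    (fun e0 => hl0 (by rw [← hll', e0, zero_mul])) (fun e0 => hl0 (by rw [← hll', e0, mul_zero]))
    (by rw [hθθ', heq, ← mul_pow, hll']; push_cast; rfl) hdvd hcop hcop'
  obtain ⟨η, w, rfl⟩ := exists_unit_mul_pow hcl hpn (by omega) hμ0 hJ
  have hη0 : h.re (η : 𝓞 K) ≠ 0 := by
    intro e0
    exact η.ne_zero (h.re_injective (by simpa only [map_zero] using e0))
  rcases hη0.lt_or_gt with hneg | hpos
  · obtain ⟨k, hk⟩ := h.exists_eq_zpow hfund he (-η) (by simpa using hneg)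
    refine ⟨k, -w, ?_⟩
    rw [hμ, ← hk, (hpodd.pow).neg_pow]
    simp
  · obtain ⟨k, rfl⟩ := h.exists_eq_zpow hfund he η hpos
    exact ⟨k, w, hμ⟩

end PureCubic

/-- The descent, granted that the class group of `ℚ(P^{1/3})` has no `p`-torsion. -/
theorem PureCubic.dvd_of_solution {P : ℕ} {K : Type*} [Field K] [NumberField K]
    (h : PureCubic P K) {p : ℕ} (hp : p.Prime) (hpodd : Odd p) (hP : P = 2 * p ∨ P = p)
    (hP9 : P % 9 ≠ 1 ∧ P % 9 ≠ 8)
    (hcl : ∀ J : Ideal (𝓞 K), J ≠ ⊥ → (J ^ p).IsPrincipal → J.IsPrincipal)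
    {α β γ : ℤ} {ε : ℝ} (hε : ε = (α : ℝ) + (β : ℝ) * cbrt P + (γ : ℝ) * (cbrt P) ^ 2)
    (hfund : IsFundamentalUnit P ε) {ι : ℕ} (hι : ι = 1 ∨ (ι = 2 ∧ (p : ℤ) ∣ β))
    {l : ℕ} (hl : l.Prime) (hlP : ¬ l ∣ P) (hl3 : l % 3 = 2) {m : ℕ} (hm : 1 ≤ m) {a b c : ℤ}
    (h1 : (l : ℤ) = a ^ 3 + b ^ 3 * (P : ℤ) ^ ι + c ^ 3 * (P : ℤ) ^ (2 * ι)
      - 3 * a * b * c * (P : ℤ) ^ ι)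
    (h2 : ∀ (k : ℤ) (A B C : ℤ),
      (A : ℝ) + (B : ℝ) * (cbrt P) ^ ι + (C : ℝ) * (cbrt P) ^ (2 * ι)
        = ε ^ k * ((a : ℝ) + (b : ℝ) * (cbrt P) ^ ι + (c : ℝ) * (cbrt P) ^ (2 * ι)) ^ m
      → ¬ (p : ℤ) ∣ C) {n : ℕ} (hn : 5 ≤ n) (hpn : p ^ ι ∣ n) {x y z : ℤ}
    (hprim : Int.gcd x (Int.gcd y z) = 1)
    (heq : x ^ 3 + (P : ℤ) ^ ι * y ^ 3 = (l : ℤ) ^ m * z ^ n) : (l : ℤ) ∣ x ∧ (l : ℤ) ∣ y := by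
  by_contra hxy
  have hp2 : p ≠ 2 := by rintro rfl; exact absurd hpodd (by decide)
  have hp3 : 3 ≤ p := by have := hp.two_le; omega
  have hpP : p ∣ P := by rcases hP with rfl | rfl <;> simp
  have hpP' : (p : ℤ) ∣ P := Int.natCast_dvd_natCast.2 hpP
  have hpp : Prime (p : ℤ) := Nat.prime_iff_prime_int.1 hp
  have hsq := squarefree_of_eq_two_mul_or_eq hp hpodd hP
  have hι' : ι = 1 ∨ ι = 2 := hι.imp_right And.left
  obtain ⟨e, he⟩ := h.exists_unit_of_isUnitOfOrder hfund.1
  have hpx : ¬ (p : ℤ) ∣ x := by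
    intro hd
    have hc2 := (isCoprime_of_solution hsq hP9 hι' hl hlP hl3 hn hprim heq hxy).2
    refine hpp.not_isUnit (hc2.isUnit_of_dvd' (dvd_add (hd.trans (dvd_pow_self _ (by simp))) ?_) hpP')
    refine (hpP'.trans (dvd_pow_self _ ?_)).mul_right _
    rcases hι' with rfl | rfl <;> simp
  obtain ⟨k, w, hkw⟩ := h.exists_zpow_mul_pow_of_solution hpodd hsq hP9 hι' hcl hfund he hl hlP hl3
    hm h1 hn hpn hprim heq hxy
  rcases hι with rfl | ⟨rfl, hβ⟩
  · obtain ⟨A, B, C, hABC⟩ := h.exists_elt (((e ^ k : (𝓞 K)ˣ) : 𝓞 K) * (h.elt a b c) ^ m)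
    have hC : ¬ (p : ℤ) ∣ C := by
      refine h2 k A B C ?_
      have := congrArg (fun u : 𝓞 K => h.re u) hABC
      simp only [map_mul, map_pow, h.re_zpow he, h.re_elt] at this
      simpa using this.symm
    obtain ⟨r, v, hrv⟩ := h.exists_pow_prime_pow_eq hp hp3 hpP w 0
    have h3 : h.elt x y 0 = h.elt A B C * (((r ^ p : ℤ) : 𝓞 K) + (p : ℤ) * v) := by
      have e1 : h.elt x y 0 = (x : 𝓞 K) + y * h.rt ^ 1 := by simp [elt]
      have e2 : (a : 𝓞 K) + b * h.rt ^ 1 + c * (h.rt ^ 1) ^ 2 = h.elt a b c := by simp [elt]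
      rw [e2] at hkw
      rw [e1, hkw, hrv, ← hABC]
      push_cast
      ring
    obtain ⟨hx, -, hz⟩ := h.coeff_of_eq_mul h3
    rw [zero_sub, dvd_neg] at hz
    have hr := hpp.dvd_of_dvd_pow ((hpp.dvd_or_dvd hz).resolve_left hC)
    exact hpx ((dvd_sub_left ((dvd_pow hr hp.ne_zero).mul_left A)).1 hx)
  · have heβ : h.MidDvd p (e : 𝓞 K) := by
      refine ⟨α, β, γ, h.re_injective ?_, hβ⟩
      simp only [he, h.re_elt, hε]
    obtain ⟨j, w', hjw⟩ : ∃ (j : ℤ) (w' : 𝓞 K), ((e ^ k : (𝓞 K)ˣ) : 𝓞 K) * w ^ p ^ 2 =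
        ((e ^ (2 * j) : (𝓞 K)ˣ) : 𝓞 K) * w' ^ p ^ 2 := by
      rcases Int.even_or_odd' k with ⟨j, rfl | rfl⟩
      · exact ⟨j, w, rfl⟩
      · obtain ⟨q, hq⟩ := (hpodd.pow : Odd (p ^ 2))
        refine ⟨j + q + 1, ((e⁻¹ : (𝓞 K)ˣ) : 𝓞 K) * w, ?_⟩
        have : (e ^ (2 * j + 1) : (𝓞 K)ˣ) = e ^ (2 * (j + q + 1)) * e⁻¹ ^ p ^ 2 := by
          rw [hq, inv_pow, ← zpow_natCast, ← zpow_neg, ← zpow_add]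
          congr 1; push_cast; ring
        rw [this, mul_pow, Units.val_mul, Units.val_pow_eq_pow_val]
        ring
    have hlam : (a : 𝓞 K) + b * h.rt ^ 2 + c * (h.rt ^ 2) ^ 2 = h.elt a (c * P) b := by
      simp only [elt]
      push_cast
      linear_combination (c : 𝓞 K) * h.rt * h.rt_pow
    have hmid : h.MidDvd P (((e ^ (2 * j) : (𝓞 K)ˣ) : 𝓞 K) * (h.elt a (c * P) b) ^ m) :=
      (heβ.zpow_two_mul hP j).mul dvd_rfl (MidDvd.pow dvd_rfl ⟨_, _, _, rfl, dvd_mul_left _ _⟩ m)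
    obtain ⟨A, _, B, hABC, C, rfl⟩ := hmid
    have hC : ¬ (p : ℤ) ∣ C := by
      refine h2 (2 * j) A B C ?_
      have := congrArg (fun u : 𝓞 K => h.re u) hABC
      simp only [map_mul, map_pow, h.re_zpow he, h.re_elt] at this
      have hcb := cbrt_pow_three P
      have e1 : (a : ℝ) + b * cbrt P ^ 2 + c * cbrt P ^ (2 * 2) =
          a + ((c * P : ℤ) : ℝ) * cbrt P + b * cbrt P ^ 2 := by
        push_cast; linear_combination (c : ℝ) * cbrt P * hcb
      rw [e1, this]
      push_cast
      linear_combination (C : ℝ) * cbrt P * hcb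
    obtain ⟨r, v, hrv⟩ := h.exists_pow_prime_pow_eq hp hp3 hpP w' 1
    have h3 : h.elt x 0 y = h.elt A (P * C) B * (((r ^ p ^ 2 : ℤ) : 𝓞 K) + (p ^ 2 : ℤ) * v) := by
      have e1 : h.elt x 0 y = (x : 𝓞 K) + y * h.rt ^ 2 := by simp [elt]
      rw [hlam] at hkw
      rw [e1, hkw, hjw, hrv, ← hABC]
      push_cast
      ring
    obtain ⟨hx, hz, -⟩ := h.coeff_of_eq_mul h3
    rw [zero_sub, dvd_neg] at hz
    have hr : (p : ℤ) ∣ r := by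
      have h4 : (p : ℤ) ∣ 2 * (C * r ^ p ^ 2) := by
        rcases hP with rfl | rfl
        · refine Int.dvd_of_mul_dvd_mul_left (a := (p : ℤ)) (Int.natCast_ne_zero.2 hp.ne_zero) ?_
          have e2 : (p : ℤ) * (2 * (C * r ^ p ^ 2)) = ((2 * p : ℕ) : ℤ) * C * r ^ p ^ 2 := by
            push_cast; ring
          rw [e2, ← _root_.sq]
          exact hz
        · refine Dvd.dvd.mul_left ?_ _
          refine Int.dvd_of_mul_dvd_mul_left (a := (P : ℤ)) (Int.natCast_ne_zero.2 hp.ne_zero) ?_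
          rw [← mul_assoc, ← _root_.sq]
          exact hz
      have h5 : ¬ (p : ℤ) ∣ 2 := by
        intro hd
        have := Nat.le_of_dvd two_pos (Int.natCast_dvd_natCast.1 hd)
        omega
      exact hpp.dvd_of_dvd_pow ((hpp.dvd_or_dvd ((hpp.dvd_or_dvd h4).resolve_left h5)).resolve_left hC)
    exact hpx ((dvd_sub_left ((dvd_pow hr (by positivity)).mul_left A)).1
      ((dvd_pow_self _ two_ne_zero).trans hx))

/-- The index form inequality for the pure cubic order, in real coordinates. -/
theorem index_form_le {a b x T u n E D : ℝ} (hT : T = |x + a + b|) (hu0 : 0 ≤ u)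
    (hu : u ^ 2 = x ^ 2 + a ^ 2 + b ^ 2 - x * a - x * b - a * b) (hn : 0 < n) (hTu : T * u ^ 2 = n)
    (hE : 1 ≤ E) (h1 : T ^ 3 ≤ n * E ^ 2) (h2 : n ≤ T ^ 3 * E ^ 2)
    (hD : D ^ 2 = 27 / 4 * (a ^ 3 - b ^ 3) ^ 2) :
    D ≤ n * (E + 3) := by
  have hT0 : 0 ≤ T := hT ▸ abs_nonneg _
  have hTpos : 0 < T := by
    rcases hT0.eq_or_lt with h | h
    · rw [← h] at hTu; simp at hTu; linarith
    · exact h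
  have hupos : 0 < u := by
    rcases hu0.eq_or_lt with h | h
    · rw [← h] at hTu; simp at hTu; linarith
    · exact h
  have hT2 : T ^ 2 = (x + a + b) ^ 2 := by rw [hT, sq_abs]
  have hre : (x - (a + b) / 2) ^ 2 ≤ u ^ 2 := by rw [hu]; nlinarith [sq_nonneg (a - b)]
  have him : 3 / 4 * (a - b) ^ 2 ≤ u ^ 2 := by rw [hu]; nlinarith [sq_nonneg (x - (a + b) / 2)]
  have hF : 3 * (a ^ 2 + a * b + b ^ 2) ≤ (T + u) ^ 2 := by
    have h3 : |(x + a + b) * (x - (a + b) / 2)| ≤ T * u := by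
      rw [abs_mul, ← hT]
      exact mul_le_mul_of_nonneg_left (abs_le_of_sq_le_sq hre hu0) hT0
    have := neg_abs_le ((x + a + b) * (x - (a + b) / 2))
    nlinarith
  have hF0 : 0 ≤ a ^ 2 + a * b + b ^ 2 := by nlinarith [sq_nonneg (a + b), sq_nonneg a, sq_nonneg b]
  have hD1 : D ≤ u * (T + u) ^ 2 := by
    refine abs_le_of_sq_le_sq' ?_ (by positivity) |>.2
    have e : D ^ 2 = (3 / 4 * (a - b) ^ 2) * (3 * (a ^ 2 + a * b + b ^ 2)) ^ 2 := by rw [hD]; ring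
    rw [e, mul_pow u]
    exact mul_le_mul him (pow_le_pow_left₀ (by positivity) hF 2) (by positivity) (by positivity)
  have hX : u * T ^ 2 ≤ n * E := by
    refine abs_le_of_sq_le_sq' ?_ (by positivity) |>.2
    have e : (u * T ^ 2) ^ 2 = n * T ^ 3 := by rw [← hTu]; ring
    rw [e]
    nlinarith
  have hY : u ^ 3 ≤ n * E := by
    refine abs_le_of_sq_le_sq' ?_ (by positivity) |>.2
    have e : T ^ 3 * (u ^ 3) ^ 2 = n * n ^ 2 := by rw [← hTu]; ring
    have : T ^ 3 * (u ^ 3) ^ 2 ≤ T ^ 3 * (n * E) ^ 2 := by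
      rw [e]
      nlinarith [mul_le_mul_of_nonneg_right h2 (sq_nonneg n)]
    exact le_of_mul_le_mul_left this (by positivity)
  have hXY : (u * T ^ 2) * u ^ 3 = n ^ 2 := by rw [← hTu]; ring
  have hsum : u * T ^ 2 + u ^ 3 ≤ n * (E + 1) := by
    have h4 := mul_nonneg (sub_nonneg.2 hX) (sub_nonneg.2 hY)
    have h5 : (u * T ^ 2 + u ^ 3) * (n * E) ≤ n * (E + 1) * (n * E) := by nlinarith
    exact le_of_mul_le_mul_right h5 (by positivity)
  have : u * (T + u) ^ 2 = (u * T ^ 2 + u ^ 3) + 2 * (T * u ^ 2) := by ring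
  rw [this, hTu] at hD1
  linarith

namespace PureCubic

variable {P : ℕ} {K : Type*} [Field K] [NumberField K] (h : PureCubic P K)

/-- An integer whose real absolute value is close to the cube root of its norm lies in `ℤ`. -/
theorem eq_zero_of_index_form {x y z : ℤ} {n E : ℝ} (hirr : ∀ y z : ℤ, y ^ 3 = P * z ^ 3 → z = 0)
    (hP : 0 < P) (hn0 : 0 < n)
    (hn : |((Algebra.norm ℤ (h.elt x y z) : ℤ) : ℝ)| = n) (hE : 1 ≤ E)
    (h1 : |h.re (h.elt x y z : 𝓞 K)| ^ 3 ≤ n * E ^ 2)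
    (h2 : n ≤ |h.re (h.elt x y z : 𝓞 K)| ^ 3 * E ^ 2)
    (hlt : n * (E + 3) < √27 / 2 * P) : y = 0 ∧ z = 0 := by
  by_contra hyz
  have hyz' : y ^ 3 - P * z ^ 3 ≠ 0 := by
    intro e
    have hz := hirr y z (by linarith)
    subst hz
    refine hyz ⟨?_, rfl⟩
    simpa using e
  have hcb := cbrt_pow_three P
  set ρ := cbrt P
  rw [h.re_elt] at h1 h2
  set a : ℝ := y * ρ with ha
  set b : ℝ := z * ρ ^ 2 with hb
  set q : ℝ := (x : ℝ) ^ 2 + a ^ 2 + b ^ 2 - x * a - x * b - a * b with hq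
  have hq0 : 0 ≤ q := by
    nlinarith [sq_nonneg (x - a), sq_nonneg (x - b), sq_nonneg (a - b)]
  have hprod : (x + a + b) * q = ((Algebra.norm ℤ (h.elt x y z) : ℤ) : ℝ) := by
    rw [h.norm_elt, hq, ha, hb]
    push_cast
    linear_combination ((y : ℝ) ^ 3 + z ^ 3 * (ρ ^ 3 + P) - 3 * x * y * z) * hcb
  refine absurd hlt (not_lt.2 ?_)
  refine (index_form_le (a := a) (b := b) (x := x) (D := √27 / 2 * P * |(y : ℝ) ^ 3 - P * z ^ 3|)
    rfl (Real.sqrt_nonneg q) (Real.sq_sqrt hq0) hn0 ?_ hE h1 h2 ?_).trans' ?_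
  · rw [Real.sq_sqrt hq0, ← hn, ← hprod, abs_mul, abs_of_nonneg hq0]
  · rw [mul_pow, mul_pow, div_pow, Real.sq_sqrt (by norm_num), sq_abs, ha, hb]
    have e1 : ((y : ℝ) * ρ) ^ 3 - (z * ρ ^ 2) ^ 3 = P * (y ^ 3 - P * z ^ 3) := by
      linear_combination ((y : ℝ) ^ 3 - z ^ 3 * (ρ ^ 3 + P)) * hcb
    rw [e1]; ring
  · refine le_mul_of_one_le_right (by positivity) ?_
    have : ((y ^ 3 - P * z ^ 3 : ℤ) : ℝ) = (y : ℝ) ^ 3 - P * z ^ 3 := by push_cast; rfl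
    rw [← this, ← Int.cast_abs]
    exact_mod_cast Int.one_le_abs hyz'

end PureCubic

namespace PureCubic

variable {P : ℕ} {K : Type*} [Field K] [NumberField K] (h : PureCubic P K)

include h in
theorem exists_univ_eq_pair : ∃ w₁ w₂ : InfinitePlace K, w₁ ≠ w₂ ∧ w₁.IsReal ∧ w₂.IsComplex ∧
    (∀ x, w₁ x = |h.re x|) ∧ ∀ f : InfinitePlace K → ℝ, ∏ w, f w = f w₁ * f w₂ := by
  classical
  obtain ⟨φ, -, -, -, hφ⟩ := h.exists_complex_embedding
  set w₁ := InfinitePlace.mk (Complex.ofRealHom.comp h.re) with hw₁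
  have hne : w₁ ≠ InfinitePlace.mk φ := fun e =>
    InfinitePlace.not_isReal_iff_isComplex.2 hφ (e ▸ h.isReal_re)
  refine ⟨w₁, InfinitePlace.mk φ, hne, h.isReal_re, hφ, fun x => ?_, fun f => ?_⟩
  · rw [hw₁, InfinitePlace.apply]
    simp
  · have hcard : Fintype.card (InfinitePlace K) = 2 := by
      rw [InfinitePlace.card_eq_nrRealPlaces_add_nrComplexPlaces, h.nrRealPlaces_eq,
        h.nrComplexPlaces_eq]
    have huniv : ({w₁, InfinitePlace.mk φ} : Finset (InfinitePlace K)) = Finset.univ :=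
      Finset.eq_univ_of_card _ (by rw [Finset.card_pair hne, hcard])
    rw [← huniv, Finset.prod_pair hne]

/-- Minkowski's theorem for ideals of a pure cubic field. -/
theorem exists_mem_ideal_lt {I : Ideal (𝓞 K)} (hI : I ≠ ⊥) {s t : ℝ} (hs : 0 < s) (ht : 0 < t)
    (hst : 2 / Real.pi * (√27 * P) * Ideal.absNorm I < s * t) :
    ∃ v ∈ I, v ≠ 0 ∧ |h.re (v : 𝓞 K)| < s ∧
      |((Algebra.norm ℤ v : ℤ) : ℝ)| < |h.re (v : 𝓞 K)| * t := by
  classical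
  obtain ⟨w₁, w₂, hne, hr, hc, hw₁, hprod⟩ := h.exists_univ_eq_pair
  let J : (FractionalIdeal (nonZeroDivisors (𝓞 K)) K)ˣ :=
    FractionalIdeal.mk0 K ⟨I, mem_nonZeroDivisors_of_ne_zero hI⟩
  let f : InfinitePlace K → NNReal := fun w => if w = w₁ then s.toNNReal else (√t).toNNReal
  have hfprod : ((∏ w, f w ^ w.mult : NNReal) : ℝ) = s * t := by
    push_cast
    rw [hprod, InfinitePlace.mult_isReal ⟨w₁, hr⟩, InfinitePlace.mult_isComplex ⟨w₂, hc⟩]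
    simp only [f, if_true, hne.symm, if_false, pow_one, Real.coe_toNNReal _ hs.le,
      Real.coe_toNNReal _ (Real.sqrt_nonneg t), Real.sq_sqrt ht.le]
  have key : mixedEmbedding.minkowskiBound K J <
      MeasureTheory.volume (mixedEmbedding.convexBodyLT K f) := by
    rw [mixedEmbedding.convexBodyLT_volume, mixedEmbedding.minkowskiBound,
      mixedEmbedding.volume_fundamentalDomain_fractionalIdealLatticeBasis,
      mixedEmbedding.volume_fundamentalDomain_latticeBasis, mixedEmbedding.finrank, h.finrank_eq,
      mixedEmbedding.convexBodyLTFactor, h.nrRealPlaces_eq, h.nrComplexPlaces_eq, h.discr_eq,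
      FractionalIdeal.coe_mk0, FractionalIdeal.coeIdeal_absNorm]
    rw [← ENNReal.toReal_lt_toReal (by finiteness) (by finiteness)]
    have e1 : ((NNReal.sqrt ‖(-27 * P ^ 2 : ℤ)‖₊ : NNReal) : ℝ) = √27 * P := by
      rw [Real.coe_sqrt, coe_nnnorm, Int.norm_eq_abs]
      push_cast
      rw [abs_mul, abs_neg, abs_of_nonneg (by positivity : (0 : ℝ) ≤ 27),
        abs_of_nonneg (by positivity : (0 : ℝ) ≤ (P : ℝ) ^ 2), Real.sqrt_mul (by norm_num),
        Real.sqrt_sq (by positivity)]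
    simp only [ENNReal.toReal_mul, ENNReal.toReal_pow, ENNReal.toReal_inv, ENNReal.coe_toReal, e1]
    have hpi := Real.pi_pos
    rw [div_mul_eq_mul_div, div_mul_eq_mul_div, div_lt_iff₀ hpi] at hst
    push_cast at hfprod
    norm_num [hfprod]
    nlinarith
  obtain ⟨a, ha, ha0, hlt⟩ := mixedEmbedding.exists_ne_zero_mem_ideal_lt K J key
  obtain ⟨v, hv, rfl⟩ := (FractionalIdeal.mem_coeIdeal _).1 ha
  have h1 := hlt w₁
  have h2 := hlt w₂
  simp only [f, if_true, hne.symm, if_false, Real.coe_toNNReal _ hs.le,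
    Real.coe_toNNReal _ (Real.sqrt_nonneg t), hw₁] at h1 h2
  have hv0 : v ≠ 0 := by rintro rfl; simp at ha0
  refine ⟨v, hv, hv0, h1, ?_⟩
  have hnorm : |((Algebra.norm ℤ v : ℤ) : ℝ)| = |h.re (v : 𝓞 K)| * (w₂ (v : 𝓞 K)) ^ 2 := by
    have e := InfinitePlace.prod_eq_abs_norm (v : K)
    rw [hprod, InfinitePlace.mult_isReal ⟨w₁, hr⟩, InfinitePlace.mult_isComplex ⟨w₂, hc⟩,
      hw₁, pow_one] at e
    rw [e, ← Algebra.coe_norm_int]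
    push_cast; rfl
  rw [hnorm]
  have hre : 0 < |h.re (v : 𝓞 K)| := abs_pos.2 (by simpa using hv0)
  refine mul_lt_mul_of_pos_left ?_ hre
  rw [← Real.sq_sqrt ht.le]
  exact pow_lt_pow_left₀ h2 (apply_nonneg _ _) two_ne_zero

end PureCubic

theorem Finset.card_le_of_separated {α : Type*} (s : Finset α) (u : α → ℝ) {δ L : ℝ} (hδ : 0 < δ)
    (hL : 0 ≤ L) (hu : ∀ a ∈ s, 0 < u a ∧ u a < L)
    (hsep : ∀ a ∈ s, ∀ b ∈ s, |u a - u b| < δ → a = b) : (s.card : ℝ) ≤ L / δ + 1 := by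
  have h1 : s.card ≤ (Finset.range (⌊L / δ⌋₊ + 1)).card := by
    refine Finset.card_le_card_of_injOn (fun a => ⌊u a / δ⌋₊) (fun a ha => ?_) fun a ha b hb hab => ?_
    · rw [Finset.mem_coe, Finset.mem_range, Nat.lt_succ_iff]
      exact Nat.floor_le_floor (div_le_div_of_nonneg_right (hu a ha).2.le hδ.le)
    · refine hsep a ha b hb ?_
      have ha0 : 0 ≤ u a / δ := (div_pos (hu a ha).1 hδ).le
      have hb0 : 0 ≤ u b / δ := (div_pos (hu b hb).1 hδ).le
      have ha1 := Nat.floor_le ha0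
      have ha2 := Nat.lt_floor_add_one (u a / δ)
      have hb1 := Nat.floor_le hb0
      have hb2 := Nat.lt_floor_add_one (u b / δ)
      simp only at hab
      rw [hab] at ha1 ha2
      have : |u a / δ - u b / δ| < 1 := abs_lt.2 ⟨by linarith, by linarith⟩
      rwa [← sub_div, abs_div, abs_of_pos hδ, div_lt_one hδ] at this
  rw [Finset.card_range] at h1
  have h2 := Nat.floor_le (div_nonneg hL hδ.le)
  have h3 : (s.card : ℝ) ≤ ⌊L / δ⌋₊ + 1 := by exact_mod_cast h1
  linarith

namespace PureCubic

variable {P : ℕ} {K : Type*} [Field K] [NumberField K] (h : PureCubic P K)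

/-- The logarithmic position of an element on the unit-norm hyperbola. -/
noncomputable def logPos (v : 𝓞 K) : ℝ :=
  Real.log |h.re (v : 𝓞 K)| - Real.log |((Algebra.norm ℤ v : ℤ) : ℝ)| / 3

theorem card_mul_le_sum_log {I : Type*} [Fintype I] (𝔟 : I → Ideal (𝓞 K)) (h𝔟 : ∀ i, 𝔟 i ≠ ⊥)
    {L X : ℝ} (hL : 0 < L)
    (hsep : ∀ i j (v v' : 𝓞 K), v ≠ 0 → v' ≠ 0 →
      Ideal.span {v} * 𝔟 j = Ideal.span {v'} * 𝔟 i → |h.logPos v - h.logPos v'| < L →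
      i = j ∧ |h.re (v : 𝓞 K)| = |h.re (v' : 𝓞 K)|)
    (hX : 2 / Real.pi * (√27 * P) < X) (S : Finset (Ideal (𝓞 K)))
    (hS : ∀ 𝔞 : Ideal (𝓞 K), 𝔞 ≠ ⊥ → (Ideal.absNorm 𝔞 : ℝ) < X → 𝔞 ∈ S)
    (hS' : ∀ 𝔞 ∈ S, 𝔞 ≠ ⊥ ∧ (Ideal.absNorm 𝔞 : ℝ) ≤ X) :
    Fintype.card I * L ≤ ∑ 𝔞 ∈ S, Real.log (X / Ideal.absNorm 𝔞) := by
  classical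
  have hX0 : 0 < X := hX.trans_le' (by have := Real.pi_pos; positivity)
  have hpos : ∀ 𝔞 : Ideal (𝓞 K), 𝔞 ≠ ⊥ → (0 : ℝ) < Ideal.absNorm 𝔞 := fun 𝔞 h0 =>
    Nat.cast_pos.2 (Nat.pos_of_ne_zero (Ideal.absNorm_eq_zero_iff.not.2 h0))
  have main : ∀ N : ℕ, 0 < N → Fintype.card I * L ≤
      ∑ 𝔞 ∈ S, Real.log (X / Ideal.absNorm 𝔞) + S.card * (L / N) := by
    intro N hN
    have hN' : (0 : ℝ) < N := Nat.cast_pos.2 hN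
    set δ := L / N with hδ
    have hδ0 : 0 < δ := div_pos hL hN'
    have hexist : ∀ q : I × Fin N, ∃ (v : 𝓞 K) (𝔞 : Ideal (𝓞 K)), v ≠ 0 ∧ 𝔞 ≠ ⊥ ∧
        Ideal.span {v} = 𝔟 q.1 * 𝔞 ∧ (Ideal.absNorm 𝔞 : ℝ) < X ∧
        0 < (q.2 : ℝ) * δ - h.logPos v + Real.log (X / Ideal.absNorm 𝔞) / 3 ∧
        (q.2 : ℝ) * δ - h.logPos v + Real.log (X / Ideal.absNorm 𝔞) / 3 <
          Real.log (X / Ideal.absNorm 𝔞) := by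
      rintro ⟨i, k⟩
      have hb := hpos _ (h𝔟 i)
      obtain ⟨v, hv, hv0, h1, h2⟩ := h.exists_mem_ideal_lt (h𝔟 i)
        (s := Real.exp (k * δ + Real.log (X * Ideal.absNorm (𝔟 i)) / 3))
        (t := Real.exp (-(k * δ) + 2 * Real.log (X * Ideal.absNorm (𝔟 i)) / 3))
        (Real.exp_pos _) (Real.exp_pos _) (by
          rw [← Real.exp_add]
          have : (k : ℝ) * δ + Real.log (X * Ideal.absNorm (𝔟 i)) / 3 +
            (-(k * δ) + 2 * Real.log (X * Ideal.absNorm (𝔟 i)) / 3) =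
            Real.log (X * Ideal.absNorm (𝔟 i)) := by ring
          rw [this, Real.exp_log (by positivity)]
          exact mul_lt_mul_of_pos_right hX hb)
      obtain ⟨𝔞, h𝔞⟩ := Ideal.dvd_iff_le.2 ((Ideal.span_singleton_le_iff_mem _).2 hv)
      have h𝔞0 : 𝔞 ≠ ⊥ := by
        rintro rfl
        rw [Ideal.mul_bot, Ideal.span_singleton_eq_bot] at h𝔞
        exact hv0 h𝔞
      have ha := hpos _ h𝔞0
      have hnorm : |((Algebra.norm ℤ v : ℤ) : ℝ)| = Ideal.absNorm (𝔟 i) * Ideal.absNorm 𝔞 := by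
        have := congrArg Ideal.absNorm h𝔞
        rw [Ideal.absNorm_span_singleton, map_mul] at this
        rw [← Int.cast_abs, Int.abs_eq_natAbs, this]
        push_cast; rfl
      have hre : 0 < |h.re (v : 𝓞 K)| := abs_pos.2 (by simpa using hv0)
      have hl1 := Real.log_lt_log hre h1
      have hl2 := Real.log_lt_log (by rw [hnorm]; positivity) h2
      rw [Real.log_exp, Real.log_mul hX0.ne' hb.ne'] at hl1
      rw [hnorm, Real.log_mul hre.ne' (Real.exp_ne_zero _), Real.log_exp,
        Real.log_mul hX0.ne' hb.ne', Real.log_mul hb.ne' ha.ne'] at hl2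
      refine ⟨v, 𝔞, hv0, h𝔞0, h𝔞, ?_, ?_⟩
      · refine (Real.log_lt_log_iff ha hX0).1 ?_
        linarith
      · rw [logPos, hnorm, Real.log_div hX0.ne' ha.ne', Real.log_mul hb.ne' ha.ne']
        constructor <;> simp only <;> linarith
    choose v 𝔞 hv0 h𝔞0 hspan h𝔞X hu0 huL using hexist
    have hcard := Finset.card_eq_sum_card_fiberwise (s := (Finset.univ : Finset (I × Fin N)))
      (f := 𝔞) (t := S) (fun q _ => hS _ (h𝔞0 q) (h𝔞X q))
    have hfib : ∀ 𝔠 ∈ S, (((Finset.univ : Finset (I × Fin N)).filter (𝔞 · = 𝔠)).card : ℝ) ≤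
        Real.log (X / Ideal.absNorm 𝔠) / δ + 1 := by
      intro 𝔠 h𝔠
      have hc := hpos _ (hS' 𝔠 h𝔠).1
      refine Finset.card_le_of_separated _
        (fun q => (q.2 : ℝ) * δ - h.logPos (v q) + Real.log (X / Ideal.absNorm 𝔠) / 3) hδ0
        (Real.log_nonneg ((one_le_div hc).2 (hS' 𝔠 h𝔠).2)) ?_ ?_
      · rintro q hq
        rw [Finset.mem_filter] at hq
        rw [← hq.2]
        exact ⟨hu0 q, huL q⟩
      · rintro ⟨i, k⟩ hq ⟨j, k'⟩ hq' hlt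
        rw [Finset.mem_filter] at hq hq'
        simp only at hlt
        have hk : ∀ k : Fin N, (k : ℝ) ≤ N - 1 := by
          intro k
          have : ((k : ℕ) : ℝ) + 1 ≤ N := by exact_mod_cast k.2
          linarith
        have hNδ : (N : ℝ) * δ = L := by rw [hδ]; field_simp
        rw [abs_lt] at hlt
        have hk0 : ∀ k : Fin N, (0 : ℝ) ≤ k := fun k => Nat.cast_nonneg _
        have hij := hsep i j (v (i, k)) (v (j, k')) (hv0 _) (hv0 _)
          (by rw [hspan, hspan, hq.2, hq'.2]; simp only; ring)
          (by
            have e1 := mul_le_mul_of_nonneg_right (hk k) hδ0.le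
            have e2 := mul_le_mul_of_nonneg_right (hk k') hδ0.le
            have e3 := mul_nonneg (hk0 k) hδ0.le
            have e4 := mul_nonneg (hk0 k') hδ0.le
            rw [abs_lt]
            constructor <;> linarith)
        obtain ⟨rfl, hre⟩ := hij
        have hlog : h.logPos (v (i, k)) = h.logPos (v (i, k')) := by
          have : |((Algebra.norm ℤ (v (i, k)) : ℤ) : ℝ)| =
              |((Algebra.norm ℤ (v (i, k')) : ℤ) : ℝ)| := by
            have e := congrArg Ideal.absNorm ((hspan (i, k)).trans
              ((congrArg (𝔟 i * ·) (hq.2.trans hq'.2.symm)).trans (hspan (i, k')).symm))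
            rw [Ideal.absNorm_span_singleton, Ideal.absNorm_span_singleton] at e
            rw [← Int.cast_abs, ← Int.cast_abs, Int.abs_eq_natAbs, Int.abs_eq_natAbs, e]
          rw [logPos, logPos, hre, this]
        rw [hlog] at hlt
        have hkk : (k : ℕ) = k' := by
          have e1 : ((k : ℝ) - k') * δ < 1 * δ := by linarith
          have e2 : ((k' : ℝ) - k) * δ < 1 * δ := by linarith
          have e3 := lt_of_mul_lt_mul_right e1 hδ0.le
          have e4 := lt_of_mul_lt_mul_right e2 hδ0.le
          have e5 : (k : ℕ) < k' + 1 := by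
            have : (k : ℝ) < k' + 1 := by linarith
            exact_mod_cast this
          have e6 : (k' : ℕ) < k + 1 := by
            have : (k' : ℝ) < k + 1 := by linarith
            exact_mod_cast this
          omega
        rw [Fin.ext hkk]
    have hle : (Fintype.card I * N : ℝ) ≤
        ∑ 𝔠 ∈ S, (Real.log (X / Ideal.absNorm 𝔠) / δ + 1) := by
      refine le_trans (le_of_eq ?_) (Finset.sum_le_sum hfib)
      rw [← Nat.cast_sum, ← hcard, Finset.card_univ, Fintype.card_prod, Fintype.card_fin]
      push_cast; rfl
    rw [Finset.sum_add_distrib, ← Finset.sum_div, Finset.sum_const, nsmul_eq_mul, mul_one] at hle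
    have h3 := mul_le_mul_of_nonneg_right hle hδ0.le
    rw [add_mul, div_mul_cancel₀ _ hδ0.ne'] at h3
    have hNδ : (Fintype.card I : ℝ) * N * δ = Fintype.card I * L := by rw [hδ]; field_simp
    rwa [hNδ] at h3
  have hlim : Filter.Tendsto (fun N : ℕ => ∑ 𝔞 ∈ S, Real.log (X / Ideal.absNorm 𝔞) +
      S.card * (L / N)) Filter.atTop
      (nhds (∑ 𝔞 ∈ S, Real.log (X / Ideal.absNorm 𝔞) + S.card * 0)) :=
    ((tendsto_const_div_atTop_nhds_zero_nat L).const_mul _).const_add _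
  rw [mul_zero, add_zero] at hlim
  exact ge_of_tendsto hlim (Filter.eventually_atTop.2 ⟨1, fun N hN => main N hN⟩)

end PureCubic

/-- A totally ramified prime, from an Eisenstein-type relation. -/
theorem span_pair_pow_three {R : Type*} [CommRing R] {q θ a b u : R}
    (hθ : θ ^ 3 = q * (a * θ ^ 2 + b * θ + u)) (hu : IsCoprime u q) :
    Ideal.span {q, θ} ^ 3 = Ideal.span {q} := by
  have hq : q ∈ Ideal.span {q, θ} := Ideal.subset_span (by simp)
  have hθm : θ ∈ Ideal.span {q, θ} := Ideal.subset_span (by simp)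
  set I := Ideal.span {q, θ} with hI
  obtain ⟨s, t, hst⟩ := hu
  refine le_antisymm ?_ ?_
  · have h3 : I ^ 3 = I * I * I := by ring
    rw [h3, hI, Ideal.span_pair_mul_span_pair, Ideal.span_mul_span', Ideal.span_le]
    rintro _ ⟨x, hx, y, hy, rfl⟩
    rw [SetLike.mem_coe, Ideal.mem_span_singleton]
    simp only [Set.mem_insert_iff, Set.mem_singleton_iff] at hx hy
    rcases hy with rfl | rfl
    · exact dvd_mul_left _ _
    · rcases hx with rfl | rfl | rfl | rfl
      · exact ((dvd_mul_right _ _).mul_right _)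
      · exact ((dvd_mul_right _ _).mul_right _)
      · exact ((dvd_mul_left _ _).mul_right _)
      · exact ⟨_, by rw [← hθ]; ring⟩
  · rw [Ideal.span_singleton_le_iff_mem]
    have hmem : ∀ x y z, x ∈ I → y ∈ I → z ∈ I → x * y * z ∈ I ^ 3 := fun x y z hx hy hz => by
      rw [show I ^ 3 = I * I * I by ring]
      exact Ideal.mul_mem_mul (Ideal.mul_mem_mul hx hy) hz
    have h1 := hmem _ _ _ hq hq hq
    have h2 := hmem _ _ _ hq hq hθm
    have h3 := hmem _ _ _ hq hθm hθm
    have h4 := hmem _ _ _ hθm hθm hθm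
    set J := I ^ 3
    have h5 : q * (b * θ + u) ∈ J := by
      have := J.sub_mem h4 (J.mul_mem_left a h3)
      convert this using 1
      linear_combination -hθ
    have h6 : q * θ ∈ J := by
      have e1 := J.mul_mem_left s (J.sub_mem (J.mul_mem_left θ h5) (J.mul_mem_left b h3))
      have e2 := J.add_mem e1 (J.mul_mem_left t h2)
      convert e2 using 1
      linear_combination -q * θ * hst
    have h7 : q * u ∈ J := by
      convert J.sub_mem h5 (J.mul_mem_left b h6) using 1
      ring
    have h8 : q * q ∈ J := by
      convert J.add_mem (J.mul_mem_left (s * q) h7) (J.mul_mem_left t h1) using 1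
      linear_combination -q * q * hst
    convert J.add_mem (J.mul_mem_left s h7) (J.mul_mem_left t h8) using 1
    linear_combination -q * hst

namespace PureCubic

variable {P : ℕ} {K : Type*} [Field K] [NumberField K] (h : PureCubic P K)

include h in
theorem exists_ideal_pow_three_of_dvd {q : ℕ} (hsq : Squarefree P) (hq : q ∣ P) :
    ∃ 𝔮 : Ideal (𝓞 K), 𝔮 ^ 3 = Ideal.span {(q : 𝓞 K)} ∧ h.rt ∈ 𝔮 := by
  obtain ⟨u, hu⟩ := hq
  have hc : Nat.Coprime u q := (Nat.coprime_of_squarefree_mul (hu ▸ hsq)).symm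
  refine ⟨_, span_pair_pow_three (q := (q : 𝓞 K)) (θ := h.rt) (a := 0) (b := 0) (u := u) ?_ ?_,
    Ideal.subset_span (by simp)⟩
  · have hu' : (P : 𝓞 K) = q * u := by exact_mod_cast congrArg (Nat.cast (R := 𝓞 K)) hu
    linear_combination h.rt_pow + hu'
  · have := (Nat.isCoprime_iff_coprime.2 hc).map (Int.castRingHom (𝓞 K))
    simpa using this

include h in
theorem exists_ideal_pow_three_eq_three (hP9 : P % 9 ≠ 1 ∧ P % 9 ≠ 8) (h3 : ¬ 3 ∣ P) :
    ∃ 𝔮 : Ideal (𝓞 K), 𝔮 ^ 3 = Ideal.span {(3 : 𝓞 K)} ∧ h.rt - P ∈ 𝔮 := by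
  obtain ⟨u, hu, hu3⟩ : ∃ u : ℤ, (P : ℤ) ^ 3 - P = 3 * u ∧ ¬ (3 : ℤ) ∣ u := by
    obtain ⟨k, r, hk, hr⟩ : ∃ k r : ℕ, P = 9 * k + r ∧ (r = 2 ∨ r = 4 ∨ r = 5 ∨ r = 7) :=
      ⟨P / 9, P % 9, by omega, by omega⟩
    rw [hk]
    rcases hr with rfl | rfl | rfl | rfl
    · exact ⟨2 + 33 * k + 162 * k ^ 2 + 243 * k ^ 3, by push_cast; ring, by omega⟩
    · exact ⟨20 + 141 * k + 324 * k ^ 2 + 243 * k ^ 3, by push_cast; ring, by omega⟩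
    · exact ⟨40 + 222 * k + 405 * k ^ 2 + 243 * k ^ 3, by push_cast; ring, by omega⟩
    · exact ⟨112 + 438 * k + 567 * k ^ 2 + 243 * k ^ 3, by push_cast; ring, by omega⟩
  have hc : IsCoprime u 3 :=
    ((Int.prime_three.coprime_iff_not_dvd).2 hu3).symm
  refine ⟨_, span_pair_pow_three (q := (3 : 𝓞 K)) (θ := h.rt - P) (a := -P) (b := -P ^ 2)
    (u := ((-u : ℤ) : 𝓞 K)) ?_ ?_, Ideal.subset_span (by simp)⟩
  · have hu' : (P : 𝓞 K) ^ 3 - P = 3 * u := by exact_mod_cast congrArg (Int.cast (R := 𝓞 K)) hu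
    push_cast
    linear_combination h.rt_pow - hu'
  · have := hc.neg_left.map (Int.castRingHom (𝓞 K))
    simpa using this

include h in
theorem absNorm_span_natCast (q : ℕ) : Ideal.absNorm (Ideal.span {(q : 𝓞 K)}) = q ^ 3 := by
  have : (q : 𝓞 K) = h.elt q 0 0 := by simp [elt]
  rw [this, Ideal.absNorm_span_singleton, h.norm_elt]
  simp [Int.natAbs_pow]

include h in
theorem absNorm_eq_of_pow_three {q : ℕ} {𝔮 : Ideal (𝓞 K)} (hq : 𝔮 ^ 3 = Ideal.span {(q : 𝓞 K)}) :
    Ideal.absNorm 𝔮 = q := by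
  have := congrArg Ideal.absNorm hq
  rw [map_pow, h.absNorm_span_natCast] at this
  exact Nat.pow_left_injective (by norm_num : 3 ≠ 0) this

theorem logPos_mul {u v : 𝓞 K} (hu : u ≠ 0) (hv : v ≠ 0) :
    h.logPos (u * v) = h.logPos u + h.logPos v := by
  have h1 : ∀ {w : 𝓞 K}, w ≠ 0 → |h.re (w : 𝓞 K)| ≠ 0 := fun hw => by simpa using hw
  have h2 : ∀ {w : 𝓞 K}, w ≠ 0 → |((Algebra.norm ℤ w : ℤ) : ℝ)| ≠ 0 := fun hw => by
    simpa [Algebra.norm_eq_zero_iff] using hw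
  simp only [logPos, map_mul, abs_mul, Int.cast_mul]
  rw [Real.log_mul (h1 hu) (h1 hv), Real.log_mul (h2 hu) (h2 hv)]
  ring

theorem logPos_natCast (q : ℕ) : h.logPos (q : 𝓞 K) = 0 := by
  have : (q : 𝓞 K) = h.elt q 0 0 := by simp [elt]
  rw [logPos, this, h.norm_elt, h.re_elt]
  simp

theorem eq_one_of_abs_logPos_lt (hirr : ∀ y z : ℤ, y ^ 3 = P * z ^ 3 → z = 0) (hP : 0 < P)
    {g : 𝓞 K} {n : ℕ} {B E : ℝ} (hn : (Algebra.norm ℤ g).natAbs = n) (hn0 : 0 < n) (hnB : n ≤ B)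
    (hn1 : ∀ x : ℕ, x ^ 3 = n → x = 1) (hE : 1 ≤ E) (hBE : B * (E + 3) < √27 / 2 * P)
    (hlog : |h.logPos g| < 2 / 3 * Real.log E) : n = 1 ∧ |h.re (g : 𝓞 K)| = 1 := by
  obtain ⟨x, y, z, rfl⟩ := h.exists_elt g
  have hn0' : (0 : ℝ) < n := Nat.cast_pos.2 hn0
  have hnr : |((Algebra.norm ℤ (h.elt x y z) : ℤ) : ℝ)| = n := by
    rw [← Int.cast_abs, Int.abs_eq_natAbs, hn]; rfl
  have hg0 : h.elt x y z ≠ 0 := by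
    intro e
    rw [e] at hn
    simp at hn
    omega
  have hT : 0 < |h.re (h.elt x y z : 𝓞 K)| := abs_pos.2 (by simpa using hg0)
  have hE0 : 0 < E := by linarith
  rw [logPos, hnr, abs_lt] at hlog
  obtain ⟨rfl, rfl⟩ := h.eq_zero_of_index_form hirr hP hn0' hnr hE
    ((Real.log_le_log_iff (by positivity) (by positivity)).1 (by
      rw [Real.log_mul (by positivity) (by positivity), Real.log_pow, Real.log_pow]
      push_cast; linarith))
    ((Real.log_le_log_iff (by positivity) (by positivity)).1 (by
      rw [Real.log_mul (by positivity) (by positivity), Real.log_pow, Real.log_pow]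
      push_cast; linarith))
    (hBE.trans_le' (mul_le_mul_of_nonneg_right hnB (by linarith)))
  rw [h.norm_elt] at hn
  have hx : x.natAbs = 1 := hn1 _ (by rw [← hn]; simp [Int.natAbs_pow])
  refine ⟨by rw [← hn]; simp [Int.natAbs_pow, hx], ?_⟩
  rw [h.re_elt]
  simp only [Int.cast_zero, zero_mul, add_zero]
  rw [← Int.cast_abs, Int.abs_eq_natAbs, hx]
  simp

include h in
theorem eq_zero_of_pow_three_eq (y z : ℤ) (e : y ^ 3 = P * z ^ 3) : z = 0 := by
  have : Algebra.norm ℤ (h.elt y (-z) 0) = 0 := by rw [h.norm_elt]; linear_combination e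
  rw [Algebra.norm_eq_zero_iff] at this
  have h0 : (0 : 𝓞 K) = h.elt 0 0 0 := by simp [elt]
  rw [h0, h.elt_inj] at this
  simpa using this.2.1

end PureCubic

/-- Shifting exponents modulo three for an ideal whose cube is generated by an integer. -/
theorem exists_span_mul_pow_eq {R : Type*} [CommRing R] {q : ℕ} (hq : q ≠ 0) {𝔮 : Ideal R}
    (h𝔮 : 𝔮 ^ 3 = Ideal.span {(q : R)}) {e e' : ℕ} (he : e < 3) (he' : e' < 3) :
    ∃ d c : ℕ, d < 3 ∧ c ≠ 0 ∧ (d = 0 → e = e') ∧ (e = e' → d = 0 ∧ c = 1) ∧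
      Ideal.span {(c : R)} * 𝔮 ^ e = 𝔮 ^ d * 𝔮 ^ e' := by
  rcases le_or_gt e' e with hle | hlt
  · refine ⟨e - e', 1, by omega, one_ne_zero, by omega, fun h => ⟨by omega, rfl⟩, ?_⟩
    rw [← pow_add, Nat.sub_add_cancel hle]
    simp
  · refine ⟨e + 3 - e', q, by omega, hq, by omega, fun h => by omega, ?_⟩
    rw [← h𝔮, ← pow_add, ← pow_add]
    congr 1
    omega

namespace PureCubic

variable {P : ℕ} {K : Type*} [Field K] [NumberField K] (h : PureCubic P K)

theorem eq_of_abs_logPos_sub_lt (hirr : ∀ y z : ℤ, y ^ 3 = P * z ^ 3 → z = 0) (hP : 0 < P)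
    {r k B : ℕ} (hr : r = 1 ∧ k = 1 ∧ B = 3 ∨ r = 2 ∧ k = 3 ∧ B = 12) {𝔮 𝔱 : Ideal (𝓞 K)}
    (h𝔮 : 𝔮 ^ 3 = Ideal.span {(r : 𝓞 K)}) (h𝔱 : 𝔱 ^ 3 = Ideal.span {((3 : ℕ) : 𝓞 K)}) {E : ℝ}
    (hE : 1 ≤ E) (hBE : B * (E + 3) < √27 / 2 * P) {e e' f f' : ℕ} (he : e < k) (he' : e' < k)
    (hf : f < 3) (hf' : f' < 3) {v v' : 𝓞 K} (hv : v ≠ 0) (hv' : v' ≠ 0)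
    (heq : Ideal.span {v} * (𝔮 ^ e * 𝔱 ^ f) = Ideal.span {v'} * (𝔮 ^ e' * 𝔱 ^ f'))
    (hlog : |h.logPos v - h.logPos v'| < 2 / 3 * Real.log E) :
    e = e' ∧ f = f' ∧ |h.re (v : 𝓞 K)| = |h.re (v' : 𝓞 K)| := by
  have hr0 : r ≠ 0 := by omega
  have hk : k ≤ 3 := by omega
  have hne : ∀ {q : ℕ} {I : Ideal (𝓞 K)}, q ≠ 0 → I ^ 3 = Ideal.span {(q : 𝓞 K)} → I ≠ ⊥ := by
    rintro q I hq hI rfl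
    rw [Ideal.bot_pow (by norm_num), eq_comm, Ideal.span_singleton_eq_bot] at hI
    exact hq (by exact_mod_cast hI)
  obtain ⟨d, c, hd, hc, hd0, hdc, hdq⟩ :=
    exists_span_mul_pow_eq hr0 h𝔮 (he'.trans_le hk) (he.trans_le hk)
  obtain ⟨d', c', hd', hc', hd0', hdc', hdq'⟩ :=
    exists_span_mul_pow_eq (by norm_num : (3 : ℕ) ≠ 0) h𝔱 hf' hf
  have hspan : Ideal.span {v * c * c'} = Ideal.span {v'} * (𝔮 ^ d * 𝔱 ^ d') := by
    have h0 : 𝔮 ^ e * 𝔱 ^ f ≠ ⊥ :=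
      mul_ne_zero (pow_ne_zero _ (hne hr0 h𝔮)) (pow_ne_zero _ (hne (by norm_num) h𝔱))
    refine mul_right_cancel₀ h0 ?_
    rw [← Ideal.span_singleton_mul_span_singleton, ← Ideal.span_singleton_mul_span_singleton]
    calc _ = (Ideal.span {v} * (𝔮 ^ e * 𝔱 ^ f)) * Ideal.span {(c : 𝓞 K)}
          * Ideal.span {(c' : 𝓞 K)} := by ring
      _ = Ideal.span {v'} * ((Ideal.span {(c : 𝓞 K)} * 𝔮 ^ e') *
          (Ideal.span {(c' : 𝓞 K)} * 𝔱 ^ f')) := by rw [heq]; ring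
      _ = _ := by rw [hdq, hdq']; ring
  obtain ⟨g, hg⟩ : v' ∣ v * c * c' := by
    rw [← Ideal.mem_span_singleton, ← Ideal.span_singleton_le_iff_mem, hspan]
    exact Ideal.mul_le_left (I := Ideal.span {v'}) (J := 𝔮 ^ d * 𝔱 ^ d')
  have hgspan : Ideal.span {g} = 𝔮 ^ d * 𝔱 ^ d' := by
    rw [hg, ← Ideal.span_singleton_mul_span_singleton] at hspan
    exact mul_left_cancel₀ (by simpa using hv') hspan
  have hcc : ((c : 𝓞 K)) ≠ 0 ∧ ((c' : 𝓞 K)) ≠ 0 := by exact_mod_cast And.intro hc hc'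
  have hg0 : g ≠ 0 := by
    rintro rfl
    rw [mul_zero] at hg
    exact mul_ne_zero (mul_ne_zero hv hcc.1) hcc.2 hg
  have hglog : h.logPos g = h.logPos v - h.logPos v' := by
    have := congrArg h.logPos hg
    rw [h.logPos_mul (mul_ne_zero hv hcc.1) hcc.2, h.logPos_mul hv hcc.1, h.logPos_natCast,
      h.logPos_natCast, h.logPos_mul hv' hg0] at this
    linarith
  have hgn : (Algebra.norm ℤ g).natAbs = r ^ d * 3 ^ d' := by
    rw [← Ideal.absNorm_span_singleton, hgspan, map_mul, map_pow, map_pow,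
      h.absNorm_eq_of_pow_three h𝔮, h.absNorm_eq_of_pow_three h𝔱]
  have hdk : r = 1 → d = 0 := fun h1 => (hdc (by omega)).1
  rw [← hglog] at hlog
  have hfin : r ^ d * 3 ^ d' = 1 → |h.re (g : 𝓞 K)| = 1 →
      e = e' ∧ f = f' ∧ |h.re (v : 𝓞 K)| = |h.re (v' : 𝓞 K)| := by
    intro h1 hre
    have hd1 : d' = 0 := by
      have := Nat.eq_one_of_mul_eq_one_left h1
      simpa using this
    have hd2 : d = 0 := by
      rcases hr with hr | hr
      · exact hdk hr.1
      · have := Nat.eq_one_of_mul_eq_one_right h1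
        rw [hr.1] at this
        simpa using this
    have e1 := (hdc (hd0 hd2)).2
    have e2 := (hdc' (hd0' hd1)).2
    refine ⟨(hd0 hd2).symm, (hd0' hd1).symm, ?_⟩
    rw [e1, e2] at hg
    have : v = v' * g := by simpa using hg
    rw [this, RingOfIntegers.coe_eq_algebraMap, map_mul, map_mul, abs_mul,
      ← RingOfIntegers.coe_eq_algebraMap, ← RingOfIntegers.coe_eq_algebraMap, hre, mul_one]
  have hcube : ∀ {n : ℕ}, n ∈ ({1, 2, 3, 4, 6, 9, 12} : Finset ℕ) → ∀ x : ℕ, x ^ 3 = n → x = 1 := by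
    intro n hn x hx
    have : x < 3 := by
      by_contra! h3
      have := Nat.pow_le_pow_left h3 3
      simp at hn
      omega
    interval_cases x <;> simp at hx <;> subst hx <;> simp at hn ⊢
  by_cases hsmall : r ^ d * 3 ^ d' ≤ B
  · obtain ⟨h1, h2⟩ := h.eq_one_of_abs_logPos_lt hirr hP hgn (by positivity)
      (by exact_mod_cast hsmall) (hcube (by
        rcases hr with ⟨rfl, rfl, rfl⟩ | ⟨rfl, rfl, rfl⟩
        · rw [hdk rfl] at hsmall ⊢
          interval_cases d' <;> simp at hsmall ⊢
        · interval_cases d <;> interval_cases d' <;> simp at hsmall ⊢)) hE hBE hlog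
    exact hfin h1 h2
  · obtain ⟨g', hg'⟩ : g ∣ ((r * 3 : ℕ) : 𝓞 K) := by
      rw [← Ideal.mem_span_singleton, hgspan, ← Ideal.span_singleton_le_iff_mem, Nat.cast_mul,
        ← Ideal.span_singleton_mul_span_singleton, ← h𝔮, ← h𝔱]
      exact Ideal.mul_mono (Ideal.pow_le_pow_right hd.le) (Ideal.pow_le_pow_right hd'.le)
    have hg'0 : g' ≠ 0 := by
      rintro rfl
      rw [mul_zero] at hg'
      have : r * 3 = 0 := by exact_mod_cast hg'
      omega
    have hlog' : |h.logPos g'| < 2 / 3 * Real.log E := by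
      have := congrArg h.logPos hg'
      rw [h.logPos_natCast, h.logPos_mul hg0 hg'0] at this
      rwa [show h.logPos g' = -h.logPos g by linarith, abs_neg]
    have hn' : r ^ d * 3 ^ d' * (Algebra.norm ℤ g').natAbs = (r * 3) ^ 3 := by
      rw [← hgn, ← Int.natAbs_mul, ← map_mul, ← hg', ← Ideal.absNorm_span_singleton,
        h.absNorm_span_natCast]
    exfalso
    have key : ∀ n : ℕ, (Algebra.norm ℤ g').natAbs = n → 1 < n → n ≤ B →
        n ∈ ({1, 2, 3, 4, 6, 9, 12} : Finset ℕ) → False := fun n hn h1 hB hmem => by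
      have := (h.eq_one_of_abs_logPos_lt hirr hP hn (by omega) (by exact_mod_cast hB)
        (hcube hmem) hE hBE hlog').1
      omega
    rcases hr with ⟨rfl, rfl, rfl⟩ | ⟨rfl, rfl, rfl⟩
    · rw [hdk rfl] at hsmall hn'
      interval_cases d' <;> simp at hsmall
      exact key 3 (by omega) (by norm_num) le_rfl (by simp)
    · interval_cases d <;> interval_cases d' <;> simp at hsmall
      · exact key 12 (by omega) (by norm_num) (by norm_num) (by simp)
      · exact key 6 (by omega) (by norm_num) (by norm_num) (by simp)

theorem eq_of_abs_logPos_sub_lt_of_orderOf (hirr : ∀ y z : ℤ, y ^ 3 = P * z ^ 3 → z = 0)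
    (hP : 0 < P) {r k B p : ℕ} (hr : r = 1 ∧ k = 1 ∧ B = 3 ∨ r = 2 ∧ k = 3 ∧ B = 12)
    (hp : p.Prime) (hp3 : p ≠ 3) {𝔠 𝔮 𝔱 : Ideal (𝓞 K)} (h𝔠 : 𝔠 ≠ ⊥)
    (h𝔠p : (𝔠 ^ p).IsPrincipal) (h𝔠n : ¬ 𝔠.IsPrincipal)
    (h𝔮 : 𝔮 ^ 3 = Ideal.span {(r : 𝓞 K)}) (h𝔱 : 𝔱 ^ 3 = Ideal.span {((3 : ℕ) : 𝓞 K)}) {E : ℝ}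
    (hE : 1 ≤ E) (hBE : B * (E + 3) < √27 / 2 * P) (i i' : Fin p × Fin k × Fin 3)
    {v v' : 𝓞 K} (hv : v ≠ 0) (hv' : v' ≠ 0)
    (heq : Ideal.span {v} * (𝔠 ^ i.1.1 * (𝔮 ^ i.2.1.1 * 𝔱 ^ i.2.2.1)) =
      Ideal.span {v'} * (𝔠 ^ i'.1.1 * (𝔮 ^ i'.2.1.1 * 𝔱 ^ i'.2.2.1)))
    (hlog : |h.logPos v - h.logPos v'| < 2 / 3 * Real.log E) :
    i = i' ∧ |h.re (v : 𝓞 K)| = |h.re (v' : 𝓞 K)| := by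
  obtain ⟨⟨a, ha⟩, ⟨e, he⟩, ⟨f, hf⟩⟩ := i
  obtain ⟨⟨a', ha'⟩, ⟨e', he'⟩, ⟨f', hf'⟩⟩ := i'
  simp only at heq
  have hr0 : r ≠ 0 := by omega
  set C : ClassGroup (𝓞 K) := ClassGroup.mk0 ⟨𝔠, mem_nonZeroDivisors_of_ne_zero h𝔠⟩ with hC
  have hCp : orderOf C = p := by
    have := Fact.mk hp
    refine orderOf_eq_prime ?_ ?_
    · rw [hC, ← map_pow, ClassGroup.mk0_eq_one_iff]
      exact h𝔠p
    · rw [hC, Ne, ClassGroup.mk0_eq_one_iff]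
      exact h𝔠n
  have hcl : C ^ (a * 3) = C ^ (a' * 3) := by
    have hcube := congrArg (· ^ 3) heq
    simp only [mul_pow, ← pow_mul, mul_comm _ 3] at hcube
    simp only [pow_mul, h𝔮, h𝔱] at hcube
    simp only [Ideal.span_singleton_pow, ← pow_mul] at hcube
    rw [hC, ← map_pow, ← map_pow, ClassGroup.mk0_eq_mk0_iff]
    refine ⟨v ^ 3 * (r ^ e * (3 : ℕ) ^ f), v' ^ 3 * (r ^ e' * (3 : ℕ) ^ f'), ?_, ?_, ?_⟩
    · have : (r : 𝓞 K) ≠ 0 := by exact_mod_cast hr0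
      have : ((3 : ℕ) : 𝓞 K) ≠ 0 := by norm_num
      positivity
    · have : (r : 𝓞 K) ≠ 0 := by exact_mod_cast hr0
      have : ((3 : ℕ) : 𝓞 K) ≠ 0 := by norm_num
      positivity
    · simp only [← Ideal.span_singleton_mul_span_singleton, SubmonoidClass.mk_pow]
      rw [mul_comm a, mul_comm a']
      refine Eq.trans ?_ (hcube.trans ?_) <;> ring
  have hmod : a * 3 ≡ a' * 3 [MOD p] := by
    rw [pow_eq_pow_iff_modEq, hCp] at hcl
    exact hcl
  have haa : a = a' := by
    have := Nat.ModEq.cancel_right_of_coprime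
      ((Nat.coprime_primes hp Nat.prime_three).2 hp3) hmod
    exact Nat.ModEq.eq_of_lt_of_lt this ha ha'
  subst haa
  have heq' : Ideal.span {v} * (𝔮 ^ e * 𝔱 ^ f) = Ideal.span {v'} * (𝔮 ^ e' * 𝔱 ^ f') := by
    refine mul_left_cancel₀ (pow_ne_zero a h𝔠) ?_
    refine Eq.trans ?_ (heq.trans ?_) <;> ring
  obtain ⟨rfl, rfl, h3⟩ := h.eq_of_abs_logPos_sub_lt hirr hP hr h𝔮 h𝔱 hE hBE he he' hf hf' hv hv'
    heq' hlog
  exact ⟨rfl, h3⟩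

end PureCubic

section IdealCount

variable {K : Type*} [Field K] [NumberField K]

/-- The set of ideals of norm `n` all of whose prime divisors lie in `S`. -/
def idealsWithPrimes (S : Set (Ideal (𝓞 K))) (n : ℕ) : Set (Ideal (𝓞 K)) :=
  {𝔞 | Ideal.absNorm 𝔞 = n ∧ ∀ 𝔭, Prime 𝔭 → 𝔭 ∣ 𝔞 → 𝔭 ∈ S}

theorem finite_idealsWithPrimes (S : Set (Ideal (𝓞 K))) (n : ℕ) : (idealsWithPrimes S n).Finite :=
  (Ideal.finite_setOfPred_absNorm_eq n).subset fun _ h => h.1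

theorem ncard_idealsWithPrimes_empty_le {q : ℕ} (hq : q.Prime) (k : ℕ) :
    (idealsWithPrimes (∅ : Set (Ideal (𝓞 K))) (q ^ k)).ncard ≤ if k = 0 then 1 else 0 := by
  have hsub : ∀ 𝔞 ∈ idealsWithPrimes (∅ : Set (Ideal (𝓞 K))) (q ^ k), 𝔞 = ⊤ := by
    rintro 𝔞 ⟨h1, h2⟩
    by_contra hne
    have h0 : 𝔞 ≠ 0 := by
      rintro rfl
      rw [Ideal.zero_eq_bot, Ideal.absNorm_bot] at h1
      exact (pow_pos hq.pos k).ne h1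
    obtain ⟨𝔭, h𝔭, hd⟩ := WfDvdMonoid.exists_irreducible_factor
      (by simpa [Ideal.isUnit_iff] using hne) h0
    exact h2 𝔭 h𝔭.prime hd
  split_ifs with hk
  · refine (Set.ncard_le_ncard (t := {⊤}) (fun 𝔞 h => hsub 𝔞 h) (Set.finite_singleton _)).trans ?_
    simp
  · rw [Nat.le_zero, Set.ncard_eq_zero (finite_idealsWithPrimes _ _), Set.eq_empty_iff_forall_notMem]
    intro 𝔞 h𝔞
    have h1 := h𝔞.1
    rw [hsub 𝔞 h𝔞, Ideal.absNorm_top] at h1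
    exact (Nat.one_lt_pow hk hq.one_lt).ne h1

theorem ncard_idealsWithPrimes_insert_le {q : ℕ} (hq : q.Prime) {S : Set (Ideal (𝓞 K))}
    {𝔭 : Ideal (𝓞 K)} (h𝔭 : Prime 𝔭) {f : ℕ} (hf : 0 < f) (hN : Ideal.absNorm 𝔭 = q ^ f)
    {u U : ℕ → ℕ} (hu : ∀ k, (idealsWithPrimes S (q ^ k)).ncard ≤ u k)
    (h1 : ∀ k, u k ≤ U k) (h2 : ∀ k, f ≤ k → u k + U (k - f) ≤ U k) (k : ℕ) :
    (idealsWithPrimes (insert 𝔭 S) (q ^ k)).ncard ≤ U k := by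
  induction k using Nat.strong_induction_on with
  | _ k ih =>
    have hsub : ∀ 𝔞 ∈ idealsWithPrimes (insert 𝔭 S) (q ^ k), 𝔞 ∈ idealsWithPrimes S (q ^ k) ∨
        f ≤ k ∧ ∃ 𝔟 ∈ idealsWithPrimes (insert 𝔭 S) (q ^ (k - f)), 𝔭 * 𝔟 = 𝔞 := by
      rintro 𝔞 ⟨ha1, ha2⟩
      by_cases hd : 𝔭 ∣ 𝔞
      · right
        obtain ⟨𝔟, rfl⟩ := hd
        rw [map_mul, hN] at ha1
        have hfk : f ≤ k := (Nat.pow_dvd_pow_iff_le_right hq.one_lt).1 ⟨_, ha1.symm⟩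
        refine ⟨hfk, 𝔟, ⟨?_, fun 𝔮 h𝔮 hd => ha2 𝔮 h𝔮 (hd.mul_left _)⟩, rfl⟩
        refine Nat.eq_of_mul_eq_mul_left (pow_pos hq.pos f) ?_
        rw [ha1, ← pow_add, Nat.add_sub_cancel' hfk]
      · left
        refine ⟨ha1, fun 𝔮 h𝔮 hd' => ?_⟩
        rcases ha2 𝔮 h𝔮 hd' with rfl | h
        · exact absurd hd' hd
        · exact h
    by_cases hfk : f ≤ k
    · refine le_trans ?_ (h2 k hfk)
      refine (Set.ncard_le_ncard (t := idealsWithPrimes S (q ^ k) ∪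
        (𝔭 * ·) '' idealsWithPrimes (insert 𝔭 S) (q ^ (k - f))) ?_ ?_).trans ?_
      · intro 𝔞 h𝔞
        exact (hsub 𝔞 h𝔞).imp id fun h => h.2
      · exact (finite_idealsWithPrimes _ _).union ((finite_idealsWithPrimes _ _).image _)
      · refine (Set.ncard_union_le _ _).trans (add_le_add (hu k) ?_)
        exact (Set.ncard_image_le (finite_idealsWithPrimes _ _)).trans (ih _ (by omega))
    · refine le_trans ?_ ((hu k).trans (h1 k))
      exact Set.ncard_le_ncard (fun 𝔞 h𝔞 => (hsub 𝔞 h𝔞).resolve_right fun h => hfk h.1)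
        (finite_idealsWithPrimes _ _)

theorem ncard_idealsWithPrimes_le_choose {q : ℕ} (hq : q.Prime) (S : Finset (Ideal (𝓞 K)))
    (hS : ∀ 𝔭 ∈ S, Prime 𝔭 ∧ ∃ f, 0 < f ∧ Ideal.absNorm 𝔭 = q ^ f) {s : ℕ}
    (hs : S.card ≤ s + 1) (k : ℕ) :
    (idealsWithPrimes (S : Set (Ideal (𝓞 K))) (q ^ k)).ncard ≤ (k + s).choose s := by
  classical
  induction S using Finset.induction_on generalizing s k with
  | empty =>
    rw [Finset.coe_empty]
    refine (ncard_idealsWithPrimes_empty_le hq k).trans ?_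
    have := Nat.choose_pos (Nat.le_add_left s k)
    split_ifs <;> omega
  | insert 𝔭 T h𝔭 ih =>
    rw [Finset.card_insert_of_notMem h𝔭] at hs
    obtain ⟨hp, f, hf, hN⟩ := hS 𝔭 (Finset.mem_insert_self _ _)
    have hT := fun 𝔮 h𝔮 => hS 𝔮 (Finset.mem_insert_of_mem h𝔮)
    rw [Finset.coe_insert]
    rcases s with _ | s
    · have hT0 : T = ∅ := Finset.card_eq_zero.1 (by omega)
      subst hT0
      rw [Nat.add_zero, Nat.choose_zero_right]
      refine ncard_idealsWithPrimes_insert_le hq hp hf hN (U := fun _ => 1)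
        (u := fun k => if k = 0 then 1 else 0) ?_ ?_ ?_ k
      · intro k
        simpa using ncard_idealsWithPrimes_empty_le hq k
      · intro k
        split_ifs <;> omega
      · intro k hk
        rw [if_neg (by omega)]
    · refine ncard_idealsWithPrimes_insert_le hq hp hf hN (U := fun k => (k + (s + 1)).choose (s + 1))
        (u := fun k => (k + s).choose s) (fun k => ih hT (by omega) k) ?_ ?_ k
      · intro k
        rw [← add_assoc, Nat.choose_succ_succ]
        omega
      · intro k hk
        rw [← add_assoc k, Nat.choose_succ_succ]
        refine Nat.add_le_add_left (Nat.choose_le_choose _ (by omega)) _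

theorem ncard_absNorm_eq_mul_le {m n : ℕ} (hmn : m.Coprime n) :
    {𝔞 : Ideal (𝓞 K) | Ideal.absNorm 𝔞 = m * n}.ncard ≤
      {𝔞 : Ideal (𝓞 K) | Ideal.absNorm 𝔞 = m}.ncard *
        {𝔞 : Ideal (𝓞 K) | Ideal.absNorm 𝔞 = n}.ncard := by
  rw [← Set.ncard_prod]
  refine Set.ncard_le_ncard_of_injOn
    (fun 𝔞 => (𝔞 ⊔ Ideal.span {(m : 𝓞 K)}, 𝔞 ⊔ Ideal.span {(n : 𝓞 K)})) ?_ ?_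
    ((Ideal.finite_setOfPred_absNorm_eq _).prod (Ideal.finite_setOfPred_absNorm_eq _))
  all_goals
    have hcop : Ideal.span {(m : 𝓞 K)} ⊔ Ideal.span {(n : 𝓞 K)} = ⊤ := by
      rw [← Ideal.isCoprime_iff_sup_eq, Ideal.isCoprime_span_singleton_iff]
      have := (Nat.isCoprime_iff_coprime.2 hmn).map (Int.castRingHom (𝓞 K))
      simpa using this
    have hprod : ∀ 𝔞 : Ideal (𝓞 K), Ideal.absNorm 𝔞 = m * n →
        (𝔞 ⊔ Ideal.span {(m : 𝓞 K)}) * (𝔞 ⊔ Ideal.span {(n : 𝓞 K)}) = 𝔞 := by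
      intro 𝔞 h𝔞
      refine le_antisymm ?_ ?_
      · rw [Ideal.sup_mul, Ideal.mul_sup, Ideal.mul_sup]
        refine sup_le (sup_le Ideal.mul_le_left Ideal.mul_le_left)
          (sup_le Ideal.mul_le_right ?_)
        rw [Ideal.span_singleton_mul_span_singleton, Ideal.span_singleton_le_iff_mem]
        have := Ideal.absNorm_mem 𝔞
        rw [h𝔞] at this
        exact_mod_cast this
      · calc 𝔞 = 𝔞 * (Ideal.span {(m : 𝓞 K)} ⊔ Ideal.span {(n : 𝓞 K)}) := by
              rw [hcop, Ideal.mul_top]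
          _ ≤ _ := by
            rw [Ideal.mul_sup, Ideal.sup_mul, Ideal.mul_sup, Ideal.mul_sup]
            refine sup_le ?_ ?_
            · rw [mul_comm]; exact le_sup_of_le_right le_sup_left
            · exact le_sup_of_le_left le_sup_right
  · intro 𝔞 h𝔞
    have h𝔞' : Ideal.absNorm 𝔞 = m * n := h𝔞
    have hN := congrArg Ideal.absNorm (hprod 𝔞 h𝔞')
    rw [map_mul, h𝔞'] at hN
    have hd : ∀ {i j : ℕ}, i.Coprime j →
        (Ideal.absNorm (𝔞 ⊔ Ideal.span {(i : 𝓞 K)})).Coprime j := by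
      intro i j hij
      refine Nat.Coprime.coprime_dvd_left (Ideal.absNorm_dvd_absNorm_of_le le_sup_right) ?_
      rw [Ideal.absNorm_span_singleton, show (i : 𝓞 K) = algebraMap ℤ (𝓞 K) i by simp,
        Algebra.norm_algebraMap, Int.natAbs_pow, Int.natAbs_natCast]
      exact hij.pow_left _
    have e1 := hd hmn
    have e2 := hd hmn.symm
    have d1 : Ideal.absNorm (𝔞 ⊔ Ideal.span {(m : 𝓞 K)}) ∣ m :=
      e1.dvd_of_dvd_mul_right (hN ▸ dvd_mul_right _ _)
    have d2 : Ideal.absNorm (𝔞 ⊔ Ideal.span {(n : 𝓞 K)}) ∣ n :=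
      e2.dvd_of_dvd_mul_left (hN ▸ dvd_mul_left _ _)
    have d3 : m ∣ Ideal.absNorm (𝔞 ⊔ Ideal.span {(m : 𝓞 K)}) :=
      e2.symm.dvd_of_dvd_mul_right (hN ▸ dvd_mul_right _ _)
    have d4 : n ∣ Ideal.absNorm (𝔞 ⊔ Ideal.span {(n : 𝓞 K)}) :=
      e1.symm.dvd_of_dvd_mul_left (hN ▸ dvd_mul_left _ _)
    exact ⟨Nat.dvd_antisymm d1 d3, Nat.dvd_antisymm d2 d4⟩
  · intro 𝔞 h𝔞 𝔟 h𝔟 hab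
    rw [Prod.mk.injEq] at hab
    rw [← hprod 𝔞 h𝔞, ← hprod 𝔟 h𝔟, hab.1, hab.2]

end IdealCount

theorem exists_finset_primes {K : Type*} [Field K] [NumberField K]
    (hK : Module.finrank ℚ K = 3) {q : ℕ} (hq : q.Prime) :
    ∃ (S : Finset (Ideal (𝓞 K))) (f : Ideal (𝓞 K) → ℕ),
      (∀ 𝔭, 𝔭 ∈ S ↔ Prime 𝔭 ∧ (q : 𝓞 K) ∈ 𝔭) ∧
      (∀ 𝔭 ∈ S, 0 < f 𝔭 ∧ Ideal.absNorm 𝔭 = q ^ f 𝔭) ∧ ∑ 𝔭 ∈ S, f 𝔭 ≤ 3 := by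
  have hNq : Ideal.absNorm (Ideal.span {(q : 𝓞 K)}) = q ^ 3 := by
    rw [Ideal.absNorm_span_singleton, show (q : 𝓞 K) = algebraMap ℤ (𝓞 K) q by simp,
      Algebra.norm_algebraMap, Int.natAbs_pow, Int.natAbs_natCast, RingOfIntegers.rank, hK]
  have hdvd : ∀ 𝔭 : Ideal (𝓞 K), (q : 𝓞 K) ∈ 𝔭 → Ideal.absNorm 𝔭 ∣ q ^ 3 := fun 𝔭 h => by
    rw [← hNq]
    exact Ideal.absNorm_dvd_absNorm_of_le ((Ideal.span_singleton_le_iff_mem _).2 h)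
  have hfin : {𝔭 : Ideal (𝓞 K) | Prime 𝔭 ∧ (q : 𝓞 K) ∈ 𝔭}.Finite :=
    (Ideal.finite_setOfPred_absNorm_le (q ^ 3)).subset fun 𝔭 h =>
      Nat.le_of_dvd (pow_pos hq.pos 3) (hdvd 𝔭 h.2)
  have hex : ∀ 𝔭 : Ideal (𝓞 K), ∃ f : ℕ, Prime 𝔭 ∧ (q : 𝓞 K) ∈ 𝔭 →
      0 < f ∧ Ideal.absNorm 𝔭 = q ^ f := by
    intro 𝔭
    by_cases h : Prime 𝔭 ∧ (q : 𝓞 K) ∈ 𝔭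
    · obtain ⟨f, -, hf⟩ := (Nat.dvd_prime_pow hq).1 (hdvd 𝔭 h.2)
      refine ⟨f, fun _ => ⟨Nat.pos_of_ne_zero ?_, hf⟩⟩
      rintro rfl
      rw [pow_zero, Ideal.absNorm_eq_one_iff] at hf
      exact h.1.not_isUnit (by rw [Ideal.isUnit_iff, hf])
    · exact ⟨0, fun h' => absurd h' h⟩
  choose f hf using hex
  have hmem : ∀ 𝔭, 𝔭 ∈ hfin.toFinset ↔ Prime 𝔭 ∧ (q : 𝓞 K) ∈ 𝔭 := fun 𝔭 => by simp
  refine ⟨hfin.toFinset, f, hmem, fun 𝔭 h => hf 𝔭 ((hmem 𝔭).1 h), ?_⟩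
  have hd : ∏ 𝔭 ∈ hfin.toFinset, 𝔭 ∣ Ideal.span {(q : 𝓞 K)} :=
    Finset.prod_primes_dvd _ (fun 𝔭 h => ((hmem 𝔭).1 h).1) fun 𝔭 h => by
      rw [Ideal.dvd_span_singleton]
      exact ((hmem 𝔭).1 h).2
  have := map_dvd Ideal.absNorm hd
  rw [hNq, map_prod, Finset.prod_congr rfl fun 𝔭 h => (hf 𝔭 ((hmem 𝔭).1 h)).2,
    Finset.prod_pow_eq_pow_sum] at this
  exact (Nat.pow_dvd_pow_iff_le_right hq.one_lt).1 this

theorem ncard_absNorm_eq_prime_pow_le {K : Type*} [Field K] [NumberField K] {q : ℕ}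
    (S : Set (Ideal (𝓞 K)))
    (hS : ∀ 𝔭, Prime 𝔭 → (q : 𝓞 K) ∈ 𝔭 → 𝔭 ∈ S) (k : ℕ) :
    {𝔞 : Ideal (𝓞 K) | Ideal.absNorm 𝔞 = q ^ k}.ncard ≤ (idealsWithPrimes S (q ^ k)).ncard := by
  refine Set.ncard_le_ncard (fun 𝔞 h𝔞 => ⟨h𝔞, fun 𝔭 h𝔭 hd => hS 𝔭 h𝔭 ?_⟩)
    (finite_idealsWithPrimes _ _)
  have h1 : ((q ^ k : ℕ) : 𝓞 K) ∈ 𝔞 := by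
    rw [← show Ideal.absNorm 𝔞 = q ^ k from h𝔞]
    exact Ideal.absNorm_mem 𝔞
  have h2 := Ideal.dvd_iff_le.1 hd h1
  rw [Nat.cast_pow] at h2
  exact (Ideal.isPrime_of_prime h𝔭).mem_of_pow_mem _ h2

theorem ncard_absNorm_eq_prime_pow_le_choose {K : Type*} [Field K] [NumberField K]
    (hK : Module.finrank ℚ K = 3) {q : ℕ} (hq : q.Prime) (k : ℕ) :
    {𝔞 : Ideal (𝓞 K) | Ideal.absNorm 𝔞 = q ^ k}.ncard ≤ (k + 2).choose 2 := by
  obtain ⟨S, f, hS, hf, hsum⟩ := exists_finset_primes hK hq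
  refine (ncard_absNorm_eq_prime_pow_le _ (fun 𝔭 h1 h2 => (hS 𝔭).2 ⟨h1, h2⟩) k).trans
    (ncard_idealsWithPrimes_le_choose hq S
      (fun 𝔭 h => ⟨((hS 𝔭).1 h).1, f 𝔭, hf 𝔭 h⟩) ?_ k)
  refine le_trans ?_ hsum
  rw [Finset.card_eq_sum_ones]
  exact Finset.sum_le_sum fun 𝔭 h => (hf 𝔭 h).1

namespace PureCubic

variable {P : ℕ} {K : Type*} [Field K] [NumberField K] (h : PureCubic P K)

omit [NumberField K] in
theorem intCast_mem_iff {q : ℕ} (hq : q.Prime) {𝔭 : Ideal (𝓞 K)} (h𝔭 : 𝔭 ≠ ⊤)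
    (hq𝔭 : (q : 𝓞 K) ∈ 𝔭) (n : ℤ) : (n : 𝓞 K) ∈ 𝔭 ↔ (q : ℤ) ∣ n := by
  constructor
  · intro hn
    by_contra hd
    obtain ⟨s, t, hst⟩ := ((Nat.prime_iff_prime_int.1 hq).coprime_iff_not_dvd).2 hd
    refine h𝔭 ((Ideal.eq_top_iff_one _).2 ?_)
    have : ((s * q + t * n : ℤ) : 𝓞 K) ∈ 𝔭 := by
      push_cast
      exact 𝔭.add_mem (𝔭.mul_mem_left _ hq𝔭) (𝔭.mul_mem_left _ hn)
    rwa [hst, Int.cast_one] at this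
  · rintro ⟨m, rfl⟩
    push_cast
    exact 𝔭.mul_mem_right _ hq𝔭

theorem elt_mem_iff {𝔭 : Ideal (𝓞 K)} {r : ℤ} (hr : h.rt - r ∈ 𝔭) (x y z : ℤ) :
    h.elt x y z ∈ 𝔭 ↔ ((x + y * r + z * r ^ 2 : ℤ) : 𝓞 K) ∈ 𝔭 := by
  have : h.elt x y z - ((x + y * r + z * r ^ 2 : ℤ) : 𝓞 K) ∈ 𝔭 := by
    convert 𝔭.mul_mem_left (y + z * (h.rt + r)) hr using 1
    rw [elt]
    push_cast
    ring
  exact ⟨fun h1 => by simpa using 𝔭.sub_mem h1 this, fun h1 => by simpa using 𝔭.add_mem h1 this⟩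

theorem exists_root_of_absNorm_prime {q : ℕ} (hq : q.Prime) {𝔭 : Ideal (𝓞 K)}
    (hN : Ideal.absNorm 𝔭 = q) :
    ∃ r : ℤ, h.rt - r ∈ 𝔭 ∧ (q : ℤ) ∣ r ^ 3 - P := by
  have : Fact q.Prime := ⟨hq⟩
  have hcard : Nat.card (𝓞 K ⧸ 𝔭) = q := hN
  have htop : 𝔭 ≠ ⊤ := by
    rintro rfl
    rw [Ideal.absNorm_top] at hN
    exact hq.one_lt.ne hN
  have := Ideal.Quotient.nontrivial_iff.2 htop
  obtain ⟨r, hr⟩ := AddSubgroup.mem_zmultiples_iff.1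
    (mem_zmultiples_of_prime_card hcard (g := (1 : 𝓞 K ⧸ 𝔭))
      (g' := Ideal.Quotient.mk 𝔭 h.rt) one_ne_zero)
  have hr' : h.rt - r ∈ 𝔭 := by
    rw [← Ideal.Quotient.eq_zero_iff_mem, map_sub, ← hr]
    simp
  refine ⟨r, hr', ?_⟩
  rw [← intCast_mem_iff hq htop (by rw [← hN]; exact Ideal.absNorm_mem 𝔭)]
  convert 𝔭.mul_mem_left (-(h.rt ^ 2 + h.rt * r + r ^ 2)) hr' using 1
  push_cast
  linear_combination h.rt_pow

theorem eq_of_root {q : ℕ} (hq : q.Prime) {𝔭 𝔭' : Ideal (𝓞 K)}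
    (hN : Ideal.absNorm 𝔭 = q) (hN' : Ideal.absNorm 𝔭' = q) {r r' : ℤ} (hr : h.rt - r ∈ 𝔭)
    (hr' : h.rt - r' ∈ 𝔭') (hrr : (q : ℤ) ∣ r - r') : 𝔭 = 𝔭' := by
  have htop : ∀ {I : Ideal (𝓞 K)}, Ideal.absNorm I = q → I ≠ ⊤ ∧ (q : 𝓞 K) ∈ I := by
    rintro I hI
    refine ⟨?_, by rw [← hI]; exact Ideal.absNorm_mem I⟩
    rintro rfl
    rw [Ideal.absNorm_top] at hI
    exact hq.one_lt.ne hI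
  have hr2 : h.rt - r ∈ 𝔭' := by
    have := (intCast_mem_iff hq (htop hN').1 (htop hN').2 (r - r')).2 hrr
    convert 𝔭'.sub_mem hr' this using 1
    push_cast
    ring
  ext w
  obtain ⟨x, y, z, rfl⟩ := h.exists_elt w
  rw [h.elt_mem_iff hr, h.elt_mem_iff hr2, intCast_mem_iff hq (htop hN).1 (htop hN).2,
    intCast_mem_iff hq (htop hN').1 (htop hN').2]

include h in
theorem ncard_absNorm_eq_prime_pow_le_of_mod_three {q : ℕ} (hq : q.Prime) (hq3 : q % 3 = 2)
    (k : ℕ) : {𝔞 : Ideal (𝓞 K) | Ideal.absNorm 𝔞 = q ^ k}.ncard ≤ k / 2 + 1 := by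
  classical
  have := Fact.mk hq
  obtain ⟨S, f, hS, hf, hsum⟩ := exists_finset_primes h.finrank_eq hq
  have huniq : ∀ 𝔭 ∈ S, ∀ 𝔭' ∈ S, f 𝔭 = 1 → f 𝔭' = 1 → 𝔭 = 𝔭' := by
    intro 𝔭 h𝔭 𝔭' h𝔭' h1 h1'
    have hN := (hf 𝔭 h𝔭).2
    have hN' := (hf 𝔭' h𝔭').2
    rw [h1, pow_one] at hN
    rw [h1', pow_one] at hN'
    obtain ⟨r, hr, hrP⟩ := h.exists_root_of_absNorm_prime hq hN
    obtain ⟨r', hr', hrP'⟩ := h.exists_root_of_absNorm_prime hq hN'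
    refine h.eq_of_root hq hN hN' hr hr' ?_
    rw [← ZMod.intCast_zmod_eq_zero_iff_dvd] at hrP hrP' ⊢
    push_cast at hrP hrP' ⊢
    rw [sub_eq_zero] at hrP hrP' ⊢
    exact cube_injective_of_pow_eq hq3 (fun u => ZMod.pow_card u) (hrP.trans hrP'.symm)
  have hle : ∀ 𝔭 ∈ S, Prime 𝔭 ∧ ∃ f, 0 < f ∧ Ideal.absNorm 𝔭 = q ^ f :=
    fun 𝔭 h => ⟨((hS 𝔭).1 h).1, f 𝔭, hf 𝔭 h⟩
  by_cases hall : ∃ 𝔭 ∈ S, 2 ≤ f 𝔭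
  · obtain ⟨𝔭, h𝔭, hf2⟩ := hall
    refine (ncard_absNorm_eq_prime_pow_le (insert 𝔭 ((S.erase 𝔭 : Finset _) : Set (Ideal (𝓞 K))))
      (fun 𝔮 h1 h2 => ?_) k).trans ?_
    · rw [← Finset.coe_insert, Finset.insert_erase h𝔭]
      exact (hS 𝔮).2 ⟨h1, h2⟩
    refine ncard_idealsWithPrimes_insert_le hq (hle 𝔭 h𝔭).1 (hf 𝔭 h𝔭).1 (hf 𝔭 h𝔭).2
      (U := fun k => k / 2 + 1) (u := fun k => 1) (fun k => ?_) (fun k => ?_) (fun k hk => ?_) k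
    · refine (ncard_idealsWithPrimes_le_choose hq (S.erase 𝔭) (s := 0)
        (fun 𝔮 h => hle 𝔮 (Finset.mem_of_mem_erase h)) ?_ k).trans (by simp)
      rw [← Finset.add_sum_erase _ _ h𝔭] at hsum
      have : (S.erase 𝔭).card ≤ ∑ 𝔮 ∈ S.erase 𝔭, f 𝔮 := by
        rw [Finset.card_eq_sum_ones]
        exact Finset.sum_le_sum fun 𝔮 h => (hf 𝔮 (Finset.mem_of_mem_erase h)).1
      omega
    · omega
    · omega
  · push Not at hall
    have hone : ∀ 𝔭 ∈ S, f 𝔭 = 1 := fun 𝔭 h => by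
      have := hall 𝔭 h
      have := (hf 𝔭 h).1
      omega
    refine (ncard_absNorm_eq_prime_pow_le _ (fun 𝔭 h1 h2 => (hS 𝔭).2 ⟨h1, h2⟩) k).trans
      ((ncard_idealsWithPrimes_le_choose hq S hle (s := 0) ?_ k).trans (by simp))
    exact Finset.card_le_one.2 fun 𝔭 h 𝔭' h' => huniq 𝔭 h 𝔭' h' (hone 𝔭 h) (hone 𝔭' h')

include h in
theorem eq_of_mem_of_pow_three {q : ℕ} (hq : q.Prime) {𝔮 : Ideal (𝓞 K)}
    (h𝔮 : 𝔮 ^ 3 = Ideal.span {(q : 𝓞 K)}) {𝔭 : Ideal (𝓞 K)} (h𝔭 : Prime 𝔭)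
    (hq𝔭 : (q : 𝓞 K) ∈ 𝔭) : 𝔭 = 𝔮 := by
  have h1 : 𝔭 ∣ 𝔮 := by
    refine h𝔭.dvd_of_dvd_pow (n := 3) ?_
    rw [h𝔮, Ideal.dvd_span_singleton]
    exact hq𝔭
  have hirr : Irreducible (Ideal.absNorm 𝔮) := by
    rw [h.absNorm_eq_of_pow_three h𝔮]
    exact hq
  have h𝔮p : Prime 𝔮 := by
    refine Ideal.prime_of_isPrime ?_ (Ideal.isPrime_of_irreducible_absNorm hirr)
    rintro rfl
    simp at hirr
  exact associated_iff_eq.1 (h𝔭.associated_of_dvd h𝔮p h1)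

include h in
theorem ncard_absNorm_eq_prime_pow_le_one {q : ℕ} (hq : q.Prime) {𝔮 : Ideal (𝓞 K)}
    (h𝔮 : 𝔮 ^ 3 = Ideal.span {(q : 𝓞 K)}) (k : ℕ) :
    {𝔞 : Ideal (𝓞 K) | Ideal.absNorm 𝔞 = q ^ k}.ncard ≤ 1 := by
  obtain ⟨S, f, hS, hf, hsum⟩ := exists_finset_primes h.finrank_eq hq
  refine (ncard_absNorm_eq_prime_pow_le _ (fun 𝔭 h1 h2 => (hS 𝔭).2 ⟨h1, h2⟩) k).trans
    ((ncard_idealsWithPrimes_le_choose hq S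
      (fun 𝔭 h => ⟨((hS 𝔭).1 h).1, f 𝔭, hf 𝔭 h⟩) (s := 0) ?_ k).trans (by simp))
  refine Finset.card_le_one.2 fun 𝔭 h1 𝔭' h2 => ?_
  rw [h.eq_of_mem_of_pow_three hq h𝔮 ((hS 𝔭).1 h1).1 ((hS 𝔭).1 h1).2,
    h.eq_of_mem_of_pow_three hq h𝔮 ((hS 𝔭').1 h2).1 ((hS 𝔭').1 h2).2]

end PureCubic

section CubicSum

open ArithmeticFunction

/-- The nontrivial Dirichlet character modulo three. -/
def chiThree : ArithmeticFunction ℤ :=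
  ⟨fun n => if n % 3 = 1 then 1 else if n % 3 = 2 then -1 else 0, by simp⟩

/-- The trivial Dirichlet character modulo three. -/
def coprimeThree : ArithmeticFunction ℤ :=
  ⟨fun n => if n % 3 = 0 then 0 else 1, by simp⟩

theorem chiThree_apply (n : ℕ) :
    chiThree n = if n % 3 = 1 then 1 else if n % 3 = 2 then -1 else 0 := rfl

theorem coprimeThree_apply (n : ℕ) : coprimeThree n = if n % 3 = 0 then 0 else 1 := rfl

theorem chiThree_mul (m n : ℕ) : chiThree (m * n) = chiThree m * chiThree n := by
  simp only [chiThree_apply, Nat.mul_mod m n]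
  have hm : m % 3 = 0 ∨ m % 3 = 1 ∨ m % 3 = 2 := by omega
  have hn : n % 3 = 0 ∨ n % 3 = 1 ∨ n % 3 = 2 := by omega
  rcases hm with hm | hm | hm <;> rcases hn with hn | hn | hn <;> simp [hm, hn]

theorem coprimeThree_mul (m n : ℕ) : coprimeThree (m * n) = coprimeThree m * coprimeThree n := by
  simp only [coprimeThree_apply, Nat.mul_mod m n]
  have hm : m % 3 = 0 ∨ m % 3 = 1 ∨ m % 3 = 2 := by omega
  have hn : n % 3 = 0 ∨ n % 3 = 1 ∨ n % 3 = 2 := by omega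
  rcases hm with hm | hm | hm <;> rcases hn with hn | hn | hn <;> simp [hm, hn]

theorem chiThree_pow (m k : ℕ) : chiThree (m ^ k) = chiThree m ^ k := by
  induction k with
  | zero => simp [chiThree_apply]
  | succ k ih => rw [pow_succ, chiThree_mul, ih, pow_succ]

theorem coprimeThree_pow (m k : ℕ) : coprimeThree (m ^ k) = coprimeThree m ^ k := by
  induction k with
  | zero => simp [coprimeThree_apply]
  | succ k ih => rw [pow_succ, coprimeThree_mul, ih, pow_succ]

/-- An upper bound for the number of ideals of norm `n` in a pure cubic field. -/
def cubicCount : ArithmeticFunction ℤ := (zeta : ArithmeticFunction ℤ) * (coprimeThree * chiThree)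

theorem isMultiplicative_cubicCount : cubicCount.IsMultiplicative := by
  refine isMultiplicative_zeta.natCast.mul (.mul ⟨?_, ?_⟩ ⟨?_, ?_⟩)
  · simp [coprimeThree_apply]
  · intro m n _; exact coprimeThree_mul m n
  · simp [chiThree_apply]
  · intro m n _; exact chiThree_mul m n

theorem coprimeThree_mul_chiThree_prime_pow {q : ℕ} (hq : q.Prime) (k : ℕ) :
    (coprimeThree * chiThree) (q ^ k) =
      ∑ i ∈ Finset.range (k + 1), coprimeThree q ^ (k - i) * chiThree q ^ i := by
  rw [mul_comm, mul_apply, Nat.sum_divisorsAntidiagonal fun i j => chiThree i * coprimeThree j,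
    Nat.sum_divisors_prime_pow hq]
  refine Finset.sum_congr rfl fun i hi => ?_
  rw [Nat.pow_div (by simpa [Nat.lt_succ_iff] using hi) hq.pos, chiThree_pow,
    coprimeThree_pow, mul_comm]

theorem cubicCount_prime_pow {q : ℕ} (hq : q.Prime) (k : ℕ) :
    cubicCount (q ^ k) = ∑ i ∈ Finset.range (k + 1), (coprimeThree * chiThree) (q ^ i) := by
  rw [cubicCount, coe_zeta_mul_apply, Nat.sum_divisors_prime_pow hq]

theorem cubicCount_prime_pow_of_mod_one {q : ℕ} (hq : q.Prime) (hq3 : q % 3 = 1) (k : ℕ) :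
    cubicCount (q ^ k) = (k + 2).choose 2 := by
  have h1 : coprimeThree q = 1 := by simp [coprimeThree_apply, hq3]
  have h2 : chiThree q = 1 := by simp [chiThree_apply, hq3]
  rw [cubicCount_prime_pow hq]
  simp only [coprimeThree_mul_chiThree_prime_pow hq, h1, h2, one_pow, mul_one, Finset.sum_const,
    Finset.card_range, nsmul_eq_mul]
  induction k with
  | zero => simp
  | succ k ih =>
    have := Nat.choose_succ_succ (k + 2) 1
    rw [Nat.choose_one_right] at this
    rw [Finset.sum_range_succ, ih, show k + 1 + 2 = (k + 2).succ by rfl, this]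
    push_cast
    ring

theorem cubicCount_prime_pow_of_mod_two {q : ℕ} (hq : q.Prime) (hq3 : q % 3 = 2) (k : ℕ) :
    cubicCount (q ^ k) = (k / 2 + 1 : ℕ) := by
  have h1 : coprimeThree q = 1 := by simp [coprimeThree_apply, hq3]
  have h2 : chiThree q = -1 := by simp [chiThree_apply, hq3]
  rw [cubicCount_prime_pow hq]
  simp only [coprimeThree_mul_chiThree_prime_pow hq, h1, h2, one_pow, one_mul, neg_one_geom_sum]
  induction k with
  | zero => simp
  | succ k ih =>
    rw [Finset.sum_range_succ, ih]
    rcases Nat.even_or_odd' k with ⟨j, rfl | rfl⟩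
    · rw [if_pos (by simp [parity_simps])]
      push_cast
      omega
    · rw [if_neg (by simp [parity_simps])]
      push_cast
      omega

theorem cubicCount_three_pow (k : ℕ) : cubicCount (3 ^ k) = 1 := by
  have h1 : coprimeThree 3 = 0 := by simp [coprimeThree_apply]
  have h2 : chiThree 3 = 0 := by simp [chiThree_apply]
  rw [cubicCount_prime_pow Nat.prime_three]
  simp only [coprimeThree_mul_chiThree_prime_pow Nat.prime_three, h1, h2]
  rw [Finset.sum_eq_single 0]
  · simp
  · intro i _ hi
    refine Finset.sum_eq_zero fun j hj => ?_
    rcases Nat.eq_zero_or_pos j with rfl | hj0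
    · simp [hi]
    · rw [zero_pow hj0.ne', mul_zero]
  · simp

end CubicSum

namespace PureCubic

variable {P : ℕ} {K : Type*} [Field K] [NumberField K] (h : PureCubic P K)

include h in
theorem ncard_absNorm_le_cubicCount (hP9 : P % 9 ≠ 1 ∧ P % 9 ≠ 8) (h3 : ¬ 3 ∣ P) {n : ℕ}
    (hn : n ≠ 0) :
    ({𝔞 : Ideal (𝓞 K) | Ideal.absNorm 𝔞 = n}.ncard : ℤ) ≤ cubicCount n := by
  have key : ∀ q k : ℕ, q.Prime →
      ({𝔞 : Ideal (𝓞 K) | Ideal.absNorm 𝔞 = q ^ k}.ncard : ℤ) ≤ cubicCount (q ^ k) := by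
    intro q k hq
    have hcases : q % 3 = 0 ∨ q % 3 = 1 ∨ q % 3 = 2 := by omega
    rcases hcases with h0 | h1 | h2
    · obtain rfl : q = 3 := ((Nat.prime_dvd_prime_iff_eq Nat.prime_three hq).1
        (Nat.dvd_of_mod_eq_zero h0)).symm
      obtain ⟨𝔮, h𝔮, -⟩ := h.exists_ideal_pow_three_eq_three hP9 h3
      rw [cubicCount_three_pow]
      exact_mod_cast h.ncard_absNorm_eq_prime_pow_le_one Nat.prime_three
        (by exact_mod_cast h𝔮) k
    · rw [cubicCount_prime_pow_of_mod_one hq h1]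
      exact_mod_cast ncard_absNorm_eq_prime_pow_le_choose h.finrank_eq hq k
    · rw [cubicCount_prime_pow_of_mod_two hq h2]
      exact_mod_cast h.ncard_absNorm_eq_prime_pow_le_of_mod_three hq h2 k
  induction n using Nat.recOnPosPrimePosCoprime with
  | zero => exact absurd rfl hn
  | one => simpa using key 2 0 Nat.prime_two
  | prime_pow q k hq _ => exact key q k hq
  | coprime a b ha hb hab iha ihb =>
    rw [isMultiplicative_cubicCount.map_mul_of_coprime hab]
    refine (Nat.cast_le.2 (ncard_absNorm_eq_mul_le hab)).trans ?_
    rw [Nat.cast_mul]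
    exact mul_le_mul (iha (by omega)) (ihb (by omega)) (by positivity)
      ((Nat.cast_nonneg _).trans (iha (by omega)))

end PureCubic

section CubicSumBound

open ArithmeticFunction

theorem sum_Ioc_mul_apply_mul (f g : ArithmeticFunction ℤ) (φ : ℕ → ℝ) (N : ℕ) :
    ∑ n ∈ Finset.Ioc 0 N, ((f * g) n : ℝ) * φ n =
      ∑ n ∈ Finset.Ioc 0 N, (f n : ℝ) * ∑ m ∈ Finset.Ioc 0 (N / n), (g m : ℝ) * φ (n * m) := by
  have h1 : ∑ n ∈ Finset.Ioc 0 N, ((f * g) n : ℝ) * φ n =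
      ∑ x ∈ Finset.Ioc 0 N ×ˢ Finset.Ioc 0 N with x.1 * x.2 ≤ N,
        (f x.1 : ℝ) * ((g x.2 : ℝ) * φ (x.1 * x.2)) := by
    trans ∑ n ∈ Finset.Ioc 0 N, ∑ x ∈ Finset.Ioc 0 N ×ˢ Finset.Ioc 0 N with x.1 * x.2 = n,
        (f x.1 : ℝ) * ((g x.2 : ℝ) * φ (x.1 * x.2))
    · refine Finset.sum_congr rfl fun n hn ↦ ?_
      simp only [Finset.mem_Ioc] at hn
      rw [mul_apply, Nat.divisorsAntidiagonal_eq_prod_filter_of_le hn.1.ne' hn.2, Int.cast_sum,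
        Finset.sum_mul]
      refine Finset.sum_congr rfl fun x hx => ?_
      rw [(Finset.mem_filter.1 hx).2]
      push_cast
      ring
    · simp_rw [Finset.sum_filter]
      rw [Finset.sum_comm]
      exact Finset.sum_congr rfl fun _ _ ↦ (by simp_all)
  rw [h1, Finset.sum_filter, Finset.sum_product]
  refine Finset.sum_congr rfl fun n hn ↦ ?_
  rw [← Finset.sum_filter, Finset.mul_sum]
  congr 1
  ext m
  simp only [Finset.mem_filter, Finset.mem_Ioc] at hn ⊢
  rw [Nat.le_div_iff_mul_le hn.1, mul_comm m n]
  constructor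
  · rintro ⟨⟨h1, h2⟩, h3⟩
    exact ⟨h1, h3⟩
  · rintro ⟨h1, h2⟩
    exact ⟨⟨h1, (Nat.le_mul_of_pos_left m hn.1).trans h2⟩, h2⟩

theorem sum_log_div_le {M : ℕ} (hM : 1 ≤ M) {y : ℝ} (hy : 0 < y) :
    ∑ d ∈ Finset.Ioc 0 M, Real.log (y / d) ≤ y - 1 := by
  induction M, hM using Nat.le_induction generalizing y with
  | base => simpa using Real.log_le_sub_one_of_pos hy
  | succ M hM ih =>
    have hM0 : (0 : ℝ) < M := by exact_mod_cast hM
    have hih := ih (y := y * M / (M + 1)) (by positivity)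
    have hsplit : ∑ d ∈ Finset.Ioc 0 M, Real.log (y / d) =
        ∑ d ∈ Finset.Ioc 0 M, Real.log (y * M / (M + 1) / d) + M * Real.log ((M + 1) / M) := by
      rw [← nsmul_eq_mul, ← show ∑ d ∈ Finset.Ioc 0 M, Real.log (((M : ℝ) + 1) / M) =
        M • Real.log ((M + 1) / M) by simp, ← Finset.sum_add_distrib]
      refine Finset.sum_congr rfl fun d hd => ?_
      have hd0 : (0 : ℝ) < d := by exact_mod_cast (Finset.mem_Ioc.1 hd).1
      rw [← Real.log_mul (by positivity) (by positivity)]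
      congr 1
      field_simp
    rw [Finset.sum_Ioc_succ_top (by omega), hsplit]
    have h1 : Real.log (((M : ℝ) + 1) / M) ≤ 1 / M := by
      refine (Real.log_le_sub_one_of_pos (by positivity)).trans (le_of_eq ?_)
      field_simp
      ring
    have h2 : Real.log (y / ((M + 1 : ℕ) : ℝ)) ≤ y / (M + 1) - 1 := by
      push_cast
      exact Real.log_le_sub_one_of_pos (by positivity)
    have h3 : M * Real.log (((M : ℝ) + 1) / M) ≤ 1 := by
      refine (mul_le_mul_of_nonneg_left h1 hM0.le).trans (le_of_eq ?_)
      field_simp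
    have h4 : y * M / (M + 1) + y / (M + 1) = y := by field_simp
    linarith

theorem coprimeThree_mul_chiThree_nonneg (n : ℕ) : 0 ≤ (coprimeThree * chiThree) n := by
  have hmult : (coprimeThree * chiThree).IsMultiplicative :=
    .mul ⟨by simp [coprimeThree_apply], fun {m n} _ => coprimeThree_mul m n⟩
      ⟨by simp [chiThree_apply], fun {m n} _ => chiThree_mul m n⟩
  induction n using Nat.recOnPosPrimePosCoprime with
  | zero => simp
  | one => rw [hmult.map_one]; norm_num
  | prime_pow q k hq hk =>
    rw [coprimeThree_mul_chiThree_prime_pow hq]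
    have hcases : q % 3 = 0 ∨ q % 3 = 1 ∨ q % 3 = 2 := by omega
    rcases hcases with h | h | h
    · refine Finset.sum_nonneg fun i _ => mul_nonneg (pow_nonneg ?_ _) (pow_nonneg ?_ _) <;>
        simp [coprimeThree_apply, chiThree_apply, h]
    · exact Finset.sum_nonneg fun i _ => by simp [coprimeThree_apply, chiThree_apply, h]
    · simp only [coprimeThree_apply, chiThree_apply, h]
      norm_num [neg_one_geom_sum]
      split_ifs <;> norm_num
  | coprime a b ha hb hab iha ihb =>
    rw [hmult.map_mul_of_coprime hab]
    exact mul_nonneg iha ihb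

theorem sum_Ioc_three_mul_succ (φ : ℕ → ℝ) (j : ℕ) :
    ∑ e ∈ Finset.Ioc 0 (3 * (j + 1)), φ e =
      ∑ e ∈ Finset.Ioc 0 (3 * j), φ e + φ (3 * j + 1) + φ (3 * j + 2) + φ (3 * j + 3) := by
  rw [show 3 * (j + 1) = 3 * j + 1 + 1 + 1 by ring, Finset.sum_Ioc_succ_top (by omega),
    Finset.sum_Ioc_succ_top (by omega), Finset.sum_Ioc_succ_top (by omega)]

theorem chiThree_three_mul (j : ℕ) : chiThree (3 * j + 1) = 1 ∧ chiThree (3 * j + 2) = -1 ∧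
    chiThree (3 * j + 3) = 0 := by
  refine ⟨?_, ?_, ?_⟩ <;> rw [chiThree_apply]
  · rw [if_pos (by omega)]
  · rw [if_neg (by omega), if_pos (by omega)]
  · rw [if_neg (by omega), if_neg (by omega)]

theorem sum_chiThree (j : ℕ) : ∑ e ∈ Finset.Ioc 0 (3 * j), (chiThree e : ℝ) = 0 := by
  induction j with
  | zero => simp
  | succ j ih =>
    obtain ⟨h1, h2, h3⟩ := chiThree_three_mul j
    rw [sum_Ioc_three_mul_succ, ih, h1, h2, h3]
    norm_num

theorem sum_chiThree_div_succ (j : ℕ) : ∑ e ∈ Finset.Ioc 0 (3 * (j + 1)), (chiThree e : ℝ) / e =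
    ∑ e ∈ Finset.Ioc 0 (3 * j), (chiThree e : ℝ) / e + 1 / ((3 * j + 1) * (3 * j + 2)) := by
  obtain ⟨h1, h2, h3⟩ := chiThree_three_mul j
  rw [sum_Ioc_three_mul_succ, h1, h2, h3]
  push_cast
  field_simp
  ring

theorem sum_chiThree_div_le {j : ℕ} (hj : 1 ≤ j) :
    1 / 5 ≤ (61 / 100 - ∑ e ∈ Finset.Ioc 0 (3 * j), (chiThree e : ℝ) / e) * (3 * j - 1) ∧
    1 / 5 + 1 / (3 * j + 1) ≤
      (61 / 100 - ∑ e ∈ Finset.Ioc 0 (3 * j), (chiThree e : ℝ) / e) * (3 * j + 2) := by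
  have h0 : ∑ e ∈ Finset.Ioc 0 (3 * 0), (chiThree e : ℝ) / e = 0 := by simp
  have h1 := sum_chiThree_div_succ 0
  have h2 := sum_chiThree_div_succ 1
  have h3 := sum_chiThree_div_succ 2
  rw [h0] at h1
  rw [h1] at h2
  rw [h2] at h3
  obtain rfl | rfl | hj3 : j = 1 ∨ j = 2 ∨ 3 ≤ j := by omega
  · rw [show 3 * 1 = 3 * (0 + 1) by rfl, h1]
    norm_num
  · rw [show 3 * 2 = 3 * (1 + 1) by rfl, h2]
    norm_num
  · have key : 1 / 3 / (3 * j - 1) ≤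
        61 / 100 - ∑ e ∈ Finset.Ioc 0 (3 * j), (chiThree e : ℝ) / e := by
      induction j, hj3 using Nat.le_induction with
      | base =>
        rw [show 3 * 3 = 3 * (2 + 1) by rfl, h3]
        norm_num
      | succ j hj3 ih =>
        have ih := ih (by omega)
        rw [sum_chiThree_div_succ]
        have hj : (3 : ℝ) ≤ j := by exact_mod_cast hj3
        have : (1 : ℝ) / 3 / (3 * (j + 1 : ℕ) - 1) + 1 / ((3 * j + 1) * (3 * j + 2)) ≤
            1 / 3 / (3 * j - 1) := by
          push_cast
          rw [div_add_div _ _ (by nlinarith) (by positivity),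
            div_le_div_iff₀ (by apply mul_pos <;> nlinarith) (by linarith)]
          nlinarith
        linarith
    have hj : (3 : ℝ) ≤ j := by exact_mod_cast hj3
    set t := 61 / 100 - ∑ e ∈ Finset.Ioc 0 (3 * j), (chiThree e : ℝ) / e
    rw [div_le_iff₀ (by linarith)] at key
    have ht : 0 ≤ t := by nlinarith
    refine ⟨by linarith, ?_⟩
    have : (1 : ℝ) / (3 * j + 1) ≤ 1 / 10 := one_div_le_one_div_of_le (by norm_num) (by linarith)
    nlinarith

theorem sum_chiThree_mul_le {M : ℕ} (hM : 1 ≤ M) {y : ℝ} (hy : M ≤ y) (hy' : y ≤ M + 1) :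
    ∑ e ∈ Finset.Ioc 0 M, (chiThree e : ℝ) * (y / e - 1) ≤ 61 / 100 * y - 1 / 5 := by
  have hsplit : ∑ e ∈ Finset.Ioc 0 M, (chiThree e : ℝ) * (y / e - 1) =
      y * ∑ e ∈ Finset.Ioc 0 M, (chiThree e : ℝ) / e - ∑ e ∈ Finset.Ioc 0 M, (chiThree e : ℝ) := by
    rw [Finset.mul_sum, ← Finset.sum_sub_distrib]
    exact Finset.sum_congr rfl fun e _ => by ring
  rw [hsplit]
  have hy0 : 1 ≤ y := hy.trans' (by exact_mod_cast hM)
  obtain ⟨j, rfl | rfl | rfl⟩ : ∃ j, M = 3 * j + 1 ∨ M = 3 * j + 2 ∨ M = 3 * (j + 1) :=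
    ⟨(M - 1) / 3, by omega⟩
  · rw [Finset.sum_Ioc_succ_top (by omega), Finset.sum_Ioc_succ_top (by omega), sum_chiThree,
      (chiThree_three_mul j).1]
    push_cast at hy hy' ⊢
    rcases Nat.eq_zero_or_pos j with rfl | hj
    · simp at hy hy' ⊢
      linarith
    · obtain ⟨h1, h2⟩ := sum_chiThree_div_le hj
      set t := ∑ e ∈ Finset.Ioc 0 (3 * j), (chiThree e : ℝ) / e
      have hj' : (1 : ℝ) ≤ j := by exact_mod_cast hj
      set u : ℝ := 1 / (3 * j + 1) with hu
      have hu1 : u * (3 * j + 1) = 1 := by rw [hu]; field_simp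
      have ht : 0 ≤ 61 / 100 - t := by
        by_contra! hneg
        nlinarith
      nlinarith [mul_nonneg (sub_nonneg.2 hy) (sub_nonneg.2 h2),
        mul_nonneg (sub_nonneg.2 hy') (sub_nonneg.2 h1), mul_nonneg (sub_nonneg.2 hy') ht]
  · have := sum_chiThree_div_succ j
    rw [show 3 * (j + 1) = 3 * j + 2 + 1 by ring, Finset.sum_Ioc_succ_top (by omega),
      show 3 * j + 2 + 1 = 3 * j + 3 by ring, (chiThree_three_mul j).2.2] at this
    have h0 := sum_chiThree (j + 1)
    rw [show 3 * (j + 1) = 3 * j + 2 + 1 by ring, Finset.sum_Ioc_succ_top (by omega),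
      show 3 * j + 2 + 1 = 3 * j + 3 by ring, (chiThree_three_mul j).2.2] at h0
    have h1 := (sum_chiThree_div_le (j := j + 1) (by omega)).1
    rw [sum_chiThree_div_succ] at h1
    rw [Int.cast_zero, zero_div, add_zero] at this
    rw [Int.cast_zero, add_zero] at h0
    rw [h0, this]
    push_cast at h1 hy
    set t := ∑ e ∈ Finset.Ioc 0 (3 * j), (chiThree e : ℝ) / e + 1 / ((3 * j + 1) * (3 * j + 2))
    have hj' : (0 : ℝ) ≤ j := by positivity
    have ht : 0 ≤ 61 / 100 - t := by
      by_contra! hneg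
      nlinarith
    nlinarith [mul_nonneg (sub_nonneg.2 hy) ht]
  · rw [sum_chiThree]
    have h1 := (sum_chiThree_div_le (j := j + 1) (by omega)).1
    push_cast at h1 hy
    set t := ∑ e ∈ Finset.Ioc 0 (3 * (j + 1)), (chiThree e : ℝ) / e
    have hj' : (0 : ℝ) ≤ j := by positivity
    have ht : 0 ≤ 61 / 100 - t := by
      by_contra! hneg
      nlinarith
    nlinarith [mul_nonneg (sub_nonneg.2 hy) ht]

end CubicSumBound

section CubicSumEstimate

open ArithmeticFunction

theorem sum_cubicCount_mul_log_le (N : ℕ) :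
    ∑ n ∈ Finset.Ioc 0 N, (cubicCount n : ℝ) * Real.log (N / n) ≤
      ∑ m ∈ Finset.Ioc 0 N, (coprimeThree m : ℝ) * (61 / 100 * (N / m) - 1 / 5) := by
  rw [cubicCount, mul_comm, sum_Ioc_mul_apply_mul _ _ fun n => Real.log (N / n)]
  refine (Finset.sum_le_sum (g := fun k => ((coprimeThree * chiThree) k : ℝ) * (N / k - 1))
    fun k hk => ?_).trans ?_
  · rw [Finset.mem_Ioc] at hk
    have hk0 : (0 : ℝ) < k := by exact_mod_cast hk.1
    have hN0 : (0 : ℝ) < N := by exact_mod_cast hk.1.trans_le hk.2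
    refine mul_le_mul_of_nonneg_left ?_ (by exact_mod_cast coprimeThree_mul_chiThree_nonneg k)
    refine le_trans (le_of_eq ?_) (sum_log_div_le (M := N / k)
      ((Nat.one_le_div_iff hk.1).2 hk.2) (div_pos hN0 hk0))
    refine Finset.sum_congr rfl fun d hd => ?_
    have hd0 : d ≠ 0 := (Finset.mem_Ioc.1 hd).1.ne'
    simp [hd0, div_div]
  · rw [sum_Ioc_mul_apply_mul _ _ fun k => (N : ℝ) / k - 1]
    refine Finset.sum_le_sum fun m hm => ?_
    rw [Finset.mem_Ioc] at hm
    have hm0 : (0 : ℝ) < m := by exact_mod_cast hm.1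
    refine mul_le_mul_of_nonneg_left ?_ ?_
    · refine le_trans (le_of_eq ?_) (sum_chiThree_mul_le (M := N / m)
        ((Nat.one_le_div_iff hm.1).2 hm.2) (y := (N : ℝ) / m) Nat.cast_div_le ?_)
      · refine Finset.sum_congr rfl fun e _ => ?_
        rw [Nat.cast_mul, div_div]
      · rw [div_le_iff₀ hm0]
        exact_mod_cast (Nat.lt_div_mul_add hm.1 (a := N)).le.trans (by rw [add_mul, one_mul])
    · rw [coprimeThree_apply]
      split_ifs <;> norm_num

theorem sum_coprimeThree_block_le {j : ℕ} (hj : 1 ≤ j) :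
    (1 : ℝ) / (3 * j + 1) + 1 / (3 * j + 2) ≤
      2 / 3 * (Real.log ((54 * j + 53) / 53) - Real.log ((54 * (j - 1) + 53) / 53)) := by
  have hj' : (1 : ℝ) ≤ j := by exact_mod_cast hj
  have h1 := Real.le_log_one_add_of_nonneg (x := 54 / (54 * (j - 1) + 53))
    (div_nonneg (by norm_num) (by linarith))
  have h2 : (1 : ℝ) + 54 / (54 * (j - 1) + 53) = ((54 * j + 53) / 53) / ((54 * (j - 1) + 53) / 53) := by
    have : (54 * ((j : ℝ) - 1) + 53) ≠ 0 := by linarith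
    field_simp
    ring
  have h3 : (0 : ℝ) < 54 * (j - 1) + 53 := by linarith
  rw [h2, Real.log_div (by positivity) (by positivity)] at h1
  refine le_trans ?_ (mul_le_mul_of_nonneg_left h1 (by norm_num))
  have h4 : (2 : ℝ) / 3 * (2 * (54 / (54 * (j - 1) + 53)) / (54 / (54 * (j - 1) + 53) + 2)) =
      36 / (54 * j + 26) := by
    have : (54 : ℝ) + (54 * (j - 1) + 53) * 2 ≠ 0 := by linarith
    have : (54 : ℝ) * j + 26 ≠ 0 := by linarith
    field_simp
    ring
  rw [h4, div_add_div _ _ (by linarith) (by linarith),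
    div_le_div_iff₀ (by positivity) (by linarith)]
  nlinarith

theorem sum_coprimeThree_div_le (J : ℕ) :
    ∑ m ∈ Finset.Ioc 0 (3 * J + 2), (coprimeThree m : ℝ) / m ≤
      3 / 2 + 2 / 3 * Real.log ((54 * J + 53) / 53) := by
  induction J with
  | zero =>
    rw [show 3 * 0 + 2 = 0 + 1 + 1 by rfl, Finset.sum_Ioc_succ_top (by omega),
      Finset.sum_Ioc_succ_top (by omega)]
    norm_num [coprimeThree_apply]
  | succ J ih =>
    rw [show 3 * (J + 1) + 2 = 3 * J + 2 + 1 + 1 + 1 by ring, Finset.sum_Ioc_succ_top (by omega),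
      Finset.sum_Ioc_succ_top (by omega), Finset.sum_Ioc_succ_top (by omega)]
    have h0 : coprimeThree (3 * J + 2 + 1) = 0 := by
      rw [coprimeThree_apply, if_pos (by omega)]
    have h1 : coprimeThree (3 * J + 2 + 1 + 1) = 1 := by
      rw [coprimeThree_apply, if_neg (by omega)]
    have h2 : coprimeThree (3 * J + 2 + 1 + 1 + 1) = 1 := by
      rw [coprimeThree_apply, if_neg (by omega)]
    have hb := sum_coprimeThree_block_le (j := J + 1) (by omega)
    rw [h0, h1, h2]
    push_cast at hb ⊢
    rw [show (3 : ℝ) * (J + 1) + 1 = 3 * J + 3 + 1 by ring,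
      show (3 : ℝ) * (J + 1) + 2 = 3 * J + 4 + 1 by ring, add_sub_cancel_right] at hb
    rw [zero_div]
    linarith

theorem le_sum_coprimeThree (N : ℕ) :
    2 / 3 * (N : ℝ) ≤ ∑ m ∈ Finset.Ioc 0 N, (coprimeThree m : ℝ) := by
  have key : ∀ J : ℕ, ∑ m ∈ Finset.Ioc 0 (3 * J), (coprimeThree m : ℝ) = 2 * J := by
    intro J
    induction J with
    | zero => simp
    | succ J ih =>
      rw [sum_Ioc_three_mul_succ, ih]
      simp only [coprimeThree_apply]
      rw [if_neg (by omega), if_neg (by omega), if_pos (by omega)]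
      push_cast
      ring
  obtain ⟨J, rfl | rfl | rfl⟩ : ∃ J, N = 3 * J ∨ N = 3 * J + 1 ∨ N = 3 * J + 2 :=
    ⟨N / 3, by omega⟩
  · rw [key]
    push_cast
    linarith
  · rw [Finset.sum_Ioc_succ_top (by omega), key, coprimeThree_apply, if_neg (by omega)]
    push_cast
    linarith
  · rw [Finset.sum_Ioc_succ_top (by omega), Finset.sum_Ioc_succ_top (by omega), key,
      coprimeThree_apply, coprimeThree_apply, if_neg (by omega), if_neg (by omega)]
    push_cast
    linarith

theorem sum_cubicCount_mul_log_le_log (N : ℕ) :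
    ∑ n ∈ Finset.Ioc 0 N, (cubicCount n : ℝ) * Real.log (N / n) ≤
      N * (469 / 600 + 61 / 150 * Real.log ((18 * N + 53) / 53)) := by
  refine (sum_cubicCount_mul_log_le N).trans ?_
  have hsplit : ∑ m ∈ Finset.Ioc 0 N, (coprimeThree m : ℝ) * (61 / 100 * (N / m) - 1 / 5) =
      61 / 100 * N * ∑ m ∈ Finset.Ioc 0 N, (coprimeThree m : ℝ) / m -
        1 / 5 * ∑ m ∈ Finset.Ioc 0 N, (coprimeThree m : ℝ) := by
    rw [Finset.mul_sum, Finset.mul_sum, ← Finset.sum_sub_distrib]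
    exact Finset.sum_congr rfl fun m _ => by ring
  have h1 : ∑ m ∈ Finset.Ioc 0 N, (coprimeThree m : ℝ) / m ≤
      3 / 2 + 2 / 3 * Real.log ((18 * N + 53) / 53) := by
    refine (Finset.sum_le_sum_of_subset_of_nonneg (t := Finset.Ioc 0 (3 * (N / 3) + 2))
      (Finset.Ioc_subset_Ioc_right (by omega)) fun m _ _ => ?_).trans
      ((sum_coprimeThree_div_le (N / 3)).trans ?_)
    · rw [coprimeThree_apply]
      split_ifs <;> simp
    · have hJ : ((N / 3 : ℕ) : ℝ) ≤ N / 3 := Nat.cast_div_le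
      have := Real.log_le_log (x := (54 * (N / 3 : ℕ) + 53) / 53) (by positivity)
        (show (54 * ((N / 3 : ℕ) : ℝ) + 53) / 53 ≤ (18 * N + 53) / 53 by linarith)
      linarith
  have h2 := le_sum_coprimeThree N
  have h3 := mul_le_mul_of_nonneg_left h1 (show (0 : ℝ) ≤ 61 / 100 * N by positivity)
  rw [hsplit]
  linarith

theorem PureCubic.sum_log_absNorm_le {P : ℕ} {K : Type*} [Field K] [NumberField K]
    (h : PureCubic P K) (hP9 : P % 9 ≠ 1 ∧ P % 9 ≠ 8) (h3 : ¬ 3 ∣ P) (N : ℕ)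
    (S : Finset (Ideal (𝓞 K)))
    (hS : ∀ 𝔞 : Ideal (𝓞 K), 𝔞 ∈ S ↔ 𝔞 ≠ ⊥ ∧ Ideal.absNorm 𝔞 ≤ N) :
    ∑ 𝔞 ∈ S, Real.log (N / Ideal.absNorm 𝔞) ≤
      N * (469 / 600 + 61 / 150 * Real.log ((18 * N + 53) / 53)) := by
  classical
  refine le_trans ?_ (sum_cubicCount_mul_log_le_log N)
  rw [← Finset.sum_fiberwise_of_maps_to (s := S) (t := Finset.Ioc 0 N) (g := fun 𝔞 => Ideal.absNorm 𝔞)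
    fun 𝔞 h𝔞 => Finset.mem_Ioc.2 ⟨Nat.pos_of_ne_zero (Ideal.absNorm_ne_zero_of_nonZeroDivisors
      ⟨𝔞, mem_nonZeroDivisors_of_ne_zero ((hS 𝔞).1 h𝔞).1⟩), ((hS 𝔞).1 h𝔞).2⟩]
  refine Finset.sum_le_sum fun n hn => ?_
  rw [Finset.mem_Ioc] at hn
  have hn0 : (0 : ℝ) < n := by exact_mod_cast hn.1
  have hnN : (n : ℝ) ≤ N := by exact_mod_cast hn.2
  rw [Finset.sum_congr rfl fun 𝔞 h𝔞 => by rw [(Finset.mem_filter.1 h𝔞).2], Finset.sum_const,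
    nsmul_eq_mul]
  refine mul_le_mul_of_nonneg_right ?_ (Real.log_nonneg ((one_le_div hn0).2 hnN))
  have h1 := h.ncard_absNorm_le_cubicCount hP9 h3 hn.1.ne'
  have h2 : (S.filter fun 𝔞 => Ideal.absNorm 𝔞 = n).card ≤
      ({𝔞 : Ideal (𝓞 K) | Ideal.absNorm 𝔞 = n}).ncard := by
    rw [← Set.ncard_coe_finset]
    exact Set.ncard_le_ncard (fun 𝔞 h𝔞 => (Finset.mem_filter.1 h𝔞).2)
      (Ideal.finite_setOfPred_absNorm_eq n)
  have h3 : ((S.filter fun 𝔞 => Ideal.absNorm 𝔞 = n).card : ℤ) ≤ cubicCount n :=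
    le_trans (by exact_mod_cast h2) h1
  exact_mod_cast h3

end CubicSumEstimate

section LargeRadicand

theorem log_bounds_of_le {P : ℕ} (hP : 127 ≤ P) :
    (⌈331 / 100 * (P : ℝ)⌉₊ : ℝ) * (469 / 600 + 61 / 150 *
      Real.log ((18 * (⌈331 / 100 * (P : ℝ)⌉₊ : ℝ) + 53) / 53)) <
        2 * P * Real.log (866 / 1000 * P - 3) ∧
    (⌈331 / 100 * (P : ℝ)⌉₊ : ℝ) * (469 / 600 + 61 / 150 *
      Real.log ((18 * (⌈331 / 100 * (P : ℝ)⌉₊ : ℝ) + 53) / 53)) <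
        3 * P * Real.log (2165 / 10000 * P - 3) := by
  have hP' : (127 : ℝ) ≤ P := by exact_mod_cast hP
  have hN := (Nat.ceil_lt_add_one (show (0 : ℝ) ≤ 331 / 100 * P by positivity)).le
  set N : ℝ := (⌈331 / 100 * (P : ℝ)⌉₊ : ℝ) with hNdef
  have hN0 : 0 ≤ N := Nat.cast_nonneg _
  have hNP : N ≤ 3318 / 1000 * P := by linarith
  have hlog2 := Real.log_two_gt_d9
  have hlogP : 4.8441 ≤ Real.log P := by
    have h1 : Real.log 127 ≤ Real.log P := Real.log_le_log (by norm_num) hP'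
    have h2 : Real.log ((127 : ℝ) / 2 ^ 7) = Real.log 127 - 7 * Real.log 2 := by
      rw [Real.log_div (by norm_num) (by norm_num), Real.log_pow]
      norm_num
    have h3 := Real.one_sub_inv_le_log_of_pos (show (0 : ℝ) < 127 / 2 ^ 7 by norm_num)
    norm_num at h3 h2 ⊢
    linarith
  have h1 : Real.log ((18 * N + 53) / 53) ≤ 135 / 1000 + Real.log P := by
    have h : (18 * N + 53) / 53 ≤ 1135 / 1000 * P := by linarith
    refine (Real.log_le_log (by positivity) h).trans ?_
    rw [Real.log_mul (by norm_num) (by positivity)]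
    have := Real.log_le_sub_one_of_pos (show (0 : ℝ) < 1135 / 1000 by norm_num)
    linarith
  have h2 : Real.log P - 18 / 100 ≤ Real.log (866 / 1000 * P - 3) := by
    refine le_trans ?_ (Real.log_le_log (x := 8423 / 10000 * P) (by positivity) (by linarith))
    rw [Real.log_mul (by norm_num) (by positivity)]
    have h := Real.one_sub_inv_le_log_of_pos (show (0 : ℝ) < 9177 / 10000 by norm_num)
    have h' : Real.log ((9177 / 10000 : ℝ) ^ 2) ≤ Real.log (8423 / 10000) :=
      Real.log_le_log (by norm_num) (by norm_num)
    rw [Real.log_pow] at h'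
    norm_num at h h' ⊢
    linarith
  have h3 : Real.log P - 1.69 ≤ Real.log (2165 / 10000 * P - 3) := by
    refine le_trans ?_ (Real.log_le_log (x := 1928 / 10000 * P) (by positivity) (by linarith))
    rw [Real.log_mul (by norm_num) (by positivity)]
    have h := Real.one_sub_inv_le_log_of_pos (show (0 : ℝ) < 7712 / 10000 by norm_num)
    have h' : Real.log (1928 / 10000 : ℝ) = Real.log (7712 / 10000) - 2 * Real.log 2 := by
      rw [show (1928 / 10000 : ℝ) = 7712 / 10000 / 2 ^ 2 by norm_num,
        Real.log_div (by norm_num) (by norm_num), Real.log_pow]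
      norm_num
    have h4 := Real.log_two_lt_d9
    norm_num at h h' ⊢
    linarith
  have h4 : N * (469 / 600 + 61 / 150 * Real.log ((18 * N + 53) / 53)) ≤
      3318 / 1000 * P * (469 / 600 + 61 / 150 * (135 / 1000 + Real.log P)) := by
    refine mul_le_mul hNP (by linarith) ?_ (by positivity)
    have : 0 ≤ Real.log ((18 * N + 53) / 53) := Real.log_nonneg (by linarith)
    linarith
  have hP0 : (0 : ℝ) < P := by positivity
  refine ⟨h4.trans_lt ?_, h4.trans_lt ?_⟩
  · refine lt_of_lt_of_le ?_ (mul_le_mul_of_nonneg_left h2 (by positivity))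
    nlinarith [mul_le_mul_of_nonneg_left hlogP hP0.le]
  · refine lt_of_lt_of_le ?_ (mul_le_mul_of_nonneg_left h3 (by positivity))
    nlinarith [mul_le_mul_of_nonneg_left hlogP hP0.le]

namespace PureCubic

variable {P : ℕ} {K : Type*} [Field K] [NumberField K] (h : PureCubic P K)

include h in
theorem isPrincipal_of_pow_isPrincipal_of_large {p : ℕ} (hp : p.Prime) (hpodd : Odd p)
    (hP : P = 2 * p ∨ P = p) (hP9 : P % 9 ≠ 1 ∧ P % 9 ≠ 8) (hbig : 127 ≤ P)
    {J : Ideal (𝓞 K)} (hJ : J ≠ ⊥) (hJp : (J ^ p).IsPrincipal) : J.IsPrincipal := by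
  classical
  by_contra hJn
  have hp3 : p ≠ 3 := by omega
  have hsq := squarefree_of_eq_two_mul_or_eq hp hpodd hP
  have h3p : ¬ 3 ∣ p := fun h3 => hp3 ((Nat.prime_dvd_prime_iff_eq Nat.prime_three hp).1 h3).symm
  have h3P : ¬ 3 ∣ P := by
    rcases hP with rfl | rfl <;> omega
  obtain ⟨𝔱, h𝔱, -⟩ := h.exists_ideal_pow_three_eq_three hP9 h3P
  have hs1 : (5.196 : ℝ) < √27 := Real.lt_sqrt_of_sq_lt (by norm_num)
  have hs2 : √27 < (5.1962 : ℝ) := (Real.sqrt_lt' (by norm_num)).2 (by norm_num)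
  have hP' : (127 : ℝ) ≤ P := by exact_mod_cast hbig
  set N := ⌈331 / 100 * (P : ℝ)⌉₊ with hN
  have hNX : 2 / Real.pi * (√27 * P) < (N : ℝ) := by
    refine lt_of_lt_of_le ?_ (Nat.le_ceil _)
    rw [div_mul_eq_mul_div, div_lt_iff₀ Real.pi_pos]
    nlinarith [Real.pi_gt_d4]
  set S := (Ideal.finite_setOfPred_absNorm_le (S := 𝓞 K) N).toFinset.filter (· ≠ ⊥) with hSdef
  have hS : ∀ 𝔞 : Ideal (𝓞 K), 𝔞 ∈ S ↔ 𝔞 ≠ ⊥ ∧ Ideal.absNorm 𝔞 ≤ N := fun 𝔞 => by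
    simp [hSdef, and_comm]
  have hsum := h.sum_log_absNorm_le hP9 h3P N S hS
  obtain ⟨hb1, hb2⟩ := log_bounds_of_le hbig
  obtain ⟨r, k, B, hr, hrP, E, hE, hBE, hlt⟩ : ∃ r k B : ℕ,
      (r = 1 ∧ k = 1 ∧ B = 3 ∨ r = 2 ∧ k = 3 ∧ B = 12) ∧ r ∣ P ∧ ∃ E : ℝ, 1 < E ∧
      B * (E + 3) < √27 / 2 * P ∧
      (N : ℝ) * (469 / 600 + 61 / 150 * Real.log ((18 * (N : ℝ) + 53) / 53)) <
        (p * (k * 3) : ℕ) * (2 / 3 * Real.log E) := by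
    rcases hP with rfl | rfl
    · refine ⟨2, 3, 12, by simp, dvd_mul_right _ _, 2165 / 10000 * (2 * p : ℕ) - 3, ?_,
        ?_, hb2.trans_le (le_of_eq ?_)⟩
      · linarith
      · push_cast at hP' ⊢
        nlinarith
      · push_cast
        ring
    · refine ⟨1, 1, 3, by simp, one_dvd _, 866 / 1000 * P - 3, ?_, ?_, hb1.trans_le (le_of_eq ?_)⟩
      · linarith
      · push_cast
        nlinarith
      · push_cast
        ring
  obtain ⟨𝔮, h𝔮, -⟩ := h.exists_ideal_pow_three_of_dvd hsq hrP
  have hr0 : r ≠ 0 := by omega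
  have h𝔮0 : 𝔮 ≠ ⊥ := by
    rintro rfl
    rw [← Ideal.zero_eq_bot, zero_pow (by norm_num), Ideal.zero_eq_bot, eq_comm,
      Ideal.span_singleton_eq_bot] at h𝔮
    exact hr0 (by exact_mod_cast h𝔮)
  have h𝔱0 : 𝔱 ≠ ⊥ := by
    rintro rfl
    rw [← Ideal.zero_eq_bot, zero_pow (by norm_num), Ideal.zero_eq_bot, eq_comm,
      Ideal.span_singleton_eq_bot] at h𝔱
    exact (by norm_num : (3 : 𝓞 K) ≠ 0) h𝔱
  have hcard := h.card_mul_le_sum_log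
    (fun i : Fin p × Fin k × Fin 3 => J ^ i.1.1 * (𝔮 ^ i.2.1.1 * 𝔱 ^ i.2.2.1))
    (fun i => mul_ne_zero (pow_ne_zero _ hJ) (mul_ne_zero (pow_ne_zero _ h𝔮0) (pow_ne_zero _ h𝔱0)))
    (L := 2 / 3 * Real.log E) (X := N) (by have := Real.log_pos hE; positivity)
    (fun i j v v' hv hv' heq hlog => by
      obtain ⟨h1, h2⟩ := h.eq_of_abs_logPos_sub_lt_of_orderOf
        h.eq_zero_of_pow_three_eq (by omega) hr hp hp3 hJ hJp hJn h𝔮 (by simpa using h𝔱)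
        hE.le hBE j i hv hv' heq hlog
      exact ⟨h1.symm, h2⟩)
    hNX S (fun 𝔞 h0 hX => (hS 𝔞).2 ⟨h0, by exact_mod_cast hX.le⟩)
    fun 𝔞 h𝔞 => ⟨((hS 𝔞).1 h𝔞).1, by exact_mod_cast ((hS 𝔞).1 h𝔞).2⟩
  simp only [Fintype.card_prod, Fintype.card_fin] at hcard
  exact absurd (hlt.trans_le (hcard.trans hsum)) (lt_irrefl _)

end PureCubic

end LargeRadicand

/-- Some power of the ideal with exponent not divisible by `p` is principal. -/
def HasPrincipalPow {R : Type*} [CommRing R] (p : ℕ) (I : Ideal R) : Prop :=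
  ∃ k, ¬ p ∣ k ∧ (I ^ k).IsPrincipal

theorem isPrincipal_mul {R : Type*} [CommRing R] {I J : Ideal R} (hI : I.IsPrincipal)
    (hJ : J.IsPrincipal) : (I * J).IsPrincipal := by
  obtain ⟨x, rfl⟩ := hI
  obtain ⟨y, rfl⟩ := hJ
  exact ⟨x * y, by simp [Ideal.submodule_span_eq, Ideal.span_singleton_mul_span_singleton]⟩

theorem isPrincipal_pow {R : Type*} [CommRing R] {I : Ideal R} (hI : I.IsPrincipal) (n : ℕ) :
    (I ^ n).IsPrincipal := by
  obtain ⟨x, rfl⟩ := hI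
  exact ⟨x ^ n, by simp [Ideal.submodule_span_eq, Ideal.span_singleton_pow]⟩

theorem isPrincipal_of_mul_right {R : Type*} [CommRing R] [IsDedekindDomain R] {I J : Ideal R}
    (hJ0 : J ≠ ⊥) (hIJ : (I * J).IsPrincipal) (hJ : J.IsPrincipal) : I.IsPrincipal := by
  obtain ⟨y, hy⟩ := hJ
  obtain ⟨x, hx⟩ := hIJ
  rw [Ideal.submodule_span_eq] at hx hy
  have h1 : x ∈ Ideal.span {y} := by
    rw [← hy]
    exact Ideal.mul_le_right (I := I) (by rw [hx]; exact Ideal.mem_span_singleton_self x)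
  obtain ⟨z, rfl⟩ := Ideal.mem_span_singleton'.1 h1
  refine ⟨z, ?_⟩
  rw [Ideal.submodule_span_eq]
  refine mul_right_cancel₀ (b := J) hJ0 ?_
  rw [hx, hy, Ideal.span_singleton_mul_span_singleton]

namespace HasPrincipalPow

variable {R : Type*} [CommRing R] {p : ℕ} {I J : Ideal R}

theorem of_isPrincipal (hp : p.Prime) (hI : I.IsPrincipal) : HasPrincipalPow p I :=
  ⟨1, fun h => hp.one_lt.ne' (Nat.dvd_one.1 h), by rwa [pow_one]⟩

theorem mul (hp : p.Prime) (hI : HasPrincipalPow p I) (hJ : HasPrincipalPow p J) :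
    HasPrincipalPow p (I * J) := by
  obtain ⟨k, hk, hIk⟩ := hI
  obtain ⟨l, hl, hJl⟩ := hJ
  refine ⟨k * l, hp.not_dvd_mul hk hl, ?_⟩
  rw [mul_pow, pow_mul, mul_comm k l, pow_mul]
  exact isPrincipal_mul (isPrincipal_pow hIk l) (isPrincipal_pow hJl k)

theorem of_pow (hp : p.Prime) {k : ℕ} (hk : ¬ p ∣ k) (hI : HasPrincipalPow p (I ^ k)) :
    HasPrincipalPow p I := by
  obtain ⟨l, hl, hIl⟩ := hI
  exact ⟨k * l, hp.not_dvd_mul hk hl, by rwa [pow_mul]⟩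

theorem of_mul_right [IsDedekindDomain R] (hp : p.Prime) (hJ0 : J ≠ ⊥)
    (hIJ : HasPrincipalPow p (I * J)) (hJ : HasPrincipalPow p J) : HasPrincipalPow p I := by
  obtain ⟨k, hk, hIk⟩ := hIJ
  obtain ⟨l, hl, hJl⟩ := hJ
  refine ⟨k * l, hp.not_dvd_mul hk hl,
    isPrincipal_of_mul_right (J := J ^ (k * l)) (pow_ne_zero _ hJ0) ?_ ?_⟩
  · rw [← mul_pow, pow_mul]
    exact isPrincipal_pow hIk l
  · rw [mul_comm, pow_mul]
    exact isPrincipal_pow hJl k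

theorem isPrincipal [IsDedekindDomain R] (hp : p.Prime) (hI0 : I ≠ ⊥)
    (hI : HasPrincipalPow p I) (hIp : (I ^ p).IsPrincipal) : I.IsPrincipal := by
  obtain ⟨k, hk, hIk⟩ := hI
  have hcop : (p : ℕ).Coprime k := (Nat.Prime.coprime_iff_not_dvd hp).2 hk
  obtain ⟨u, -, hu⟩ := Nat.exists_mul_mod_eq_one_of_coprime hcop.symm hp.one_lt
  refine isPrincipal_of_mul_right (J := I ^ (p * (k * u / p))) (pow_ne_zero _ hI0) ?_ ?_
  · rw [← pow_succ', ← hu, Nat.div_add_mod, pow_mul]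
    exact isPrincipal_pow hIk u
  · rw [pow_mul]
    exact isPrincipal_pow hIp _

theorem of_forall_prime [IsDedekindDomain R] (hp : p.Prime) (hI : I ≠ ⊥)
    (h : ∀ 𝔭 : Ideal R, Prime 𝔭 → 𝔭 ∣ I → HasPrincipalPow p 𝔭) : HasPrincipalPow p I := by
  induction I using UniqueFactorizationMonoid.induction_on_prime with
  | h₁ => exact absurd rfl hI
  | h₂ I hu =>
    rw [Ideal.isUnit_iff.1 hu]
    exact of_isPrincipal hp inferInstance
  | h₃ I 𝔭 hI0 h𝔭 ih =>
    exact (h 𝔭 h𝔭 (dvd_mul_right _ _)).mul hp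
      (ih hI0 fun 𝔮 h𝔮 hd => h 𝔮 h𝔮 (hd.mul_left _))

theorem exists_eq_pow_mul {K : Type*} [Field K] [NumberField K] (hp : p.Prime) {q : ℕ}
    (hq : q.Prime) {𝔮 I : Ideal (𝓞 K)} (hI : I ≠ ⊥)
    (h : ∀ 𝔭 : Ideal (𝓞 K), Prime 𝔭 → 𝔭 ∣ I →
      𝔭 = 𝔮 ∨ HasPrincipalPow p 𝔭 ∧ ¬ q ∣ Ideal.absNorm 𝔭) :
    ∃ (k : ℕ) (J : Ideal (𝓞 K)), I = 𝔮 ^ k * J ∧ HasPrincipalPow p J ∧ ¬ q ∣ Ideal.absNorm J := by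
  induction I using UniqueFactorizationMonoid.induction_on_prime with
  | h₁ => exact absurd rfl hI
  | h₂ I hu =>
    refine ⟨0, ⊤, ?_, of_isPrincipal hp inferInstance, ?_⟩
    · rw [Ideal.isUnit_iff.1 hu, pow_zero, Ideal.one_eq_top, Ideal.top_mul]
    · simpa using hq.one_lt.ne'
  | h₃ I 𝔭 hI0 h𝔭 ih =>
    obtain ⟨k, J, rfl, hJ, hJq⟩ := ih hI0 fun 𝔮 h𝔮 hd => h 𝔮 h𝔮 (hd.mul_left _)
    rcases h 𝔭 h𝔭 (dvd_mul_right _ _) with rfl | ⟨h1, h2⟩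
    · exact ⟨k + 1, J, by ring, hJ, hJq⟩
    · refine ⟨k, 𝔭 * J, by ring, h1.mul hp hJ, ?_⟩
      rw [map_mul]
      exact hq.not_dvd_mul h2 hJq

end HasPrincipalPow

theorem exists_prime_dvd_natCast_mem {R : Type*} [CommRing R] {𝔭 : Ideal R} (h𝔭 : 𝔭.IsPrime)
    {n : ℕ} (hn0 : n ≠ 0) (hn : (n : R) ∈ 𝔭) : ∃ l : ℕ, l.Prime ∧ l ∣ n ∧ (l : R) ∈ 𝔭 := by
  induction n using Nat.recOnMul with
  | zero => exact absurd rfl hn0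
  | one => exact absurd ((Ideal.eq_top_iff_one _).2 (by simpa using hn)) h𝔭.ne_top
  | prime l hl => exact ⟨l, hl, dvd_rfl, hn⟩
  | mul a b iha ihb =>
    rw [Nat.cast_mul] at hn
    rw [mul_ne_zero_iff] at hn0
    rcases h𝔭.mem_or_mem hn with h | h
    · obtain ⟨l, hl, hd, hm⟩ := iha hn0.1 h
      exact ⟨l, hl, hd.mul_right _, hm⟩
    · obtain ⟨l, hl, hd, hm⟩ := ihb hn0.2 h
      exact ⟨l, hl, hd.mul_left _, hm⟩

/-- Every prime ideal above `l` has a principal power with exponent prime to `p`. -/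
def PrimesHavePrincipalPow (p : ℕ) (K : Type*) [Field K] (l : ℕ) : Prop :=
  ∀ 𝔭 : Ideal (𝓞 K), Prime 𝔭 → (l : 𝓞 K) ∈ 𝔭 → HasPrincipalPow p 𝔭

namespace PureCubic

variable {P : ℕ} {K : Type*} [Field K] [NumberField K] (h : PureCubic P K)

include h in
theorem primesHavePrincipalPow_of_absNorm {p q : ℕ} (hp : p.Prime) (hq : q.Prime)
    (H : ∀ 𝔮 : Ideal (𝓞 K), Ideal.absNorm 𝔮 = q → HasPrincipalPow p 𝔮) :
    PrimesHavePrincipalPow p K q := by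
  intro 𝔭 h𝔭 hq𝔭
  obtain ⟨𝔟, h𝔟⟩ : 𝔭 ∣ Ideal.span {(q : 𝓞 K)} := by rwa [Ideal.dvd_span_singleton]
  have hN := h.absNorm_span_natCast q
  have hq0 : Ideal.span {(q : 𝓞 K)} ≠ ⊥ := by
    rw [Ne, Ideal.span_singleton_eq_bot]
    exact_mod_cast hq.ne_zero
  have hprin : (Ideal.span {(q : 𝓞 K)}).IsPrincipal := ⟨q, rfl⟩
  have h𝔟0 : 𝔟 ≠ ⊥ := by
    rintro rfl
    rw [Ideal.mul_bot] at h𝔟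
    exact hq0 h𝔟
  rw [h𝔟, map_mul] at hN
  obtain ⟨f, hf, hfN⟩ := (Nat.dvd_prime_pow hq).1 ⟨_, hN.symm⟩
  obtain rfl | rfl | rfl | rfl : f = 0 ∨ f = 1 ∨ f = 2 ∨ f = 3 := by omega
  · rw [pow_zero, Ideal.absNorm_eq_one_iff] at hfN
    exact absurd hfN (Ideal.isPrime_of_prime h𝔭).ne_top
  · exact H 𝔭 (by rw [hfN, pow_one])
  · refine HasPrincipalPow.of_mul_right hp h𝔟0 (h𝔟 ▸ .of_isPrincipal hp hprin) (H 𝔟 ?_)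
    rw [hfN] at hN
    exact Nat.eq_of_mul_eq_mul_left (pow_pos hq.pos 2) (by rw [hN]; ring)
  · rw [hfN] at hN
    have h1 : Ideal.absNorm 𝔟 = 1 :=
      Nat.eq_of_mul_eq_mul_left (pow_pos hq.pos 3) (by rw [hN, mul_one])
    rw [Ideal.absNorm_eq_one_iff] at h1
    rw [h1, Ideal.mul_top] at h𝔟
    exact .of_isPrincipal hp (h𝔟 ▸ hprin)

include h in
theorem not_dvd_absNorm_of_mem {q l : ℕ} (hq : q.Prime) (hl : l.Prime) (hql : q ≠ l)
    {𝔭 : Ideal (𝓞 K)} (hl𝔭 : (l : 𝓞 K) ∈ 𝔭) : ¬ q ∣ Ideal.absNorm 𝔭 := by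
  intro hd
  have h1 := Ideal.absNorm_dvd_absNorm_of_le ((Ideal.span_singleton_le_iff_mem _).2 hl𝔭)
  rw [h.absNorm_span_natCast] at h1
  exact hql ((Nat.prime_dvd_prime_iff_eq hq hl).1 (hq.dvd_of_dvd_pow (hd.trans h1)))

theorem natCast_dvd_elt {q : ℕ} {a b c : ℤ} (hd : (q : 𝓞 K) ∣ h.elt a b c) :
    (q : ℤ) ∣ a ∧ (q : ℤ) ∣ b ∧ (q : ℤ) ∣ c := by
  obtain ⟨v, hv⟩ := hd
  obtain ⟨x, y, z, rfl⟩ := h.exists_elt v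
  have : (q : 𝓞 K) * h.elt x y z = h.elt (q * x) (q * y) (q * z) := by
    simp only [elt]; push_cast; ring
  rw [this, h.elt_inj] at hv
  exact ⟨⟨_, hv.1⟩, ⟨_, hv.2.1⟩, ⟨_, hv.2.2⟩⟩

theorem hasPrincipalPow_of_norm {p q : ℕ} (hp : p.Prime) (hq : q.Prime) {𝔮 : Ideal (𝓞 K)}
    (hN : Ideal.absNorm 𝔮 = q) {r : ℤ} (hr : h.rt - r ∈ 𝔮) {B : ℕ} (hqB : ¬ q ∣ B)
    (hB : ∀ l : ℕ, l.Prime → l ∣ B → PrimesHavePrincipalPow p K l) {a b c : ℤ} {k : ℕ}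
    (hk : ¬ p ∣ k) (hw : (q : ℤ) ∣ a + b * r + c * r ^ 2) {N : ℕ}
    (hNw : (a ^ 3 + P * b ^ 3 + P ^ 2 * c ^ 3 - 3 * P * a * b * c : ℤ).natAbs = N) (hN0 : N ≠ 0)
    (hqk : q ^ k ∣ N) {e : ℕ} (hNB : N ∣ q ^ k * B ^ e)
    (hor : k = 1 ∨ q % 3 = 2 ∧ ¬ ((q : ℤ) ∣ a ∧ (q : ℤ) ∣ b ∧ (q : ℤ) ∣ c)) :
    HasPrincipalPow p 𝔮 := by
  set w := h.elt a b c with hw_def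
  have hNI : Ideal.absNorm (Ideal.span {w}) = N := by
    rw [Ideal.absNorm_span_singleton, h.norm_elt, hNw]
  have h𝔮t : 𝔮 ≠ ⊤ := by
    rintro rfl
    rw [Ideal.absNorm_top] at hN
    exact hq.one_lt.ne hN
  have hq𝔮 : (q : 𝓞 K) ∈ 𝔮 := by
    have := Ideal.absNorm_mem 𝔮
    rwa [hN] at this
  have h𝔮0 : 𝔮 ≠ ⊥ := by
    rintro rfl
    rw [Ideal.absNorm_bot] at hN
    exact hq.ne_zero hN.symm
  have h𝔮P : Prime 𝔮 :=
    Ideal.prime_of_isPrime h𝔮0 (Ideal.isPrime_of_irreducible_absNorm (by rw [hN]; exact hq))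
  have hI0 : Ideal.span {w} ≠ ⊥ := by
    intro h0
    rw [h0, Ideal.absNorm_bot] at hNI
    exact hN0 hNI.symm
  have hw𝔮 : 𝔮 ∣ Ideal.span {w} := by
    rw [Ideal.dvd_span_singleton, h.elt_mem_iff hr, intCast_mem_iff hq h𝔮t hq𝔮]
    exact hw
  have hqBe : ¬ q ∣ B ^ e := fun hd => hqB (hq.dvd_of_dvd_pow hd)
  have hover : ∀ 𝔭 : Ideal (𝓞 K), Prime 𝔭 → 𝔭 ∣ Ideal.span {w} → (q : 𝓞 K) ∈ 𝔭 → 𝔭 = 𝔮 := by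
    intro 𝔭 h𝔭 hd hq𝔭
    by_contra hne
    have hmul : ∀ {I : Ideal (𝓞 K)}, 𝔭 ∣ I → 𝔮 ∣ I → 𝔭 * 𝔮 ∣ I := by
      rintro _ ⟨J, rfl⟩ h2
      refine mul_dvd_mul_left _ ((h𝔮P.dvd_or_dvd h2).resolve_left fun h3 => hne ?_)
      exact (associated_iff_eq.1 (h𝔮P.associated_of_dvd h𝔭 h3)).symm
    have h1 := map_dvd Ideal.absNorm (hmul hd hw𝔮)
    obtain ⟨S, f, hS, hf, hsum⟩ := exists_finset_primes h.finrank_eq hq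
    have h𝔭S := (hS 𝔭).2 ⟨h𝔭, hq𝔭⟩
    have h𝔮S := (hS 𝔮).2 ⟨h𝔮P, hq𝔮⟩
    obtain ⟨hf0, hfN⟩ := hf 𝔭 h𝔭S
    rw [map_mul, hN, hfN, hNI] at h1
    rcases hor with rfl | ⟨hq3, hndvd⟩
    · rw [pow_one] at hNB
      have h2 : q * q ∣ q * B ^ e :=
        ((Nat.mul_dvd_mul_right (dvd_pow_self q hf0.ne') q).trans h1).trans hNB
      exact hqBe (Nat.dvd_of_mul_dvd_mul_left hq.pos h2)
    · have hle : f 𝔭 + f 𝔮 ≤ 3 := by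
        refine le_trans ?_ hsum
        classical
        rw [← Finset.sum_pair hne]
        exact Finset.sum_le_sum_of_subset (by
          intro x hx
          rcases Finset.mem_insert.1 hx with rfl | hx
          · exact h𝔭S
          · rw [Finset.mem_singleton.1 hx]
            exact h𝔮S)
      have hf𝔮 : 0 < f 𝔮 := (hf 𝔮 h𝔮S).1
      obtain hf1 | hf2 : f 𝔭 = 1 ∨ f 𝔭 = 2 := by omega
      · have h2 := h.ncard_absNorm_eq_prime_pow_le_of_mod_three hq hq3 1
        refine hne ((Set.ncard_le_one ?_).1 h2 𝔭 ?_ 𝔮 ?_)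
        · exact Ideal.finite_setOfPred_absNorm_eq _
        · simp [hfN, hf1]
        · simp [hN]
      · have h2 : 𝔭 * 𝔮 ∣ Ideal.span {(q : 𝓞 K)} :=
          hmul (by rwa [Ideal.dvd_span_singleton]) (by rwa [Ideal.dvd_span_singleton])
        obtain ⟨J, hJ⟩ := h2
        have h3 := congrArg Ideal.absNorm hJ
        rw [h.absNorm_span_natCast, map_mul, map_mul, hfN, hf2, hN] at h3
        have h4 : Ideal.absNorm J = 1 :=
          Nat.eq_of_mul_eq_mul_left (pow_pos hq.pos 3) (by linarith)
        rw [Ideal.absNorm_eq_one_iff] at h4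
        rw [h4, Ideal.mul_top] at hJ
        have h5 := hmul hd hw𝔮
        rw [← hJ, Ideal.dvd_iff_le, Ideal.span_singleton_le_span_singleton] at h5
        exact hndvd (h.natCast_dvd_elt h5)
  obtain ⟨j, J, hIJ, hJ, hJq⟩ := HasPrincipalPow.exists_eq_pow_mul hp hq (𝔮 := 𝔮) hI0 (by
    intro 𝔭 h𝔭 hd
    have hP := Ideal.isPrime_of_prime h𝔭
    have h1 : ((q ^ k * B ^ e : ℕ) : 𝓞 K) ∈ 𝔭 := by
      obtain ⟨m, hm⟩ := hNB
      rw [hm, Nat.cast_mul]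
      refine 𝔭.mul_mem_right _ (Ideal.dvd_iff_le.1 hd ?_)
      rw [← hNI]
      exact Ideal.absNorm_mem _
    rw [Nat.cast_mul, Nat.cast_pow, Nat.cast_pow] at h1
    rcases hP.mem_or_mem h1 with h1 | h1
    · exact .inl (hover 𝔭 h𝔭 hd (hP.mem_of_pow_mem _ h1))
    · obtain ⟨l, hl, hlB, hl𝔭⟩ := exists_prime_dvd_natCast_mem hP
        (by rintro rfl; exact hqB (dvd_zero _)) (hP.mem_of_pow_mem _ h1)
      refine .inr ⟨hB l hl hlB 𝔭 h𝔭 hl𝔭, h.not_dvd_absNorm_of_mem hq hl ?_ hl𝔭⟩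
      rintro rfl
      exact hqB hlB)
  have hJ0 : J ≠ ⊥ := by
    rintro rfl
    rw [Ideal.mul_bot] at hIJ
    exact hI0 hIJ
  have hNJ : N = q ^ j * Ideal.absNorm J := by
    rw [← hNI, hIJ, map_mul, map_pow, hN]
  have hjk : j = k := by
    refine le_antisymm ?_ ?_
    · have h1 : q ^ j ∣ q ^ k * B ^ e := (Dvd.intro _ hNJ.symm).trans hNB
      have h2 := (Nat.Coprime.pow_left j
        ((Nat.Prime.coprime_iff_not_dvd hq).2 hqBe)).dvd_of_dvd_mul_right h1
      exact (Nat.pow_dvd_pow_iff_le_right hq.one_lt).1 h2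
    · rw [hNJ] at hqk
      have h2 := (Nat.Coprime.pow_left k
        ((Nat.Prime.coprime_iff_not_dvd hq).2 hJq)).dvd_of_dvd_mul_right hqk
      exact (Nat.pow_dvd_pow_iff_le_right hq.one_lt).1 h2
  subst hjk
  refine .of_pow hp hk (.of_mul_right hp hJ0 (hIJ ▸ .of_isPrincipal hp ⟨w, rfl⟩) hJ)

end PureCubic

/-- A check that `a + b θ + c θ ^ 2` with `θ ^ 3 = P` shows that the prime ideal `(q, θ - r)` has a
principal power with exponent prime to `p`, given the same for the primes above divisors of `B`. -/
def primeIdealCheck (P p q r B : ℕ) (w : ℤ × ℤ × ℤ) (k : ℕ) : Bool :=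
  let N := (w.1 ^ 3 + P * w.2.1 ^ 3 + P ^ 2 * w.2.2 ^ 3 - 3 * P * w.1 * w.2.1 * w.2.2).natAbs
  decide ((q : ℤ) ∣ w.1 + w.2.1 * r + w.2.2 * r ^ 2) && (decide (N ≠ 0) && (decide (q ^ k ∣ N) &&
    (decide (N ∣ q ^ k * B ^ 20) && (decide (¬ p ∣ k) && decide (k = 1 ∨ q % 3 = 2 ∧
      ¬ ((q : ℤ) ∣ w.1 ∧ (q : ℤ) ∣ w.2.1 ∧ (q : ℤ) ∣ w.2.2))))))

/-- Small elements that are likely to lie in the prime ideal `(q, θ - r)`. -/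
def primeIdealCandidates (q r : ℕ) : List (ℤ × ℤ × ℤ) :=
  ([1, 2, 3].flatMap fun b : ℤ => [-1, 0, 1, -2].map fun i : ℤ => (-b * r % q + i * q, b, 0)) ++
    [(-5, -2, 1), (5, -1, 0), (5, 1, 0), (-27, 2, 1), (27, -28, 5), (19, 4, 1), (-31, 2, 1),
      (114, -24, 0), (61, -10, 1)]

/-- A check that the prime ideals above the primes in a list have principal powers with exponent
prime to `p`, given the same for the primes dividing `B`. -/
def primesCheck (P p : ℕ) : List ℕ → ℕ → Bool
  | [], _ => true
  | q :: L, B =>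
    (decide (q ∣ B) || (List.range q).all fun r => !decide (r ^ 3 % q = P % q) ||
      (primeIdealCandidates q r).any fun w =>
        [1, 2, 4, 5, 6].any fun k => primeIdealCheck P p q r B w k) &&
      primesCheck P p L (B * q)

theorem PureCubic.primesHavePrincipalPow_of_primesCheck {P : ℕ} {K : Type*} [Field K]
    [NumberField K] (h : PureCubic P K) {p : ℕ} (hp : p.Prime) (L : List ℕ)
    (hL : ∀ q ∈ L, q.Prime) {B : ℕ}
    (hB : ∀ l : ℕ, l.Prime → l ∣ B → PrimesHavePrincipalPow p K l)
    (hcheck : primesCheck P p L B = true) : ∀ q ∈ L, PrimesHavePrincipalPow p K q := by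
  induction L generalizing B with
  | nil => simp
  | cons q L ih =>
    rw [primesCheck, Bool.and_eq_true, Bool.or_eq_true, decide_eq_true_eq] at hcheck
    obtain ⟨hq, hrest⟩ := hcheck
    have hqP : q.Prime := hL q (by simp)
    have hQ : PrimesHavePrincipalPow p K q := by
      by_cases hqB : q ∣ B
      · exact hB q hqP hqB
      refine h.primesHavePrincipalPow_of_absNorm hp hqP fun 𝔮 hN => ?_
      obtain ⟨r, hr, hrP⟩ := h.exists_root_of_absNorm_prime hqP hN
      have hq0 : (0 : ℤ) < q := by exact_mod_cast hqP.pos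
      obtain ⟨s, hs⟩ := Int.eq_ofNat_of_zero_le (Int.emod_nonneg r hq0.ne')
      have hsq : s < q := by have := Int.emod_lt_of_pos r hq0; omega
      have hrs : (q : ℤ) ∣ r - s := by
        rw [← hs]
        exact Int.dvd_self_sub_emod
      have hq𝔮 : (q : 𝓞 K) ∈ 𝔮 := by
        have := Ideal.absNorm_mem 𝔮
        rwa [hN] at this
      have h𝔮t : 𝔮 ≠ ⊤ := by
        rintro rfl
        rw [Ideal.absNorm_top] at hN
        exact hqP.one_lt.ne hN
      have hs𝔮 : h.rt - (s : ℤ) ∈ 𝔮 := by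
        convert 𝔮.add_mem hr ((PureCubic.intCast_mem_iff hqP h𝔮t hq𝔮 _).2 hrs) using 1
        push_cast
        ring
      have hsP : s ^ 3 % q = P % q := by
        have h1 : (q : ℤ) ∣ (s : ℤ) ^ 3 - P := by
          have h2 := (hrs.trans (sub_dvd_pow_sub_pow r s 3))
          have := Int.dvd_sub hrP h2
          convert this using 1
          ring
        have h4 : ((s ^ 3 : ℕ) : ℤ) % (q : ℤ) = (P : ℤ) % q := by
          push_cast
          exact Int.emod_eq_emod_iff_emod_sub_eq_zero.2 (Int.emod_eq_zero_of_dvd h1)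
        exact_mod_cast h4
      have h1 := List.all_eq_true.1 (hq.resolve_left hqB) s (List.mem_range.2 hsq)
      rw [Bool.or_eq_true, decide_eq_true hsP] at h1
      obtain ⟨⟨a, b, c⟩, -, h2⟩ := List.any_eq_true.1 (h1.resolve_left (by simp))
      obtain ⟨k, -, h3⟩ := List.any_eq_true.1 h2
      simp only [primeIdealCheck, Bool.and_eq_true, decide_eq_true_eq] at h3
      obtain ⟨hw, hN0, hqk, hNB, hk, hor⟩ := h3
      exact h.hasPrincipalPow_of_norm hp hqP hN hs𝔮 hqB hB hk hw rfl hN0 hqk hNB hor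
    intro l hl
    rcases List.mem_cons.1 hl with rfl | hl
    · exact hQ
    refine ih (fun q hq => hL q (List.mem_cons_of_mem _ hq)) (fun l hl hd => ?_) hrest l hl
    rcases hl.dvd_mul.1 hd with hd | hd
    · exact hB l hl hd
    · rwa [(Nat.prime_dvd_prime_iff_eq hl hqP).1 hd]

/-- The primes less than `187`. -/
def smallPrimes : List ℕ := [2, 3, 5, 7, 11, 13, 17, 19, 23, 29, 31, 37, 41, 43, 47, 53, 59, 61, 67,
  71, 73, 79, 83, 89, 97, 101, 103, 107, 109, 113, 127, 131, 137, 139, 149, 151, 157, 163, 167, 173,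
  179, 181]

theorem mem_smallPrimes_iff {q : ℕ} (hq : q < 187) : q ∈ smallPrimes ↔ q.Prime := by
  revert q
  decide +kernel

theorem primesCheck_eq_true : ∀ p ∈ smallPrimes, p ≠ 2 → ∀ P ∈ [p, 2 * p], P < 127 → P % 9 ≠ 1 →
    P % 9 ≠ 8 → primesCheck P p (smallPrimes.filter fun q => decide (100 * q ≤ 148 * P))
      (if p = 3 then 1 else 3 * P) = true := by
  decide +kernel

section SmallRadicand

open nonZeroDivisors

namespace PureCubic

variable {P : ℕ} {K : Type*} [Field K] [NumberField K] (h : PureCubic P K)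

include h in
theorem exists_ideal_absNorm_le (hP : 0 < P) {I : Ideal (𝓞 K)} (hI : I ≠ ⊥) :
    ∃ (J : Ideal (𝓞 K)) (x y : 𝓞 K), J ≠ ⊥ ∧ 100 * Ideal.absNorm J ≤ 148 * P ∧ x ≠ 0 ∧ y ≠ 0 ∧
      Ideal.span {x} * I = Ideal.span {y} * J := by
  obtain ⟨J, hJ, hJN⟩ := NumberField.exists_ideal_in_class_of_norm_le
    (ClassGroup.mk0 ⟨I, mem_nonZeroDivisors_iff_ne_zero.2 hI⟩)
  obtain ⟨x, y, hx, hy, hxy⟩ := ClassGroup.mk0_eq_mk0_iff.1 hJ.symm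
  refine ⟨J, x, y, nonZeroDivisors.coe_ne_zero J, ?_, hx, hy, hxy⟩
  rw [h.nrComplexPlaces_eq, h.finrank_eq, h.discr_eq] at hJN
  have hs : √27 < (5.1962 : ℝ) := (Real.sqrt_lt' (by norm_num)).2 (by norm_num)
  have hP' : (0 : ℝ) < P := by exact_mod_cast hP
  have hsq : √|((-27 * (P : ℤ) ^ 2 : ℤ) : ℝ)| = √27 * P := by
    push_cast
    rw [abs_mul, abs_of_nonneg (by positivity : (0 : ℝ) ≤ (P : ℝ) ^ 2),
      Real.sqrt_mul (by positivity), Real.sqrt_sq hP'.le]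
    norm_num
  rw [hsq] at hJN
  have h1 : (4 / Real.pi) ^ 1 * (((Nat.factorial 3 : ℕ) : ℝ) / ((3 : ℕ) : ℝ) ^ 3 * (√27 * P)) ≤
      148 / 100 * P := by
    rw [pow_one, div_mul_eq_mul_div, div_le_iff₀ Real.pi_pos]
    norm_num [Nat.factorial]
    nlinarith [Real.pi_gt_d4]
  have h2 := hJN.trans h1
  have h3 : (100 * Ideal.absNorm (J : Ideal (𝓞 K)) : ℝ) ≤ 148 * P := by linarith
  exact_mod_cast h3

include h in
theorem isPrincipal_of_primesHavePrincipalPow (hP : 0 < P) {p : ℕ} (hp : p.Prime)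
    (H : ∀ q : ℕ, q.Prime → 100 * q ≤ 148 * P → PrimesHavePrincipalPow p K q)
    {I : Ideal (𝓞 K)} (hI : I ≠ ⊥) (hIp : (I ^ p).IsPrincipal) : I.IsPrincipal := by
  obtain ⟨J, x, y, hJ0, hJN, hx, hy, hxy⟩ := h.exists_ideal_absNorm_le hP hI
  have hN0 : Ideal.absNorm J ≠ 0 := by rwa [Ne, Ideal.absNorm_eq_zero_iff]
  have hJ : HasPrincipalPow p J := .of_forall_prime hp hJ0 fun 𝔭 h𝔭 hd => by
    obtain ⟨q, hq, hqN, hq𝔭⟩ := exists_prime_dvd_natCast_mem (Ideal.isPrime_of_prime h𝔭) hN0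
      (Ideal.dvd_iff_le.1 hd (Ideal.absNorm_mem J))
    have := Nat.le_of_dvd (Nat.pos_of_ne_zero hN0) hqN
    exact H q hq (by omega) 𝔭 h𝔭 hq𝔭
  refine HasPrincipalPow.isPrincipal hp hI (.of_mul_right hp (J := Ideal.span {x}) ?_ ?_
    (.of_isPrincipal hp ⟨x, rfl⟩)) hIp
  · rwa [Ne, Ideal.span_singleton_eq_bot]
  · rw [mul_comm, hxy]
    exact (HasPrincipalPow.of_isPrincipal hp ⟨y, rfl⟩).mul hp hJ

include h in
theorem primesHavePrincipalPow_of_pow_three {p : ℕ} (hp : p.Prime) (hp3 : p ≠ 3) {q : ℕ}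
    (hq : q.Prime) (hq3 : ∃ 𝔮 : Ideal (𝓞 K), 𝔮 ^ 3 = Ideal.span {(q : 𝓞 K)}) :
    PrimesHavePrincipalPow p K q := by
  obtain ⟨𝔮, h𝔮⟩ := hq3
  intro 𝔭 h𝔭 hq𝔭
  rw [h.eq_of_mem_of_pow_three hq h𝔮 h𝔭 hq𝔭]
  exact ⟨3, fun hd => hp3 ((Nat.prime_dvd_prime_iff_eq hp Nat.prime_three).1 hd),
    h𝔮 ▸ ⟨(q : 𝓞 K), rfl⟩⟩

include h in
theorem isPrincipal_of_pow_isPrincipal_of_small {p : ℕ} (hp : p.Prime)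
    (hpodd : Odd p) (hP : P = 2 * p ∨ P = p) (hP9 : P % 9 ≠ 1 ∧ P % 9 ≠ 8) (hsmall : P < 127)
    {I : Ideal (𝓞 K)} (hI : I ≠ ⊥) (hIp : (I ^ p).IsPrincipal) : I.IsPrincipal := by
  have hp0 := hp.pos
  have hsq := squarefree_of_eq_two_mul_or_eq hp hpodd hP
  have hcheck := primesCheck_eq_true p ((mem_smallPrimes_iff (by omega)).2 hp)
    (by rintro rfl; exact absurd hpodd (by decide)) P (by simpa using hP.symm) hsmall hP9.1 hP9.2
  have hL : ∀ q : ℕ, q ∈ smallPrimes.filter (fun q => decide (100 * q ≤ 148 * P)) ↔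
      q.Prime ∧ 100 * q ≤ 148 * P := by
    intro q
    rw [List.mem_filter, decide_eq_true_eq]
    exact and_congr_left fun hq => mem_smallPrimes_iff (by omega)
  refine h.isPrincipal_of_primesHavePrincipalPow (by omega) hp (fun q hq hqP =>
    h.primesHavePrincipalPow_of_primesCheck hp _ (fun q hq => ((hL q).1 hq).1) ?_ hcheck q
      ((hL q).2 ⟨hq, hqP⟩)) hI hIp
  intro l hl hd
  split_ifs at hd with hp3
  · exact absurd (Nat.dvd_one.1 hd) hl.ne_one
  by_cases hlP : l ∣ P
  · obtain ⟨𝔮, h𝔮, -⟩ := h.exists_ideal_pow_three_of_dvd hsq hlP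
    exact h.primesHavePrincipalPow_of_pow_three hp hp3 hl ⟨𝔮, h𝔮⟩
  · obtain rfl : l = 3 :=
      (Nat.prime_dvd_prime_iff_eq hl Nat.prime_three).1 ((hl.dvd_mul.1 hd).resolve_right hlP)
    obtain ⟨𝔮, h𝔮, -⟩ := h.exists_ideal_pow_three_eq_three hP9 hlP
    exact h.primesHavePrincipalPow_of_pow_three hp hp3 hl ⟨𝔮, by simpa using h𝔮⟩

end PureCubic

end SmallRadicand

end PureCubicFields

/-- **Proposition 3.3** (Fujiwara-style descent for `x³ + P^ι y³ = l^m z^n`). -/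
theorem fujiwara_descent
    (p : ℕ) (hp : p.Prime) (hpodd : Odd p)
    (P : ℕ) (hP : P = 2 * p ∨ P = p) (hP9 : P % 9 ≠ 1 ∧ P % 9 ≠ 8)
    (α β γ : ℤ) (ε : ℝ)
    (hε : ε = (α : ℝ) + (β : ℝ) * cbrt P + (γ : ℝ) * (cbrt P) ^ 2)
    (hfund : IsFundamentalUnit P ε)
    (ι : ℕ)
    (hι : (ι = 1 ∧ (¬ (p : ℤ) ∣ β ∨ ((p : ℤ) ∣ β ∧ (p : ℤ) ∣ γ))) ∨
          (ι = 2 ∧ (p : ℤ) ∣ β ∧ ¬ (p : ℤ) ∣ γ))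
    (l : ℕ) (hl : l.Prime) (hlP : ¬ l ∣ P) (hl3 : l % 3 = 2)
    (m : ℕ) (hm : 1 ≤ m)
    (a b c : ℤ)
    -- (1) `l = a³ + b³ P^ι + c³ P^{2ι} - 3 a b c P^ι`
    (h1 : (l : ℤ) = a ^ 3 + b ^ 3 * (P : ℤ) ^ ι + c ^ 3 * (P : ℤ) ^ (2 * ι)
      - 3 * a * b * c * (P : ℤ) ^ ι)
    -- (2) if `A_k + B_k π^ι + C_k π^{2ι} = ε^k (a + bπ^ι + cπ^{2ι})^m`
    --     with `A_k, B_k, C_k ∈ ℤ`, then `C_k ≢ 0 (mod p)`, for every `k ∈ ℤ`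
    (h2 : ∀ (k : ℤ) (A B C : ℤ),
      (A : ℝ) + (B : ℝ) * (cbrt P) ^ ι + (C : ℝ) * (cbrt P) ^ (2 * ι)
        = ε ^ k * ((a : ℝ) + (b : ℝ) * (cbrt P) ^ ι + (c : ℝ) * (cbrt P) ^ (2 * ι)) ^ m
      → ¬ (p : ℤ) ∣ C) :
    ∀ n : ℕ, 5 ≤ n → p ^ ι ∣ n →
      ∀ x y z : ℤ, Int.gcd x (Int.gcd y z) = 1 →
        x ^ 3 + (P : ℤ) ^ ι * y ^ 3 = (l : ℤ) ^ m * z ^ n →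
        (l : ℤ) ∣ x ∧ (l : ℤ) ∣ y := by
  have hsq := squarefree_of_eq_two_mul_or_eq hp hpodd hP
  obtain ⟨K, _, _, ⟨h⟩⟩ := exists_pureCubic (by have := hp.two_le; omega) hsq hP9
  intro n hn hpn x y z hprim heq
  refine h.dvd_of_solution hp hpodd hP hP9 (fun J hJ hJp => ?_) hε hfund
    (hι.imp And.left fun hι => ⟨hι.1, hι.2.1⟩) hl hlP hl3 hm h1 h2 hn hpn hprim heq
  rcases lt_or_ge P 127 with hP' | hP'
  · exact h.isPrincipal_of_pow_isPrincipal_of_small hp hpodd hP hP9 hP' hJ hJp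
  · exact h.isPrincipal_of_pow_isPrincipal_of_large hp hpodd hP hP9 hP' hJ hJp
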